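/- Assume e is a principal nilpotent element, i.e. dim ker(ad e) equals the rank of g. Then g(i) = 0 for every odd i, and, setting m := ⊕_{i < 0} g(i), the natural linear map Z(U) → U/U·m_χ (inclusion of the center followed by the quotient map) is injective with image equal to the invariant subspace {a + U·m_χ : [ξ,a] ∈ U·m_χ for all ξ ∈ m}; in particular the W-algebra U(g,e) = (U/U·m_χ)^{ad m} is isomorphic to the center Z(U). -/

import Mathlib

namespace KK
open MvPolynomial

section Filt
variable {K : Type*} [Field K] {ι : Type*}

/-- Polynomials all of whose monomials have `z`-weight at least `k`. -/
def Fil (z : ι → ℕ) (k : ℕ) : Ideal (MvPolynomial ι K) where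
  carrier := {p | ∀ d, coeff d p ≠ 0 → k ≤ Finsupp.weight z d}
  zero_mem' := by intro d hd; simp at hd
  add_mem' := by
    intro p q hp hq d hd
    rw [coeff_add] at hd
    by_cases h : coeff d p = 0
    · exact hq d (by simpa [h] using hd)
    · exact hp d h
  smul_mem' := by
    classical
    intro c p hp d hd
    rw [smul_eq_mul, coeff_mul] at hd
    obtain ⟨x, hx, hx'⟩ := Finset.exists_ne_zero_of_sum_ne_zero hd
    have h1 := hp x.2 (right_ne_zero_of_mul hx')
    rw [Finset.HasAntidiagonal.mem_antidiagonal] at hx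
    rw [← hx, map_add]; omega

variable {z : ι → ℕ}

theorem mem_Fil {k : ℕ} {p : MvPolynomial ι K} :
    p ∈ Fil z k ↔ ∀ d, coeff d p ≠ 0 → k ≤ Finsupp.weight z d := Iff.rfl

theorem Fil_zero (p : MvPolynomial ι K) : p ∈ Fil z 0 := fun _ _ => Nat.zero_le _

theorem Fil_mono {j k : ℕ} (h : j ≤ k) : Fil (K := K) z k ≤ Fil z j :=
  fun _ hp d hd => h.trans (hp d hd)

theorem Fil_mul {j k : ℕ} {p q : MvPolynomial ι K} (hp : p ∈ Fil z j) (hq : q ∈ Fil z k) :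
    p * q ∈ Fil z (j + k) := by
  classical
  intro d hd
  rw [coeff_mul] at hd
  obtain ⟨x, hx, hx'⟩ := Finset.exists_ne_zero_of_sum_ne_zero hd
  have h1 := hp x.1 (left_ne_zero_of_mul hx')
  have h2 := hq x.2 (right_ne_zero_of_mul hx')
  rw [Finset.HasAntidiagonal.mem_antidiagonal] at hx
  rw [← hx, map_add]; omega

theorem Fil_mul' {j k l : ℕ} {p q : MvPolynomial ι K} (hp : p ∈ Fil z j) (hq : q ∈ Fil z k)
    (h : l ≤ j + k) : p * q ∈ Fil z l := Fil_mono h (Fil_mul hp hq)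

theorem Fil_smul {k : ℕ} {p : MvPolynomial ι K} (c : K) (hp : p ∈ Fil z k) : c • p ∈ Fil z k := by
  rw [smul_eq_C_mul]; exact Ideal.mul_mem_left _ _ hp

theorem Fil_X (i : ι) : (X i : MvPolynomial ι K) ∈ Fil z (z i) := by
  classical
  intro d hd
  rw [coeff_X] at hd
  have : Finsupp.single i 1 = d := by by_contra h; simp [h] at hd
  rw [← this, Finsupp.weight_single]; simp

/-- leading component -/
noncomputable def Cp (z : ι → ℕ) (k : ℕ) (p : MvPolynomial ι K) : MvPolynomial ι K :=
  weightedHomogeneousComponent z k p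

theorem coeff_Cp (k : ℕ) (p : MvPolynomial ι K) (d : ι →₀ ℕ) :
    coeff d (Cp z k p) = if Finsupp.weight z d = k then coeff d p else 0 := by
  rw [Cp, coeff_weightedHomogeneousComponent]

theorem Cp_sub_mem {k : ℕ} {p : MvPolynomial ι K} (hp : p ∈ Fil z k) :
    p - Cp z k p ∈ Fil z (k + 1) := by
  intro d hd
  rw [coeff_sub, coeff_Cp] at hd
  split_ifs at hd with h
  · simp at hd
  · have := hp d (by simpa using hd)
    omega

theorem Cp_hom (k : ℕ) (p : MvPolynomial ι K) : IsWeightedHomogeneous z (Cp z k p) k :=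
  weightedHomogeneousComponent_isWeightedHomogeneous _ _

theorem Cp_mem (k : ℕ) (p : MvPolynomial ι K) : Cp z k p ∈ Fil z k :=
  fun _ hd => (Cp_hom k p hd).ge

theorem hom_mem {k : ℕ} {p : MvPolynomial ι K} (hp : IsWeightedHomogeneous z p k) : p ∈ Fil z k :=
  fun _ hd => (hp hd).ge

theorem hom_eq_zero {k : ℕ} {p : MvPolynomial ι K} (hp : IsWeightedHomogeneous z p k)
    (h : p ∈ Fil z (k + 1)) : p = 0 := by
  ext d
  by_contra hd
  rw [coeff_zero] at hd
  have h1 := hp hd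
  have h2 := h d hd
  omega

theorem Cp_eq_zero_iff {k : ℕ} {p : MvPolynomial ι K} (hp : p ∈ Fil z k) :
    Cp z k p = 0 ↔ p ∈ Fil z (k + 1) := by
  constructor
  · intro h; have := Cp_sub_mem hp; rwa [h, sub_zero] at this
  · intro h
    refine hom_eq_zero (Cp_hom k p) ?_
    have := Ideal.sub_mem _ h (Cp_sub_mem hp)
    simpa using this

/-- cancellation of a `z`-weight-zero nonzero factor. -/
theorem Fil_cancel {D : MvPolynomial ι K} (hD : IsWeightedHomogeneous z D 0) (hD0 : D ≠ 0)
    {k : ℕ} {p : MvPolynomial ι K} (h : D * p ∈ Fil z k) : p ∈ Fil z k := by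
  induction k with
  | zero => exact Fil_zero p
  | succ k ih =>
    have hp := ih (Fil_mono (Nat.le_succ k) h)
    rw [← Cp_eq_zero_iff hp]
    have h1 : D * Cp z k p ∈ Fil z (k + 1) := by
      have h2 : D * (p - Cp z k p) ∈ Fil z (k + 1) := Ideal.mul_mem_left _ _ (Cp_sub_mem hp)
      have := Ideal.sub_mem _ h h2
      rwa [← mul_sub, sub_sub_cancel] at this
    have h3 : IsWeightedHomogeneous z (D * Cp z k p) k := by
      have := hD.mul (Cp_hom k p); rwa [zero_add] at this
    exact (mul_eq_zero.mp (hom_eq_zero h3 h1)).resolve_left hD0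

theorem Fil_pderiv {k : ℕ} {p : MvPolynomial ι K} (hp : p ∈ Fil z k) (i : ι) :
    pderiv i p ∈ Fil z (k - z i) := by
  intro d hd
  rw [coeff_pderiv] at hd
  have := hp _ (left_ne_zero_of_mul hd)
  rw [map_add, Finsupp.weight_single] at this
  simp at this; omega

theorem deriv_eq_sum [Fintype ι] (D : Derivation K (MvPolynomial ι K) (MvPolynomial ι K))
    (p : MvPolynomial ι K) : D p = ∑ i, pderiv i p * D (X i) := by
  classical
  have : D = ∑ i, D (X i) • pderiv (R := K) i := by
    refine derivation_ext fun j => ?_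
    have : ∀ s : Finset ι, (∑ i ∈ s, D (X i) • pderiv (R := K) i) (X j)
      = ∑ i ∈ s, (D (X i) • pderiv (R := K) i) (X j) := by
      intro s
      induction s using Finset.induction_on with
      | empty => simp
      | insert a s ha ih => rw [Finset.sum_insert ha, Finset.sum_insert ha, Derivation.add_apply, ih]
    rw [this]
    simp [pderiv_X, Pi.single_apply]
  have h2 : ∀ s : Finset ι, (∑ i ∈ s, D (X i) • pderiv (R := K) i) p
      = ∑ i ∈ s, (D (X i) • pderiv (R := K) i) p := by
      intro s
      induction s using Finset.induction_on with
      | empty => simp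
      | insert a s ha ih => rw [Finset.sum_insert ha, Finset.sum_insert ha, Derivation.add_apply, ih]
  conv_lhs => rw [this, h2]
  refine Finset.sum_congr rfl fun i _ => ?_
  simp [mul_comm]

end Filt
end KK

set_option linter.all false
namespace KK
open MvPolynomial

section Ext
variable {K : Type*} [Field K] {ι : Type*} [Fintype ι] [DecidableEq ι] {κ : Type*} [Fintype κ]

/-- combination of derivations -/
noncomputable def Vd (L : κ → Derivation K (MvPolynomial ι K) (MvPolynomial ι K))
    (v : κ → MvPolynomial ι K) : Derivation K (MvPolynomial ι K) (MvPolynomial ι K) :=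
  ∑ i, v i • L i

variable {L : κ → Derivation K (MvPolynomial ι K) (MvPolynomial ι K)}

theorem Vd_apply (v : κ → MvPolynomial ι K) (p : MvPolynomial ι K) :
    Vd L v p = ∑ i, v i * L i p := by
  classical
  have : ∀ s : Finset κ, (∑ i ∈ s, v i • L i) p = ∑ i ∈ s, v i * L i p := by
    intro s
    induction s using Finset.induction_on with
    | empty => simp
    | insert a s ha ih =>
      rw [Finset.sum_insert ha, Finset.sum_insert ha, Derivation.add_apply, ih]; rfl
  exact this _

theorem Vd_mem {z : ι → ℕ} {k : ℕ} {F : MvPolynomial ι K} (hF : ∀ i, L i F ∈ Fil z k)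
    (v : κ → MvPolynomial ι K) : Vd L v F ∈ Fil z k := by
  rw [Vd_apply]
  exact Ideal.sum_mem _ fun i _ => Ideal.mul_mem_left _ _ (hF i)

theorem Vd_comm (hL : ∀ i j, ∃ c : κ → K, ∀ p, L i (L j p) - L j (L i p) = ∑ k, c k • L k p)
    (v u : κ → MvPolynomial ι K) :
    ∃ w : κ → MvPolynomial ι K, ∀ p, Vd L v (Vd L u p) - Vd L u (Vd L v p) = Vd L w p := by
  choose c hc using hL
  refine ⟨fun k => Vd L v (u k) - Vd L u (v k) + ∑ i, ∑ j, C (c i j k) * (v i * u j), fun p => ?_⟩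
  have h1 : ∀ (v u : κ → MvPolynomial ι K), Vd L v (Vd L u p) =
      ∑ k, Vd L v (u k) * L k p + ∑ i, ∑ j, v i * u j * L i (L j p) := by
    intro v u
    rw [Vd_apply u p, map_sum]
    simp only [Derivation.leibniz, smul_eq_mul]
    rw [Finset.sum_add_distrib, add_comm]
    congr 1
    · exact Finset.sum_congr rfl fun k _ => mul_comm _ _
    · rw [Finset.sum_comm]
      refine Finset.sum_congr rfl fun j _ => ?_
      rw [Vd_apply, Finset.mul_sum]
      exact Finset.sum_congr rfl fun i _ => by ring
  rw [h1, h1, Vd_apply]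
  have h2 : ∑ i, ∑ j, u i * v j * L i (L j p) = ∑ i, ∑ j, v i * u j * L j (L i p) := by
    rw [Finset.sum_comm]
    exact Finset.sum_congr rfl fun i _ => Finset.sum_congr rfl fun j _ => by ring
  rw [h2, add_sub_add_comm, ← Finset.sum_sub_distrib, ← Finset.sum_sub_distrib]
  have h3 : ∑ i, (∑ j, v i * u j * L i (L j p) - ∑ j, v i * u j * L j (L i p))
      = ∑ k, (∑ i, ∑ j, C (c i j k) * (v i * u j)) * L k p := by
    simp only [Finset.sum_mul]
    rw [Finset.sum_comm]
    refine Finset.sum_congr rfl fun i _ => ?_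
    rw [Finset.sum_comm, ← Finset.sum_sub_distrib]
    refine Finset.sum_congr rfl fun j _ => ?_
    rw [← mul_sub, hc, Finset.mul_sum]
    exact Finset.sum_congr rfl fun k _ => by rw [smul_eq_C_mul]; ring
  rw [h3, ← Finset.sum_add_distrib]
  exact Finset.sum_congr rfl fun k _ => by ring

/-- indicator weight -/
def zw (Z : Finset ι) : ι → ℕ := fun i => if i ∈ Z then 1 else 0

theorem zw_le (Z : Finset ι) (i : ι) : zw Z i ≤ 1 := by unfold zw; split_ifs <;> simp
theorem zw_mem {Z : Finset ι} {i : ι} (h : i ∈ Z) : zw Z i = 1 := by simp [zw, h]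
theorem zw_not {Z : Finset ι} {i : ι} (h : i ∉ Z) : zw Z i = 0 := by simp [zw, h]

variable {Z : Finset ι}

/-- a derivation drops the filtration by at most one. -/
theorem der_mem (D : Derivation K (MvPolynomial ι K) (MvPolynomial ι K)) {k : ℕ}
    {p : MvPolynomial ι K} (hp : p ∈ Fil (zw Z) (k + 1)) : D p ∈ Fil (zw Z) k := by
  rw [deriv_eq_sum]
  refine Ideal.sum_mem _ fun i _ => Ideal.mul_mem_right _ _ (Fil_mono ?_ (Fil_pderiv hp i))
  have := zw_le Z i; omega

/-- A derivation with `D x_γ ∈ 𝔷` preserves the filtration. -/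
theorem der_pres (D : Derivation K (MvPolynomial ι K) (MvPolynomial ι K))
    (hD : ∀ γ ∈ Z, D (X γ) ∈ Fil (zw Z) 1) {k : ℕ}
    {p : MvPolynomial ι K} (hp : p ∈ Fil (zw Z) k) : D p ∈ Fil (zw Z) k := by
  rw [deriv_eq_sum]
  refine Ideal.sum_mem _ fun i _ => ?_
  by_cases hi : i ∈ Z
  · refine Fil_mul' (Fil_pderiv hp i) (hD i hi) ?_
    rw [zw_mem hi]; omega
  · have := Fil_pderiv hp i
    rw [zw_not hi] at this
    exact Ideal.mul_mem_right _ _ this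

theorem der_lead (D : Derivation K (MvPolynomial ι K) (MvPolynomial ι K)) {γ : ι}
    (E : MvPolynomial ι K) (hγ : γ ∈ Z)
    (hD : ∀ γ' ∈ Z, D (X γ') - (if γ' = γ then E else 0) ∈ Fil (zw Z) 1) {k : ℕ}
    {p : MvPolynomial ι K} (hp : p ∈ Fil (zw Z) k) : D p - E * pderiv γ p ∈ Fil (zw Z) k := by
  have := der_pres (Z := Z) (D - E • pderiv γ) (by
    intro γ' hγ'
    have := hD γ' hγ'
    rw [Derivation.sub_apply, Derivation.smul_apply, pderiv_X, smul_eq_mul, Pi.single_apply]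
    simpa using this) hp
  simpa using this

/-- Lemma E -/
theorem Fil_of_pderiv [CharZero K] {k : ℕ} (hk : 1 ≤ k) {Q : MvPolynomial ι K}
    (hQ : Q ∈ Fil (zw Z) k) (h : ∀ γ ∈ Z, pderiv γ Q ∈ Fil (zw Z) k) :
    Q ∈ Fil (zw Z) (k + 1) := by
  intro d hd
  have h1 := hQ d hd
  by_contra hlt
  have hw : Finsupp.weight (zw Z) d = k := by omega
  have : ∃ γ ∈ Z, d γ ≠ 0 := by
    by_contra hcon
    push Not at hcon
    rw [Finsupp.weight_eq_sum] at hw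
    have : ∑ i, d i • zw Z i = 0 := Finset.sum_eq_zero fun i _ => by
      by_cases hi : i ∈ Z
      · simp [hcon i hi]
      · simp [zw_not hi]
    omega
  obtain ⟨γ, hγ, hdγ⟩ := this
  have h2 := h γ hγ (d - Finsupp.single γ 1) (by
    rw [coeff_pderiv, tsub_add_cancel_of_le (by
      rw [Finsupp.single_le_iff]; omega)]
    refine mul_ne_zero hd ?_
    norm_cast)
  have h3 := Finsupp.weight_sub_single_add (w := zw Z) hdγ
  rw [zw_mem hγ] at h3
  omega

structure ExtData (L : κ → Derivation K (MvPolynomial ι K) (MvPolynomial ι K)) (Z : Finset ι)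
    (N : ι → κ → MvPolynomial ι K) (D : MvPolynomial ι K) : Prop where
  hom : IsWeightedHomogeneous (zw Z) D 0
  ne : D ≠ 0
  eq : ∀ γ ∈ Z, ∀ γ' ∈ Z, Vd L (N γ) (X γ') - (if γ' = γ then D else 0) ∈ Fil (zw Z) 1

variable {N N' : ι → κ → MvPolynomial ι K} {D D' : MvPolynomial ι K}

theorem ext_E [CharZero K] (hN : ExtData L Z N D) {k : ℕ} (hk : 1 ≤ k) {Q : MvPolynomial ι K}
    (hQ : Q ∈ Fil (zw Z) k) (h : ∀ γ ∈ Z, Vd L (N γ) Q ∈ Fil (zw Z) k) :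
    Q ∈ Fil (zw Z) (k + 1) := by
  refine Fil_of_pderiv hk hQ fun γ hγ => Fil_cancel hN.hom hN.ne ?_
  have := Ideal.sub_mem _ (h γ hγ) (der_lead _ D hγ (hN.eq γ hγ) hQ)
  simpa using this

theorem ext_unique [CharZero K] (hN : ExtData L Z N D) {P : MvPolynomial ι K}
    (hP : ∀ i, L i P = 0) (h : P ∈ Fil (zw Z) 1) : P = 0 := by
  have : ∀ k, 1 ≤ k → P ∈ Fil (zw Z) k := by
    intro k hk
    induction k, hk using Nat.le_induction with
    | base => exact h
    | succ k hk ih =>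
      refine ext_E hN hk ih fun γ _ => ?_
      exact Vd_mem (fun i => by rw [hP]; exact zero_mem _) _
  ext d
  by_contra hd
  have := this (Finsupp.weight (zw Z) d + 1) (by omega) d hd
  omega

theorem ext_alpha [CharZero K]
    (hL : ∀ i j, ∃ c : κ → K, ∀ p, L i (L j p) - L j (L i p) = ∑ k, c k • L k p)
    (hN : ExtData L Z N D) {k : ℕ} (hk : 1 ≤ k) {F : MvPolynomial ι K}
    (hF : ∀ i, L i F ∈ Fil (zw Z) k) (v : κ → MvPolynomial ι K)
    (hv : ∀ γ ∈ Z, Vd L v (X γ) ∈ Fil (zw Z) 1) : Vd L v F ∈ Fil (zw Z) (k + 1) := by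
  refine ext_E hN hk (Vd_mem hF v) fun γ _ => ?_
  obtain ⟨w, hw⟩ := Vd_comm hL (N γ) v
  have h1 := hw F
  rw [sub_eq_iff_eq_add] at h1
  rw [h1]
  exact Ideal.add_mem _ (Vd_mem hF w) (der_pres _ hv (Vd_mem hF _))

theorem Vd_sub (v u : κ → MvPolynomial ι K) (p : MvPolynomial ι K) :
    Vd L (v - u) p = Vd L v p - Vd L u p := by
  simp [Vd_apply, sub_mul]

theorem Vd_smul (c : MvPolynomial ι K) (v : κ → MvPolynomial ι K) (p : MvPolynomial ι K) :
    Vd L (c • v) p = c * Vd L v p := by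
  simp [Vd_apply, Finset.mul_sum, mul_assoc]

theorem Vd_sum {τ : Type*} (s : Finset τ) (v : τ → κ → MvPolynomial ι K) (p : MvPolynomial ι K) :
    Vd L (∑ t ∈ s, v t) p = ∑ t ∈ s, Vd L (v t) p := by
  simp only [Vd_apply, Finset.sum_apply, Finset.sum_mul]
  rw [Finset.sum_comm]

theorem Vd_single [DecidableEq κ] (i : κ) (p : MvPolynomial ι K) :
    Vd L (Pi.single i 1) p = L i p := by
  simp [Vd_apply, Pi.single_apply]

theorem ext_step [CharZero K]
    (hL : ∀ i j, ∃ c : κ → K, ∀ p, L i (L j p) - L j (L i p) = ∑ k, c k • L k p)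
    (hN : ExtData L Z N D) (hN' : ExtData L Z N' D') (hDD : IsRelPrime D D')
    {k : ℕ} {F : MvPolynomial ι K}
    (hF : ∀ i, L i F ∈ Fil (zw Z) k)
    (hα : ∀ v : κ → MvPolynomial ι K, (∀ γ ∈ Z, Vd L v (X γ) ∈ Fil (zw Z) 1) →
      Vd L v F ∈ Fil (zw Z) (k + 1)) :
    ∃ F', F' - F ∈ Fil (zw Z) (k + 1) ∧ ∀ i, L i F' ∈ Fil (zw Z) (k + 1) := by
  classical
  -- the quotients
  have hH : ∀ γ ∈ Z, ∃ H : MvPolynomial ι K, IsWeightedHomogeneous (zw Z) H k ∧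
      Vd L (N γ) F - D * H ∈ Fil (zw Z) (k + 1) := by
    intro γ hγ
    have h1 : D' * Vd L (N γ) F - D * Vd L (N' γ) F ∈ Fil (zw Z) (k + 1) := by
      have := hα (D' • N γ - D • N' γ) (by
        intro γ' hγ'
        rw [Vd_sub, Vd_smul, Vd_smul]
        have a := Ideal.mul_mem_left _ D' (hN.eq γ hγ γ' hγ')
        have b := Ideal.mul_mem_left _ D (hN'.eq γ hγ γ' hγ')
        have c := Ideal.sub_mem _ a b
        convert c using 1
        split_ifs <;> ring)
      rwa [Vd_sub, Vd_smul, Vd_smul] at this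
    set A := Vd L (N γ) F with hA
    set B := Vd L (N' γ) F with hB
    have hAm : A ∈ Fil (zw Z) k := Vd_mem hF _
    have hBm : B ∈ Fil (zw Z) k := Vd_mem hF _
    have h2 : D' * Cp (zw Z) k A = D * Cp (zw Z) k B := by
      rw [← sub_eq_zero]
      refine hom_eq_zero (z := zw Z) (k := k) ?_ ?_
      · have a := hN'.hom.mul (Cp_hom (z := zw Z) k A)
        have b := hN.hom.mul (Cp_hom (z := zw Z) k B)
        rw [zero_add] at a b
        exact a.sub b
      · have a := Ideal.mul_mem_left _ D' (Cp_sub_mem hAm)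
        have b := Ideal.mul_mem_left _ D (Cp_sub_mem hBm)
        have c := Ideal.sub_mem _ h1 (Ideal.sub_mem _ a b)
        convert c using 1
        ring
    have h3 : D ∣ Cp (zw Z) k A := hDD.dvd_of_dvd_mul_left ⟨_, h2⟩
    obtain ⟨H, hH⟩ := h3
    have hHm : H ∈ Fil (zw Z) k := Fil_cancel hN.hom hN.ne (by rw [← hH]; exact Cp_mem _ _)
    refine ⟨Cp (zw Z) k H, Cp_hom _ _, ?_⟩
    have a := Ideal.mul_mem_left _ D (Cp_sub_mem hHm)
    have b := Ideal.add_mem _ (Cp_sub_mem hAm) a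
    rw [hH] at b
    convert b using 1
    ring
  choose! H hHhom hHeq using hH
  have hHm : ∀ γ ∈ Z, H γ ∈ Fil (zw Z) k := fun γ hγ => hom_mem (hHhom γ hγ)
  -- G_i
  have hG : ∀ i, L i F - ∑ γ ∈ Z, L i (X γ) * H γ ∈ Fil (zw Z) (k + 1) := by
    intro i
    refine Fil_cancel hN.hom hN.ne ?_
    have h1 := hα (D • Pi.single i 1 - ∑ γ ∈ Z, L i (X γ) • N γ) (by
      intro γ' hγ'
      rw [Vd_sub, Vd_smul, Vd_single, Vd_sum]
      simp only [Vd_smul]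
      have a : ∑ γ ∈ Z, L i (X γ) * (Vd L (N γ) (X γ') - (if γ' = γ then D else 0)) ∈
        Fil (zw Z) 1 := Ideal.sum_mem _ fun γ hγ => Ideal.mul_mem_left _ _ (hN.eq γ hγ γ' hγ')
      rw [← Ideal.neg_mem_iff] at a
      convert a using 1
      simp only [mul_sub, Finset.sum_sub_distrib, mul_ite, mul_zero, Finset.sum_ite_eq, if_pos hγ']
      ring)
    rw [Vd_sub, Vd_smul, Vd_single, Vd_sum] at h1
    simp only [Vd_smul] at h1
    have h2 : ∑ γ ∈ Z, L i (X γ) * (Vd L (N γ) F - D * H γ) ∈ Fil (zw Z) (k + 1) :=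
      Ideal.sum_mem _ fun γ hγ => Ideal.mul_mem_left _ _ (hHeq γ hγ)
    have h3 := Ideal.add_mem _ h1 h2
    convert h3 using 1
    simp only [mul_sub, Finset.sum_sub_distrib, Finset.mul_sum]
    rw [sub_add_sub_cancel]
    congr 1
    exact Finset.sum_congr rfl fun γ _ => by ring
  -- closedness
  have hcl : ∀ γ ∈ Z, ∀ γ' ∈ Z, pderiv γ (H γ') - pderiv γ' (H γ) ∈ Fil (zw Z) k := by
    intro γ hγ γ' hγ'
    refine Fil_cancel hN.hom hN.ne (Fil_cancel hN.hom hN.ne ?_)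
    obtain ⟨w, hw⟩ := Vd_comm hL (N γ) (N γ')
    have h1 := Vd_mem hF w
    rw [← hw] at h1
    have key : ∀ γ ∈ Z, ∀ γ' ∈ Z, Vd L (N γ) (Vd L (N γ') F) - D * (D * pderiv γ (H γ'))
        ∈ Fil (zw Z) k := by
      intro γ hγ γ' hγ'
      have a := der_mem (Vd L (N γ)) (hHeq γ' hγ')
      have b := der_lead _ D hγ (hN.eq γ hγ) (Ideal.mul_mem_left _ D (hHm γ' hγ'))
      have c : D * (pderiv γ D * H γ') ∈ Fil (zw Z) k :=
        Ideal.mul_mem_left _ _ (Ideal.mul_mem_left _ _ (hHm γ' hγ'))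
      have d := Ideal.add_mem _ (Ideal.add_mem _ a b) c
      convert d using 1
      rw [map_sub, pderiv_mul]
      ring
    have h2 := Ideal.sub_mem _ h1 (Ideal.sub_mem _ (key γ hγ γ' hγ') (key γ' hγ' γ hγ))
    convert h2 using 1
    ring
  set P : MvPolynomial ι K := ∑ γ ∈ Z, X γ * H γ with hP
  have hXm : ∀ γ ∈ Z, (X γ : MvPolynomial ι K) ∈ Fil (zw Z) 1 := fun γ hγ => by
    have := Fil_X (K := K) (z := zw Z) γ
    rwa [zw_mem hγ] at this
  have hPm : P ∈ Fil (zw Z) (k + 1) := Ideal.sum_mem _ fun γ hγ =>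
    Fil_mul' (hXm γ hγ) (hHm γ hγ) (by omega)
  have hPd : ∀ γ' ∈ Z, pderiv γ' P - ((k : K) + 1) • H γ' ∈ Fil (zw Z) (k + 1) := by
    intro γ' hγ'
    have e1 : ∑ γ ∈ Z, X γ * pderiv γ (H γ') = (k : K) • H γ' := by
      have := (hHhom γ' hγ').sum_weight_X_mul_pderiv
      rw [Nat.cast_smul_eq_nsmul, ← this, ← Finset.sum_subset (Finset.subset_univ Z)]
      · exact Finset.sum_congr rfl fun γ hγ => by rw [zw_mem hγ, one_smul]
      · intro i _ hi; rw [zw_not hi, zero_smul]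
    have e2 : pderiv γ' P = H γ' + ∑ γ ∈ Z, X γ * pderiv γ' (H γ) := by
      rw [hP, map_sum]
      simp only [pderiv_mul, pderiv_X, Pi.single_apply]
      rw [Finset.sum_add_distrib]
      simp [hγ']
    have e3 : ∑ γ ∈ Z, X γ * (pderiv γ' (H γ) - pderiv γ (H γ')) ∈ Fil (zw Z) (k + 1) :=
      Ideal.sum_mem _ fun γ hγ => Fil_mul' (hXm γ hγ) (hcl γ' hγ' γ hγ) (by omega)
    convert e3 using 1
    simp only [mul_sub, Finset.sum_sub_distrib]
    rw [e1, e2, add_smul, one_smul]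
    ring
  have hLP : ∀ i, L i P - ((k : K) + 1) • ∑ γ ∈ Z, L i (X γ) * H γ ∈ Fil (zw Z) (k + 1) := by
    intro i
    have a : ∑ γ ∈ Z, (pderiv γ P - ((k : K) + 1) • H γ) * L i (X γ) ∈ Fil (zw Z) (k + 1) :=
      Ideal.sum_mem _ fun γ hγ => Ideal.mul_mem_right _ _ (hPd γ hγ)
    have b : ∑ j ∈ Finset.univ \ Z, pderiv j P * L i (X j) ∈ Fil (zw Z) (k + 1) := by
      refine Ideal.sum_mem _ fun j hj => Ideal.mul_mem_right _ _ ?_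
      have := Fil_pderiv hPm j
      rwa [zw_not (by simpa using hj)] at this
    have c := Ideal.add_mem _ b a
    convert c using 1
    rw [deriv_eq_sum (L i) P, ← Finset.sum_sdiff (Finset.subset_univ Z)]
    simp only [sub_mul, Finset.sum_sub_distrib, Finset.smul_sum]
    rw [add_sub_assoc]
    congr 2
    exact Finset.sum_congr rfl fun γ _ => by rw [smul_mul_assoc, mul_comm]
  have hk0 : ((k : K) + 1) ≠ 0 := by exact_mod_cast Nat.succ_ne_zero k
  refine ⟨F - ((k : K) + 1)⁻¹ • P, ?_, fun i => ?_⟩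
  · rw [sub_sub_cancel_left, Ideal.neg_mem_iff]
    exact Fil_smul _ hPm
  · have a := Ideal.sub_mem _ (hG i) (Fil_smul ((k : K) + 1)⁻¹ (hLP i))
    convert a using 1
    rw [map_sub, Derivation.map_smul, smul_sub, smul_smul, inv_mul_cancel₀ hk0, one_smul]
    ring

/-- The extension lemma. -/
theorem ext_main [CharZero K]
    (hL : ∀ i j, ∃ c : κ → K, ∀ p, L i (L j p) - L j (L i p) = ∑ k, c k • L k p)
    (hN : ExtData L Z N D) (hN' : ExtData L Z N' D') (hDD : IsRelPrime D D')
    (F₀ : MvPolynomial ι K)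
    (hα : ∀ v : κ → MvPolynomial ι K, (∀ γ ∈ Z, Vd L v (X γ) ∈ Fil (zw Z) 1) →
      Vd L v F₀ ∈ Fil (zw Z) 1) (k : ℕ) :
    ∃ F, F - F₀ ∈ Fil (zw Z) 1 ∧ ∀ i, L i F ∈ Fil (zw Z) k := by
  induction k with
  | zero => exact ⟨F₀, by simp, fun i => Fil_zero _⟩
  | succ k ih =>
    rcases Nat.eq_zero_or_pos k with rfl | hk
    · obtain ⟨F', h1, h2⟩ := ext_step hL hN hN' hDD (F := F₀) (k := 0) (fun _ => Fil_zero _) hα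
      exact ⟨F', h1, h2⟩
    · obtain ⟨F, h1, h2⟩ := ih
      obtain ⟨F', h3, h4⟩ := ext_step hL hN hN' hDD h2 (ext_alpha hL hN hk h2)
      refine ⟨F', ?_, h4⟩
      have := Ideal.add_mem _ (Fil_mono (by omega) h3) h1
      simpa using this

end Ext
end KK

set_option linter.all false
namespace KK
open Module

section Sl2
variable {K : Type*} [Field K] [CharZero K] {V : Type*} [AddCommGroup V] [Module K V]
  [FiniteDimensional K V]

structure Trip (E H F : Module.End K V) : Prop where
  HE : ∀ v, H (E v) = E (H v) + (2:K) • E v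
  HF : ∀ v, H (F v) = F (H v) - (2:K) • F v
  EF : ∀ v, E (F v) = F (E v) + H v

variable {E H F : Module.End K V}

theorem Trip.swap (t : Trip E H F) : Trip F (-H) E where
  HE v := by
    have := t.HF v; simp only [LinearMap.neg_apply, map_neg]; rw [this]; module
  HF v := by
    have := t.HE v; simp only [LinearMap.neg_apply, map_neg]; rw [this]; module
  EF v := by rw [t.EF v]; simp

theorem exists_not_eig (H : Module.End K V) (lam : K) (c : K) (hc : c ≠ 0) :
    ∃ n : ℕ, ¬ H.HasEigenvalue (lam + n * c) := by
  by_contra hcon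
  push Not at hcon
  have hfin : Set.Finite {μ | H.HasEigenvalue μ} := by
    exact Module.End.finite_hasEigenvalue H
  refine Set.infinite_of_injective_forall_mem (f := fun n : ℕ => lam + n * c) ?_ hcon hfin
  intro a b hab
  simp only [add_right_inj, mul_eq_mul_right_iff, hc, or_false] at hab
  exact_mod_cast hab

theorem Trip.E_eig (t : Trip E H F) {v : V} {μ : K} (h : v ∈ H.eigenspace μ) :
    E v ∈ H.eigenspace (μ + 2) := by
  rw [End.mem_eigenspace_iff] at *
  rw [t.HE, h, map_smul]; module

theorem Trip.F_eig (t : Trip E H F) {v : V} {μ : K} (h : v ∈ H.eigenspace μ) :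
    F v ∈ H.eigenspace (μ - 2) := by
  rw [End.mem_eigenspace_iff] at *
  rw [t.HF, h, map_smul]; module

theorem Trip.iter_eig (t : Trip E H F) {v : V} {μ : K} (h : v ∈ H.eigenspace μ) (k : ℕ) :
    (E ^ k) v ∈ H.eigenspace (μ + k * 2) := by
  induction k with
  | zero => simpa using h
  | succ k ih =>
    rw [pow_succ', Module.End.mul_apply]
    convert t.E_eig ih using 2
    push_cast; ring

theorem Trip.exists_iter_zero (t : Trip E H F) {v : V} {μ : K} (h : v ∈ H.eigenspace μ) :
    ∃ k : ℕ, (E ^ k) v = 0 := by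
  obtain ⟨n, hn⟩ := exists_not_eig H μ 2 two_ne_zero
  refine ⟨n, ?_⟩
  by_contra h0
  exact hn (Module.End.hasEigenvalue_of_hasEigenvector ⟨t.iter_eig h n, h0⟩)

/-- If `E F v = 0` and `v` has weight a positive integer then `v = 0`. -/
theorem Trip.EF_inj (t : Trip E H F) {v : V} {m : ℤ} (hm : 1 ≤ m) (h : v ∈ H.eigenspace (m : K))
    (h0 : E (F v) = 0) : v = 0 := by
  by_contra hv
  have cas : ∀ k : ℕ, (4:K) • F (E ((E ^ k) v)) =
      ((m:K) * (m - 2) - (m + k * 2) * (m + k * 2 + 2)) • (E ^ k) v := by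
    intro k
    induction k with
    | zero =>
      have h1 := t.EF v
      have h2 := (End.mem_eigenspace_iff).1 h
      rw [h0, h2] at h1
      have : F (E v) = -((m:K) • v) := eq_neg_of_add_eq_zero_left h1.symm
      simp only [pow_zero, Module.End.one_apply]
      rw [this]; push_cast; module
    | succ k ih =>
      set u := (E ^ k) v with hu
      have hu' : (E ^ (k+1)) v = E u := by rw [pow_succ', Module.End.mul_apply]
      rw [hu']
      have h1 := t.EF (E u)
      have h2 := (End.mem_eigenspace_iff).1 (t.E_eig (t.iter_eig h k))
      rw [← hu] at h2
      rw [h2] at h1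
      have h3 : (4:K) • E (F (E u)) =
        ((m:K) * (m - 2) - (m + k * 2) * (m + k * 2 + 2)) • E u := by
        rw [← map_smul, ih, map_smul]
      rw [h1, smul_add, smul_smul] at h3
      rw [eq_sub_of_add_eq h3]
      push_cast; module
  have ne : ∀ k : ℕ, (E ^ k) v ≠ 0 := by
    intro k
    induction k with
    | zero => simpa using hv
    | succ k ih =>
      rw [pow_succ', Module.End.mul_apply]
      intro h1
      have := cas k
      rw [h1, map_zero, smul_zero] at this
      have := (smul_eq_zero.1 this.symm).resolve_right ih
      have h2 : (m * (m - 2) - (m + k * 2) * (m + k * 2 + 2) : ℤ) = 0 := by exact_mod_cast this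
      nlinarith
  obtain ⟨k, hk⟩ := t.exists_iter_zero h
  exact ne k hk

theorem Trip.E_surj (t : Trip E H F) {v : V} {m : ℤ} (hm : 1 ≤ m) (h : v ∈ H.eigenspace (m : K)) :
    ∃ u ∈ H.eigenspace ((m - 2 : ℤ) : K), E u = v := by
  have hmap : ∀ x ∈ H.eigenspace (m : K), (E * F) x ∈ H.eigenspace (m : K) := by
    intro x hx
    have := t.E_eig (t.F_eig hx)
    rwa [sub_add_cancel] at this
  let T := (E * F).restrict hmap
  have hinj : Function.Injective T := by
    rw [← LinearMap.ker_eq_bot, LinearMap.ker_eq_bot']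
    intro x hx
    have : E (F x) = 0 := by
      have := congrArg Subtype.val hx
      simpa [T] using this
    exact Subtype.ext (t.EF_inj hm x.2 this)
  obtain ⟨x, hx⟩ := (LinearMap.injective_iff_surjective.1 hinj) ⟨v, h⟩
  refine ⟨F x, ?_, ?_⟩
  · have := t.F_eig x.2
    push_cast; exact this
  · have := congrArg Subtype.val hx
    simpa [T] using this

/-- `E` is injective on negative weight spaces -/
theorem Trip.E_inj (t : Trip E H F) {v : V} {m : ℤ} (hm : m < 0) (h : v ∈ H.eigenspace (m : K))
    (h0 : E v = 0) : v = 0 := by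
  by_contra hv
  have ts := t.swap
  have hs : v ∈ (-H).eigenspace (-(m : K)) := by
    rw [End.mem_eigenspace_iff] at *; simp [h]
  have cas : ∀ k : ℕ, E (F ((F ^ k) v)) =
      ((k+1 : K) * (m - k)) • (F ^ k) v := by
    intro k
    induction k with
    | zero =>
      have h1 := t.EF v
      have h2 := (End.mem_eigenspace_iff).1 h
      rw [h0, h2, map_zero, zero_add] at h1
      simp [h1]
    | succ k ih =>
      set u := (F ^ k) v with hu
      have hu' : (F ^ (k+1)) v = F u := by rw [pow_succ', Module.End.mul_apply]
      rw [hu']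
      have h1 := t.EF (F u)
      have h2 := (End.mem_eigenspace_iff).1 (ts.E_eig (ts.iter_eig hs k))
      rw [← hu, LinearMap.neg_apply, neg_eq_iff_eq_neg] at h2
      rw [h1, h2, ih, map_smul]
      push_cast; module
  have ne : ∀ k : ℕ, (F ^ k) v ≠ 0 := by
    intro k
    induction k with
    | zero => simpa using hv
    | succ k ih =>
      rw [pow_succ', Module.End.mul_apply]
      intro h1
      have := cas k
      rw [h1, map_zero] at this
      have := (smul_eq_zero.1 this.symm).resolve_right ih
      rcases mul_eq_zero.1 this with h | h
      · exact Nat.cast_add_one_ne_zero k h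
      · have : (m - k : ℤ) = 0 := by exact_mod_cast h
        omega
  obtain ⟨k, hk⟩ := ts.exists_iter_zero hs
  exact ne k hk

/-- integer part -/
theorem eig_of_gen {H : Module.End K V} {v : V} {lam : K} (hv : v ∈ ⨆ i : ℤ, H.eigenspace (i : K))
    (hg : v ∈ H.maxGenEigenspace lam) : v ∈ H.eigenspace lam ∧ (v ≠ 0 → ∃ i : ℤ, lam = i) := by
  have hle : ∀ μ, H.eigenspace μ ≤ H.maxGenEigenspace μ := fun μ =>
    Module.End.genEigenspace_le_maximal H μ 1
  have hd := Module.End.independent_maxGenEigenspace H lam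
  by_cases hl : ∃ i : ℤ, lam = i
  · refine ⟨?_, fun _ => hl⟩
    have : ⨆ i : ℤ, H.eigenspace (i : K) ≤
        H.eigenspace lam ⊔ ⨆ μ, ⨆ (_ : μ ≠ lam), H.maxGenEigenspace μ := by
      refine iSup_le fun i => ?_
      by_cases hi : (i : K) = lam
      · rw [hi]; exact le_sup_left
      · exact le_sup_of_le_right (le_iSup₂_of_le (i : K) hi (hle _))
    obtain ⟨a, ha, b, hb, hab⟩ := Submodule.mem_sup.1 (this hv)
    have hbg : b ∈ H.maxGenEigenspace lam := by
      have := Submodule.sub_mem _ hg (hle _ ha)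
      rwa [← hab, add_sub_cancel_left] at this
    have : b = 0 := Submodule.disjoint_def.1 hd b hbg hb
    rw [this, add_zero] at hab
    rwa [← hab]
  · have : ⨆ i : ℤ, H.eigenspace (i : K) ≤ ⨆ μ, ⨆ (_ : μ ≠ lam), H.maxGenEigenspace μ := by
      refine iSup_le fun i => ?_
      have hi : (i : K) ≠ lam := fun h => hl ⟨i, h.symm⟩
      exact (le_iSup₂_of_le (i : K) hi (hle _))
    have : v = 0 := Submodule.disjoint_def.1 hd v hg (this hv)
    exact ⟨by rw [this]; exact zero_mem _, fun h => (h this).elim⟩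

theorem Trip.E_gen (t : Trip E H F) {v : V} {μ : K} (h : v ∈ H.maxGenEigenspace μ) :
    E v ∈ H.maxGenEigenspace (μ + 2) := by
  rw [End.mem_maxGenEigenspace] at *
  obtain ⟨k, hk⟩ := h
  refine ⟨k, ?_⟩
  have : ∀ k : ℕ, ((H - (μ + 2) • (1 : Module.End K V)) ^ k) (E v) =
      E (((H - μ • (1 : Module.End K V)) ^ k) v) := by
    intro k
    induction k with
    | zero => simp
    | succ k ih =>
      rw [pow_succ', Module.End.mul_apply, ih, pow_succ' _ k, Module.End.mul_apply]
      simp only [LinearMap.sub_apply, LinearMap.smul_apply, Module.End.one_apply, map_sub, map_smul]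
      rw [t.HE]; module
  rw [this, hk, map_zero]

theorem Trip.iter_gen (t : Trip E H F) {v : V} {μ : K} (h : v ∈ H.maxGenEigenspace μ) (k : ℕ) :
    (E ^ k) v ∈ H.maxGenEigenspace (μ + k * 2) := by
  induction k with
  | zero => simpa using h
  | succ k ih =>
    rw [pow_succ', Module.End.mul_apply]
    convert t.E_gen ih using 2
    push_cast; ring

theorem Trip.exists_iter_zero' (t : Trip E H F) {v : V} {μ : K} (h : v ∈ H.maxGenEigenspace μ) :
    ∃ k : ℕ, (E ^ k) v = 0 := by
  obtain ⟨n, hn⟩ := exists_not_eig H μ 2 two_ne_zero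
  refine ⟨n, ?_⟩
  by_contra h0
  refine hn ?_
  have h1 := t.iter_gen h n
  rw [End.mem_maxGenEigenspace] at h1
  obtain ⟨k, hk⟩ := h1
  refine Module.End.hasEigenvalue_of_hasGenEigenvalue (k := k) ?_
  intro hbot
  have : (E ^ n) v ∈ H.genEigenspace (μ + n * 2) k := by
    rw [Module.End.mem_genEigenspace_nat]
    exact hk
  rw [hbot] at this
  exact h0 this

theorem Trip.EF_iter (t : Trip E H F) {v : V} (h : E v = 0) (n : ℕ) :
    E ((F ^ (n + 1)) v) = (n + 1 : K) • (F ^ n) (H v - (n : K) • v) := by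
  have hH : ∀ n : ℕ, H ((F ^ n) v) = (F ^ n) (H v) - (2 * n : K) • (F ^ n) v := by
    intro n
    induction n with
    | zero => simp
    | succ n ih =>
      rw [pow_succ', Module.End.mul_apply, t.HF, ih, Module.End.mul_apply, map_sub, map_smul]
      push_cast; module
  induction n with
  | zero => simp [t.EF, h]
  | succ n ih =>
    rw [pow_succ', Module.End.mul_apply, t.EF, ih, hH (n+1), map_smul]
    have : F ((F ^ n) (H v - (n:K) • v)) = (F ^ (n+1)) (H v - (n:K) • v) := by
      rw [pow_succ', Module.End.mul_apply]
    rw [this, map_sub, map_sub, map_smul, map_smul]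
    push_cast; module

theorem Trip.ker_E (t : Trip E H F) (n : ℕ) : ∀ v : V, E v = 0 → (F ^ n) v = 0 →
    v ∈ ⨆ i : Fin n, H.eigenspace ((i : ℕ) : K) := by
  induction n with
  | zero => intro v _ h; simp at h; rw [h]; exact zero_mem _
  | succ n ih =>
    intro v h1 h2
    have h3 := t.EF_iter h1 n
    rw [h2, map_zero] at h3
    have h4 := (smul_eq_zero.1 h3.symm).resolve_left (by exact_mod_cast Nat.succ_ne_zero n)
    have h5 := ih (H v - (n:K) • v) (by
      have := t.HE v
      rw [h1, map_zero, smul_zero, add_zero] at this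
      rw [map_sub, map_smul, h1, ← this]; simp) h4
    have hle : (⨆ i : Fin n, H.eigenspace ((i : ℕ) : K)) ≤
        Submodule.map (H - (n : K) • (1 : Module.End K V)) (⨆ i : Fin n, H.eigenspace ((i : ℕ) : K)) := by
      refine iSup_le fun i x hx => ?_
      have hne : ((i : ℕ) : K) - n ≠ 0 := by
        rw [sub_ne_zero]; exact_mod_cast i.2.ne
      refine ⟨((((i : ℕ) : K) - n)⁻¹) • x, Submodule.smul_mem _ _ (Submodule.mem_iSup_of_mem i hx), ?_⟩
      rw [End.mem_eigenspace_iff] at hx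
      simp only [LinearMap.sub_apply, LinearMap.smul_apply, Module.End.one_apply, map_smul]
      rw [hx, ← sub_smul, smul_smul, inv_mul_cancel₀ hne, one_smul]
    obtain ⟨w, hw, hw'⟩ := hle h5
    have hmono : (⨆ i : Fin n, H.eigenspace ((i : ℕ) : K)) ≤
        ⨆ i : Fin (n+1), H.eigenspace ((i : ℕ) : K) :=
      iSup_le fun i => le_iSup (fun i : Fin (n+1) => H.eigenspace ((i : ℕ) : K)) i.castSucc
    have h6 : v - w ∈ H.eigenspace (n : K) := by
      rw [End.mem_eigenspace_iff]
      simp only [LinearMap.sub_apply, LinearMap.smul_apply, Module.End.one_apply] at hw'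
      rw [map_sub, smul_sub, sub_eq_sub_iff_sub_eq_sub, ← hw']
    have h7 : v - w ∈ ⨆ i : Fin (n+1), H.eigenspace ((i : ℕ) : K) := by
      refine Submodule.mem_iSup_of_mem (Fin.last n) ?_
      simpa using h6
    have := Submodule.add_mem _ h7 (hmono hw)
    simpa using this

theorem Trip.top [IsAlgClosed K] (t : Trip E H F) : ⨆ i : ℤ, H.eigenspace (i : K) = ⊤ := by
  by_contra hne
  set V' := ⨆ i : ℤ, H.eigenspace (i : K) with hV'
  have hH : ∀ x ∈ V', H x ∈ V' := by
    have : V' ≤ V'.comap H := iSup_le fun i x hx => by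
      have h1 : x ∈ V' := Submodule.mem_iSup_of_mem i hx
      rw [End.mem_eigenspace_iff] at hx
      rw [Submodule.mem_comap, hx]
      exact Submodule.smul_mem _ _ h1
    exact this
  have hex : ∃ μ, ∃ v ∈ H.maxGenEigenspace μ, v ∉ V' := by
    by_contra hcon
    push Not at hcon
    refine hne (top_le_iff.1 ?_)
    rw [← Module.End.iSup_maxGenEigenspace_eq_top H]
    exact iSup_le fun μ x hx => hcon μ x hx
  obtain ⟨μ, v, hv, hvV⟩ := hex
  have hex2 : ∃ lam, ∃ v ∈ H.maxGenEigenspace lam, v ∉ V' ∧ E v ∈ V' := by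
    have hz : ∃ k, (E ^ k) v ∈ V' := by
      obtain ⟨k, hk⟩ := t.exists_iter_zero' hv
      exact ⟨k, by rw [hk]; exact zero_mem _⟩
    classical
    obtain ⟨k, hk⟩ : ∃ k, Nat.find hz = k + 1 :=
      Nat.exists_eq_succ_of_ne_zero (fun h0 => hvV (by have := Nat.find_spec hz; rwa [h0] at this))
    refine ⟨μ + k * 2, (E ^ k) v, t.iter_gen hv k, Nat.find_min hz (by omega), ?_⟩
    have := Nat.find_spec hz
    rwa [hk, pow_succ', Module.End.mul_apply] at this
  clear hv hvV
  obtain ⟨lam, v, hv, hvV, hEv⟩ := hex2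
  have hex3 : ∃ v ∈ H.maxGenEigenspace lam, v ∉ V' ∧ E v ∈ V' ∧ H v - lam • v ∈ V' := by
    set T := H - lam • (1 : Module.End K V) with hT
    have hz : ∃ k, (T ^ k) v ∈ V' := by
      rw [End.mem_maxGenEigenspace] at hv
      obtain ⟨k, hk⟩ := hv
      exact ⟨k, by rw [hk]; exact zero_mem _⟩
    have hTE : ∀ k : ℕ, E ((T ^ k) v) ∈ V' := by
      intro k
      induction k with
      | zero => simpa using hEv
      | succ k ih =>
        rw [pow_succ', Module.End.mul_apply]
        simp only [hT, LinearMap.sub_apply, LinearMap.smul_apply, Module.End.one_apply, map_sub, map_smul]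
        rw [← hT]
        have := t.HE ((T ^ k) v)
        rw [← sub_eq_iff_eq_add] at this
        rw [← this]
        exact Submodule.sub_mem _ (Submodule.sub_mem _ (hH _ ih) (Submodule.smul_mem _ _ ih))
          (Submodule.smul_mem _ _ ih)
    have hTg : ∀ k : ℕ, (T ^ k) v ∈ H.maxGenEigenspace lam := by
      intro k
      rw [End.mem_maxGenEigenspace] at *
      obtain ⟨j, hj⟩ := hv
      refine ⟨j, ?_⟩
      rw [← hT, ← Module.End.mul_apply, ← pow_add, add_comm, pow_add, Module.End.mul_apply, hj, map_zero]
    classical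
    obtain ⟨k, hk⟩ : ∃ k, Nat.find hz = k + 1 :=
      Nat.exists_eq_succ_of_ne_zero (fun h0 => hvV (by have := Nat.find_spec hz; rwa [h0] at this))
    refine ⟨(T ^ k) v, hTg k, Nat.find_min hz (by omega), hTE k, ?_⟩
    have := Nat.find_spec hz
    rw [hk, pow_succ', Module.End.mul_apply] at this
    simpa [hT] using this
  clear hv hvV hEv
  obtain ⟨v, hv, hvV, hEv, hy⟩ := hex3
  have hker : ∀ v ∈ H.maxGenEigenspace lam, E v = 0 → v ∈ V' := by
    intro v hv h0
    have hs : v ∈ (-H).maxGenEigenspace (-lam) := by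
      rw [End.mem_maxGenEigenspace] at *
      obtain ⟨k, hk⟩ := hv
      refine ⟨k, ?_⟩
      have : (-H - -lam • (1 : Module.End K V)) = -(H - lam • (1 : Module.End K V)) := by
        rw [neg_smul]; abel
      rw [this, neg_pow, Module.End.mul_apply, hk, map_zero]
    obtain ⟨n, hn⟩ := t.swap.exists_iter_zero' hs
    have := t.ker_E n v h0 hn
    have hle : (⨆ i : Fin n, H.eigenspace ((i : ℕ) : K)) ≤ V' := iSup_le fun i => by
      have := le_iSup (fun i : ℤ => H.eigenspace (i : K)) ((i : ℕ) : ℤ)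
      simpa using this
    exact hle this
  have hE2 := eig_of_gen hEv (t.E_gen hv)
  by_cases h0 : E v = 0
  · exact hvV (hker v hv h0)
  obtain ⟨j, hj⟩ := hE2.2 h0
  have hl : lam = ((j - 2 : ℤ) : K) := by push_cast; rw [← hj]; ring
  by_cases hj1 : 1 ≤ j
  · have h1 := hE2.1
    rw [hj] at h1
    obtain ⟨u, hu, huv⟩ := t.E_surj hj1 h1
    have huV : u ∈ V' := Submodule.mem_iSup_of_mem _ hu
    refine hvV ?_
    have := hker (v - u) (Submodule.sub_mem _ hv (by
      rw [hl]; exact Module.End.genEigenspace_le_maximal H _ 1 hu)) (by rw [map_sub, huv, sub_self])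
    have := Submodule.add_mem _ this huV
    simpa using this
  · have hyg : H v - lam • v ∈ H.maxGenEigenspace lam := by
      rw [End.mem_maxGenEigenspace] at *
      obtain ⟨k, hk⟩ := hv
      refine ⟨k, ?_⟩
      have : H v - lam • v = ((H - lam • (1 : Module.End K V)) ^ 1) v := by simp
      rw [this, ← Module.End.mul_apply, ← pow_add, add_comm, pow_add, Module.End.mul_apply, hk, map_zero]
    have hye := (eig_of_gen hy hyg).1
    have h1 := (End.mem_eigenspace_iff).1 hE2.1
    have hEy : E (H v - lam • v) = 0 := by
      rw [map_sub, map_smul]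
      rw [t.HE] at h1
      have : E (H v) = (lam + 2) • E v - (2:K) • E v := eq_sub_of_add_eq h1
      rw [this]; module
    rw [hl] at hye
    have := t.E_inj (m := j - 2) (by omega) hye (by rw [← hl]; exact hEy)
    refine hvV (Submodule.mem_iSup_of_mem (j - 2) ?_)
    rw [End.mem_eigenspace_iff, ← hl]
    rw [← hl] at this
    exact sub_eq_zero.1 this
end Sl2
end KK

set_option linter.all false
namespace KK
open Module

section Rk
variable {K : Type*} [Field K] [CharZero K] {V : Type*} [AddCommGroup V] [Module K V]
  [FiniteDimensional K V]

theorem line_charpoly (A B : Module.End K V) (n : ℕ) :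
    ∃ p : Polynomial K, ∀ s : K, p.eval s = (A + s • B).charpoly.coeff n := by
  classical
  let b := Module.finBasis K V
  let MA := LinearMap.toMatrix b b A
  let MB := LinearMap.toMatrix b b B
  let M : Matrix (Fin (finrank K V)) (Fin (finrank K V)) (Polynomial K) :=
    (Polynomial.C : K →+* _).mapMatrix MA + (Polynomial.X : Polynomial K) • (Polynomial.C : K →+* _).mapMatrix MB
  refine ⟨M.charpoly.coeff n, fun s => ?_⟩
  rw [← LinearMap.charpoly_toMatrix _ b]
  have : LinearMap.toMatrix b b (A + s • B) = M.map (Polynomial.evalRingHom s) := by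
    ext i j
    simp [M, MA, MB]
    ring
  rw [this, Matrix.charpoly_map, Polynomial.coeff_map]
  simp

theorem line_rank (A B : Module.End K V) :
    ∃ q : Polynomial K, q ≠ 0 ∧ ∀ s : K, q.eval s ≠ 0 →
      finrank K (LinearMap.range (A + B)) ≤ finrank K (LinearMap.range (A + s • B)) := by
  set T := A + B with hT
  obtain ⟨a, ha⟩ := T.rangeRestrict.exists_rightInverse_of_surjective (LinearMap.range_rangeRestrict T)
  obtain ⟨c, hc⟩ := (LinearMap.range T).subtype.exists_leftInverse_of_injective (Submodule.ker_subtype _)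
  obtain ⟨q, hq⟩ := line_charpoly (c ∘ₗ A ∘ₗ a) (c ∘ₗ B ∘ₗ a) 0
  have hM : ∀ s : K, (c ∘ₗ A ∘ₗ a) + s • (c ∘ₗ B ∘ₗ a) = c ∘ₗ (A + s • B) ∘ₗ a := by
    intro s; ext x; simp
  have h1 : c ∘ₗ T ∘ₗ a = LinearMap.id := by
    ext x
    have h2 : T (a x) = x := congrArg Subtype.val (LinearMap.congr_fun ha x)
    have h3 : c (x : V) = x := LinearMap.congr_fun hc x
    simp [h2, h3]
  refine ⟨q, ?_, ?_⟩
  · intro h0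
    have := hq 1
    rw [h0, hM, one_smul, h1] at this
    have hd := LinearMap.det_eq_sign_charpoly_coeff (LinearMap.id : Module.End K (LinearMap.range T))
    rw [← this] at hd
    simp at hd
  · intro s hs
    rw [hq, hM] at hs
    have hd := LinearMap.det_eq_sign_charpoly_coeff (c ∘ₗ (A + s • B) ∘ₗ a)
    have hd0 : LinearMap.det (c ∘ₗ (A + s • B) ∘ₗ a) ≠ 0 := by
      rw [hd]; exact mul_ne_zero (by simp) hs
    have hsur : LinearMap.range (c ∘ₗ (A + s • B) ∘ₗ a) = ⊤ := by
      have := LinearMap.equivOfDetNeZero _ hd0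
      exact LinearMap.range_eq_top.2 (LinearMap.equivOfDetNeZero _ hd0).surjective
    have hle : finrank K (LinearMap.range T) ≤
        finrank K (Submodule.map c (LinearMap.range (A + s • B))) := by
      have : (⊤ : Submodule K (LinearMap.range T)) ≤ Submodule.map c (LinearMap.range (A + s • B)) := by
        rw [← hsur]
        rintro _ ⟨x, rfl⟩
        exact ⟨(A + s • B) (a x), ⟨_, rfl⟩, rfl⟩
      rw [top_le_iff.1 this, finrank_top]
    exact hle.trans (Submodule.finrank_map_le _ _)

end Rk

section Lie
variable {K : Type*} [Field K] [CharZero K]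
variable {g : Type*} [LieRing g] [LieAlgebra K g] [FiniteDimensional K g]

theorem cartan_of_regular {x : g} (hx : LieAlgebra.IsRegular K x) :
    (LieSubalgebra.engel K x).IsCartanSubalgebra := by
  have h : (finrank K g : Cardinal) ≤ Cardinal.mk K :=
    Cardinal.natCast_le_aleph0.trans <| Cardinal.infinite_iff.mp inferInstance
  refine ⟨?_, LieSubalgebra.normalizer_engel _ _⟩
  apply LieSubalgebra.isNilpotent_of_forall_le_engel
  intro y hy
  set Ex : {LieSubalgebra.engel K z | z ∈ LieSubalgebra.engel K x} :=
    ⟨LieSubalgebra.engel K x, x, LieSubalgebra.self_mem_engel _ _, rfl⟩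
  suffices IsBot Ex from @this ⟨LieSubalgebra.engel K y, y, hy, rfl⟩
  apply LieAlgebra.engel_isBot_of_isMin h (LieSubalgebra.engel K x) Ex le_rfl
  rintro ⟨_, y, hy, rfl⟩ hyx
  suffices finrank K (LieSubalgebra.engel K x) ≤ finrank K (LieSubalgebra.engel K y) by
    suffices LieSubalgebra.engel K y = LieSubalgebra.engel K x from this.ge
    apply LieSubalgebra.toSubmodule_injective
    exact Submodule.eq_of_le_of_finrank_le hyx this
  rw [(LieAlgebra.isRegular_iff_finrank_engel_eq_rank K x).mp hx]
  apply LieAlgebra.rank_le_finrank_engel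

theorem ker_le [LieAlgebra.IsKilling K g] {r : ℕ}
    (hr : ∀ H : LieSubalgebra K g, H.IsCartanSubalgebra → r = finrank K H) (x : g) :
    r ≤ finrank K (LinearMap.ker (LieAlgebra.ad K g x)) := by
  obtain ⟨y, hy⟩ := LieAlgebra.exists_isRegular K g
  obtain ⟨p, hp⟩ := line_charpoly (LieAlgebra.ad K g y) (LieAlgebra.ad K g (x - y)) (LieAlgebra.rank K g)
  obtain ⟨q, hq0, hq⟩ := line_rank (LieAlgebra.ad K g y) (LieAlgebra.ad K g (x - y))
  have hp0 : p ≠ 0 := by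
    rintro rfl
    have := hp 0
    rw [LieAlgebra.isRegular_def] at hy
    simp at this
    exact hy this.symm
  have : ∃ s : K, (p * q).eval s ≠ 0 := by
    by_contra hcon
    push Not at hcon
    exact mul_ne_zero hp0 hq0 (Polynomial.funext (by simpa using hcon))
  obtain ⟨s, hs⟩ := this
  rw [Polynomial.eval_mul] at hs
  have h1 := left_ne_zero_of_mul hs
  have h2 := hq s (right_ne_zero_of_mul hs)
  set z := y + s • (x - y) with hz
  have hzad : LieAlgebra.ad K g y + s • LieAlgebra.ad K g (x - y) = LieAlgebra.ad K g z := by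
    simp [hz]
  have hxad : LieAlgebra.ad K g y + LieAlgebra.ad K g (x - y) = LieAlgebra.ad K g x := by
    rw [← map_add]; simp
  rw [hp, hzad, ← LieAlgebra.isRegular_def] at h1
  rw [hzad, hxad] at h2
  haveI hC := cartan_of_regular h1
  have hr' := hr _ hC
  have hab : IsLieAbelian (LieSubalgebra.engel K z) :=
    LieAlgebra.IsKilling.instIsLieAbelianOfIsCartanSubalgebra K g _
  have h3 : (LieSubalgebra.engel K z).toSubmodule ≤ LinearMap.ker (LieAlgebra.ad K g z) := by
    intro u hu
    have := hab.trivial ⟨z, LieSubalgebra.self_mem_engel _ _⟩ ⟨u, hu⟩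
    have := congrArg Subtype.val this
    simpa using this
  have h4 := Submodule.finrank_mono h3
  have h5 := LinearMap.finrank_range_add_finrank_ker (LieAlgebra.ad K g z)
  have h6 := LinearMap.finrank_range_add_finrank_ker (LieAlgebra.ad K g x)
  have h7 : r = finrank K (LieSubalgebra.engel K z).toSubmodule := hr'
  omega

end Lie
end KK

set_option linter.all false
namespace KK
open Module

section WBsec
variable {K : Type*} [Field K] [CharZero K] [IsAlgClosed K]
variable {g : Type*} [LieRing g] [LieAlgebra K g] [FiniteDimensional K g]

theorem trip_ad {e h f : g}
    (hhe : ⁅h, e⁆ = (2 : K) • e) (hhf : ⁅h, f⁆ = (-2 : K) • f) (hef : ⁅e, f⁆ = h) :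
    Trip (LieAlgebra.ad K g e) (LieAlgebra.ad K g h) (LieAlgebra.ad K g f) where
  HE v := by
    simp only [LieAlgebra.ad_apply]
    rw [leibniz_lie h e v, hhe, smul_lie]; abel
  HF v := by
    simp only [LieAlgebra.ad_apply]
    rw [leibniz_lie h f v, hhf, smul_lie, neg_smul]; abel
  EF v := by
    simp only [LieAlgebra.ad_apply]
    rw [leibniz_lie e f v, hef]; abel

theorem killing_weight {h x y : g} {a b : K} (hx : ⁅h, x⁆ = a • x) (hy : ⁅h, y⁆ = b • y)
    (hab : a + b ≠ 0) : killingForm K g x y = 0 := by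
  have h1 := LieModule.traceForm_apply_lie_apply K g g x h y
  have h2 := LieModule.traceForm_apply_lie_apply K g g h x y
  have e1 : killingForm K g ⁅h, x⁆ y = - killingForm K g x ⁅h, y⁆ := by
    have : ⁅h, x⁆ = -⁅x, h⁆ := (lie_skew h x).symm
    rw [this, map_neg, LinearMap.neg_apply]
    exact congrArg Neg.neg h1
  rw [hx, hy, map_smul, map_smul, LinearMap.smul_apply, smul_eq_mul, smul_eq_mul] at e1
  have : (a + b) * killingForm K g x y = 0 := by rw [add_mul, e1]; ring
  exact (mul_eq_zero.1 this).resolve_left hab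

/-- Adapted weight basis. -/
structure WB {ι : Type*} (e h f : g) (b : Basis ι K g) (w : ι → ℤ) (i0 : ι) : Prop where
  hhe : ⁅h, e⁆ = (2 : K) • e
  hhf : ⁅h, f⁆ = (-2 : K) • f
  hef : ⁅e, f⁆ = h
  hw : ∀ i, ⁅h, b i⁆ = (w i : K) • b i
  hi0 : w i0 = -2
  chi : ∀ i, i ≠ i0 → killingForm K g e (b i) = 0
  chi0 : killingForm K g e (b i0) ≠ 0
  even : ∀ i, Even (w i)
  ker : ∀ x : g, Nat.card {i // w i = 0} ≤ finrank K (LinearMap.ker (LieAlgebra.ad K g x))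

theorem exists_basis {e h f : g}
    (hhe : ⁅h, e⁆ = (2 : K) • e) (hhf : ⁅h, f⁆ = (-2 : K) • f) (hef : ⁅e, f⁆ = h) :
    ∃ (n : ℕ) (b : Basis (Fin n) K g) (w : Fin n → ℤ), ∀ i, ⁅h, b i⁆ = (w i : K) • b i := by
  classical
  have t := trip_ad hhe hhf hef
  have hind : iSupIndep (fun i : ℤ => (LieAlgebra.ad K g h).eigenspace (i : K)) :=
    (Module.End.eigenspaces_iSupIndep (LieAlgebra.ad K g h)).comp Int.cast_injective
  have hint := DirectSum.isInternal_submodule_of_iSupIndep_of_iSup_eq_top hind t.top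
  let b0 := hint.collectedBasis (fun i => Module.finBasis K ((LieAlgebra.ad K g h).eigenspace (i : K)))
  haveI : Fintype ((i : ℤ) × Fin (finrank K ((LieAlgebra.ad K g h).eigenspace (i : K)))) :=
    FiniteDimensional.fintypeBasisIndex b0
  let eq := Fintype.equivFin ((i : ℤ) × Fin (finrank K ((LieAlgebra.ad K g h).eigenspace (i : K))))
  refine ⟨_, b0.reindex eq, fun i => (eq.symm i).1, fun i => ?_⟩
  rw [Basis.reindex_apply]
  have := hint.collectedBasis_mem (fun i => Module.finBasis K ((LieAlgebra.ad K g h).eigenspace (i : K))) (eq.symm i)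
  exact (End.mem_eigenspace_iff).1 this

variable {ι : Type*} [Fintype ι] [DecidableEq ι]

theorem span_card (b : Basis ι K g) (s : Set ι) [Fintype s] :
    finrank K (Submodule.span K (b '' s)) = Fintype.card s := by
  have h1 : LinearIndependent K (fun i : s => b i) := b.linearIndependent.comp _ Subtype.val_injective
  have := finrank_span_eq_card h1
  rw [← this]
  have h2 : b '' s = Set.range (fun i : s => b i) := by ext x; simp
  rw [h2]

theorem repr_zero_of_eig {h x : g} {b : Basis ι K g} {w : ι → ℤ}
    (hw : ∀ i, ⁅h, b i⁆ = (w i : K) • b i) {a : ℤ} (hx : ⁅h, x⁆ = (a : K) • x) {i : ι}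
    (hi : w i ≠ a) : b.repr x i = 0 := by
  have h1 : ⁅h, x⁆ = ∑ j, (b.repr x j * (w j : K)) • b j := by
    conv_lhs => rw [← b.sum_repr x]
    rw [lie_sum]
    refine Finset.sum_congr rfl fun j _ => ?_
    rw [lie_smul, hw, smul_smul]
  have h2 := congrArg (fun y => b.repr y i) h1
  simp only [hx, map_smul, Finsupp.smul_apply, smul_eq_mul] at h2
  rw [Basis.repr_sum_self] at h2
  have : ((w i : K) - a) * b.repr x i = 0 := by linear_combination -h2
  refine (mul_eq_zero.1 this).resolve_left ?_
  intro h3; exact hi (by exact_mod_cast sub_eq_zero.1 h3)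

theorem eig_add {h x y : g} {a c : ℤ} (hx : ⁅h, x⁆ = (a : K) • x) (hy : ⁅h, y⁆ = (c : K) • y) :
    ⁅h, ⁅x, y⁆⁆ = ((a + c : ℤ) : K) • ⁅x, y⁆ := by
  rw [leibniz_lie, hx, hy, smul_lie, lie_smul, ← add_smul]; push_cast; rfl

theorem exists_WB [LieAlgebra.IsKilling K g] {e h f : g} (he : e ≠ 0)
    (hhe : ⁅h, e⁆ = (2 : K) • e) (hhf : ⁅h, f⁆ = (-2 : K) • f) (hef : ⁅e, f⁆ = h)
    (hprin : ∀ H : LieSubalgebra K g, H.IsCartanSubalgebra →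
      Module.finrank K (LinearMap.ker (LieAlgebra.ad K g e)) = Module.finrank K H) :
    ∃ (n : ℕ) (b : Basis (Fin n) K g) (w : Fin n → ℤ) (i0 : Fin n), WB e h f b w i0 := by
  classical
  obtain ⟨n, b, w, hw⟩ := exists_basis hhe hhf hef
  have t := trip_ad hhe hhf hef
  have hker := ker_le hprin
  -- i0
  have hex : ∃ i0, killingForm K g e (b i0) ≠ 0 := by
    by_contra hcon
    push Not at hcon
    refine he ((LieAlgebra.IsKilling.killingForm_nondegenerate K g).1 e fun y => ?_)
    have : killingForm K g e = 0 := b.ext (by simpa using hcon)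
    rw [this]; simp
  obtain ⟨i0, hi0⟩ := hex
  have hw2 : ∀ i, killingForm K g e (b i) ≠ 0 → w i = -2 := by
    intro i hi
    by_contra h2
    refine hi (killing_weight hhe (hw i) ?_)
    intro h3
    apply h2
    have : (2 + w i : ℤ) = 0 := by exact_mod_cast h3
    omega
  -- dimension count
  have hcount : Fintype.card {i // w i = 0} + Fintype.card {i // w i = 1} ≤
      finrank K (LinearMap.ker (LieAlgebra.ad K g e)) := by
    let W0 := Submodule.span K (b '' {i | 0 ≤ w i})
    let W2 := Submodule.span K (b '' {i | 2 ≤ w i})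
    have hmap : ∀ x ∈ W0, LieAlgebra.ad K g e x ∈ W2 := by
      have : W0 ≤ W2.comap (LieAlgebra.ad K g e) := by
        refine Submodule.span_le.2 ?_
        rintro _ ⟨i, hi, rfl⟩
        simp only [SetLike.mem_coe, Submodule.mem_comap, LieAlgebra.ad_apply]
        have h1 : ⁅h, ⁅e, b i⁆⁆ = ((2 + w i : ℤ) : K) • ⁅e, b i⁆ :=
          eig_add (by exact_mod_cast hhe) (hw i)
        rw [← b.sum_repr ⁅e, b i⁆]
        refine Submodule.sum_mem _ fun j _ => ?_
        by_cases hj : w j = 2 + w i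
        · refine Submodule.smul_mem _ _ (Submodule.subset_span ⟨j, ?_, rfl⟩)
          simp only [Set.mem_setOf_eq] at *; omega
        · rw [repr_zero_of_eig hw h1 hj, zero_smul]; exact zero_mem _
      exact this
    let T := (LieAlgebra.ad K g e).restrict hmap
    have h1 := LinearMap.finrank_range_add_finrank_ker T
    have h2 := Submodule.finrank_le (LinearMap.range T)
    have h3 : finrank K (LinearMap.ker T) ≤ finrank K (LinearMap.ker (LieAlgebra.ad K g e)) := by
      have : Submodule.map W0.subtype (LinearMap.ker T) ≤ LinearMap.ker (LieAlgebra.ad K g e) := by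
        rintro _ ⟨x, hx, rfl⟩
        have := congrArg Subtype.val (LinearMap.mem_ker.1 hx)
        simpa [T] using this
      have h4 := Submodule.finrank_mono this
      rwa [Submodule.finrank_map_subtype_eq] at h4
    have h5 : finrank K W0 = Fintype.card {i // 0 ≤ w i} := span_card b {i | 0 ≤ w i}
    have h6 : finrank K W2 = Fintype.card {i // 2 ≤ w i} := span_card b {i | 2 ≤ w i}
    have h7 : Fintype.card {i // 0 ≤ w i} = Fintype.card {i // w i = 0} +
        Fintype.card {i // w i = 1} + Fintype.card {i // 2 ≤ w i} := by
      simp only [Fintype.card_subtype]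
      rw [← Finset.card_union_of_disjoint, ← Finset.card_union_of_disjoint]
      · congr 1; ext i; simp; omega
      · rw [Finset.disjoint_left]; intro i; simp; omega
      · rw [Finset.disjoint_left]; intro i; simp
        omega
    omega
  have hkh : finrank K (LinearMap.ker (LieAlgebra.ad K g h)) ≤ Fintype.card {i // w i = 0} := by
    have : LinearMap.ker (LieAlgebra.ad K g h) ≤ Submodule.span K (b '' {i | w i = 0}) := by
      intro x hx
      rw [← b.sum_repr x]
      refine Submodule.sum_mem _ fun j _ => ?_
      by_cases hj : w j = 0
      · exact Submodule.smul_mem _ _ (Submodule.subset_span ⟨j, hj, rfl⟩)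
      · rw [repr_zero_of_eig hw (x := x) (a := 0) (by simpa using hx) hj, zero_smul]; exact zero_mem _
    refine (Submodule.finrank_mono this).trans ?_
    exact (span_card b {i | w i = 0}).le
  have h1 := hker h
  have hc1 : Fintype.card {i // w i = 1} = 0 := by omega
  rw [Fintype.card_eq_zero_iff] at hc1
  have e1 : (LieAlgebra.ad K g h).eigenspace ((1 : ℤ) : K) = ⊥ := by
    rw [eq_bot_iff]
    intro x hx
    rw [End.mem_eigenspace_iff] at hx
    rw [Submodule.mem_bot, ← b.sum_repr x]
    refine Finset.sum_eq_zero fun j _ => ?_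
    rw [repr_zero_of_eig hw (x := x) (a := 1) hx (fun h => hc1.false ⟨j, h⟩), zero_smul]
  have pos : ∀ n : ℕ, (LieAlgebra.ad K g h).eigenspace ((1 + 2 * n : ℤ) : K) = ⊥ := by
    intro n
    induction n with
    | zero => simpa using e1
    | succ n ih =>
      rw [eq_bot_iff]
      intro x hx
      obtain ⟨u, hu, rfl⟩ := t.E_surj (m := 1 + 2 * (n + 1 : ℕ)) (by omega) hx
      have : (1 + 2 * (n + 1 : ℕ) - 2 : ℤ) = 1 + 2 * n := by push_cast; ring
      rw [this, ih] at hu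
      rw [(Submodule.mem_bot K).1 hu, map_zero]; exact zero_mem _
  have neg : ∀ n : ℕ, (LieAlgebra.ad K g h).eigenspace ((1 - 2 * n : ℤ) : K) = ⊥ := by
    intro n
    induction n with
    | zero => simpa using e1
    | succ n ih =>
      rw [eq_bot_iff]
      intro x hx
      refine (Submodule.mem_bot K).2 (t.E_inj (m := 1 - 2 * (n + 1 : ℕ)) (by push_cast; omega) hx ?_)
      have := t.E_eig hx
      have h2 : (((1 - 2 * (n + 1 : ℕ) : ℤ) : K) + 2) = ((1 - 2 * n : ℤ) : K) := by push_cast; ring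
      rw [h2, ih] at this
      exact this
  have odd : ∀ i, Even (w i) := by
    intro i
    by_contra ho
    rw [Int.not_even_iff_odd] at ho
    have hmem : b i ∈ (LieAlgebra.ad K g h).eigenspace (w i : K) := (End.mem_eigenspace_iff).2 (hw i)
    have hz : (LieAlgebra.ad K g h).eigenspace (w i : K) = ⊥ := by
      obtain ⟨k, hk⟩ := ho
      rcases Int.eq_nat_or_neg k with ⟨n, rfl | rfl⟩
      · rw [hk, add_comm]; exact pos n
      · have : w i = 1 - 2 * n := by omega
        rw [this]; exact neg n
    rw [hz] at hmem
    exact b.ne_zero i hmem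
  -- the transvection
  let ψ : Module.Dual K g := b.coord i0 - (killingForm K g e (b i0))⁻¹ • killingForm K g e
  have hψ : ψ (b i0) = 0 := by simp [ψ, hi0]
  let τ := LinearEquiv.transvection hψ
  have hτ : ∀ x, τ x = x + ψ x • b i0 := fun x => by
    simp [τ, LinearEquiv.transvection, LinearMap.transvection]
  have hψ0 : ∀ i, ψ (b i) ≠ 0 → w i = -2 := by
    intro i hi
    by_cases h : i = i0
    · rw [h]; exact hw2 _ hi0
    · apply hw2
      intro h0
      apply hi
      simp [ψ, h0, Finsupp.single_apply, h]
  refine ⟨n, b.map τ, w, i0, hhe, hhf, hef, ?_, hw2 _ hi0, ?_, ?_, odd, ?_⟩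
  · intro i
    rw [Basis.map_apply, hτ, lie_add, lie_smul, hw, hw, smul_add]
    congr 1
    by_cases h0 : ψ (b i) = 0
    · simp [h0]
    · rw [hψ0 i h0, hw2 _ hi0, smul_comm]
  · intro i hi
    rw [Basis.map_apply, hτ, map_add, map_smul]
    simp only [ψ, LinearMap.sub_apply, Basis.coord_apply, Basis.repr_self, LinearMap.smul_apply, smul_eq_mul,
      Finsupp.single_apply, if_neg hi]
    field_simp; ring
  · rw [Basis.map_apply, hτ, hψ]; simpa using hi0
  · intro x
    rw [Nat.card_eq_fintype_card]
    have := hker x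
    omega

end WBsec
end KK

set_option linter.all false
namespace KK
open Module MvPolynomial

section E1
variable {K : Type*} [Field K] [CharZero K]
variable {g : Type*} [LieRing g] [LieAlgebra K g] [FiniteDimensional K g]
variable {ι : Type*} [Fintype ι] [DecidableEq ι]

/-- linear functions -/
noncomputable def jj (b : Basis ι K g) : g →ₗ[K] MvPolynomial ι K := b.constr K (fun i => X i)

theorem jj_basis (b : Basis ι K g) (i : ι) : jj b (b i) = X i := b.constr_basis _ _ _

theorem jj_eq (b : Basis ι K g) (x : g) : jj b x = ∑ i, C (b.repr x i) * X i := by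
  conv_lhs => rw [← b.sum_repr x]
  rw [map_sum]
  refine Finset.sum_congr rfl fun i _ => ?_
  rw [map_smul, jj_basis, smul_eq_C_mul]

/-- Poisson derivations -/
noncomputable def LL (b : Basis ι K g) :
    g →ₗ[K] Derivation K (MvPolynomial ι K) (MvPolynomial ι K) where
  toFun ξ := mkDerivation K (fun i => jj b ⁅ξ, b i⁆)
  map_add' x y := by
    refine derivation_ext fun i => ?_
    rw [Derivation.add_apply, mkDerivation_X, mkDerivation_X, mkDerivation_X, add_lie, map_add]
  map_smul' c x := by
    refine derivation_ext fun i => ?_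
    rw [RingHom.id_apply, Derivation.smul_apply, mkDerivation_X, mkDerivation_X, smul_lie, map_smul]

theorem LL_X (b : Basis ι K g) (ξ : g) (i : ι) : LL b ξ (X i) = jj b ⁅ξ, b i⁆ := mkDerivation_X _ _ _

theorem LL_jj (b : Basis ι K g) (ξ y : g) : LL b ξ (jj b y) = jj b ⁅ξ, y⁆ := by
  have : (LL b ξ : MvPolynomial ι K →ₗ[K] MvPolynomial ι K) ∘ₗ jj b = jj b ∘ₗ (LieAlgebra.ad K g ξ) := by
    refine b.ext fun i => ?_
    simp only [LinearMap.comp_apply, jj_basis, Derivation.coeFn_coe, LL_X, LieAlgebra.ad_apply]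
  exact LinearMap.congr_fun this y

theorem LL_lie (b : Basis ι K g) (ξ η : g) (p : MvPolynomial ι K) :
    LL b ξ (LL b η p) - LL b η (LL b ξ p) = LL b ⁅ξ, η⁆ p := by
  have : ⁅LL b ξ, LL b η⁆ = LL b ⁅ξ, η⁆ := by
    refine derivation_ext fun i => ?_
    rw [Derivation.commutator_apply, LL_X, LL_X, LL_X, LL_jj, LL_jj, ← map_sub, lie_lie]
  rw [← this, Derivation.commutator_apply]

theorem LL_sum (b : Basis ι K g) (x : g) (p : MvPolynomial ι K) :
    LL b x p = ∑ k, b.repr x k • LL b (b k) p := by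
  conv_lhs => rw [← b.sum_repr x]
  let T : g →ₗ[K] MvPolynomial ι K :=
    { toFun := fun x => LL b x p, map_add' := by intros; simp, map_smul' := by intros; simp }
  change T _ = _
  rw [map_sum]
  refine Finset.sum_congr rfl fun i _ => ?_
  rw [map_smul]; rfl

theorem LL_struct (b : Basis ι K g) (i j : ι) : ∃ c : ι → K, ∀ p,
    LL b (b i) (LL b (b j) p) - LL b (b j) (LL b (b i) p) = ∑ k, c k • LL b (b k) p :=
  ⟨fun k => b.repr ⁅b i, b j⁆ k, fun p => by rw [LL_lie, LL_sum]⟩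

/-- evaluation at a point -/
noncomputable def ev (b : Basis ι K g) (x : g) : MvPolynomial ι K →ₐ[K] K :=
  aeval (fun i => killingForm K g (b i) x)

theorem ev_X (b : Basis ι K g) (x : g) (i : ι) : ev b x (X i) = killingForm K g (b i) x := by
  simp [ev]

theorem ev_C (b : Basis ι K g) (x : g) (c : K) : ev b x (C c) = c := by
  simp [ev]

theorem ev_jj (b : Basis ι K g) (x ξ : g) : ev b x (jj b ξ) = killingForm K g ξ x := by
  have : (ev b x).toLinearMap ∘ₗ jj b = (killingForm K g).flip x := by
    refine b.ext fun i => ?_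
    simp [jj_basis, ev_X]
  exact LinearMap.congr_fun this ξ

theorem kf_assoc (x y z : g) : killingForm K g ⁅x, y⁆ z = killingForm K g x ⁅y, z⁆ :=
  LieModule.traceForm_apply_lie_apply K g g x y z

theorem kf_comm (x y : g) : killingForm K g x y = killingForm K g y x :=
  LieModule.traceForm_comm K g g x y

theorem kf_rot (v y x : g) : killingForm K g ⁅v, y⁆ x = killingForm K g y ⁅x, v⁆ := by
  rw [← kf_comm, ← kf_assoc, kf_comm]

theorem ev_LL (b : Basis ι K g) (x v : g) (p : MvPolynomial ι K) :
    ev b x (LL b v p) = ∑ i, ev b x (pderiv i p) * killingForm K g (b i) ⁅x, v⁆ := by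
  rw [deriv_eq_sum, map_sum]
  refine Finset.sum_congr rfl fun i _ => ?_
  rw [map_mul, LL_X, ev_jj, kf_rot]

/-- Setting the variables in `Z` to zero. -/
noncomputable def pr (K : Type*) [Field K] (Z : Finset ι) : MvPolynomial ι K →ₐ[K] MvPolynomial ι K :=
  aeval (fun i => if i ∈ Z then 0 else X i)

variable {Z : Finset ι}

theorem pr_sub_mem (p : MvPolynomial ι K) : p - pr K Z p ∈ Fil (zw Z) 1 := by
  induction p using MvPolynomial.induction_on with
  | C a => simp [pr]
  | add p q hp hq =>
    rw [map_add, add_sub_add_comm]; exact Ideal.add_mem _ hp hq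
  | mul_X p i hp =>
    rw [map_mul]
    have h1 : (X i : MvPolynomial ι K) - pr K Z (X i) ∈ Fil (zw Z) 1 := by
      by_cases hi : i ∈ Z
      · have : pr K Z (X i) = 0 := by simp [pr, hi]
        rw [this, sub_zero]
        have := Fil_X (K := K) (z := zw Z) i
        rwa [zw_mem hi] at this
      · have : pr K Z (X i) = X i := by simp [pr, hi]
        rw [this, sub_self]; exact zero_mem _
    have : p * X i - pr K Z p * pr K Z (X i) = (p - pr K Z p) * X i + pr K Z p * (X i - pr K Z (X i)) := by
      ring
    rw [this]
    exact Ideal.add_mem _ (Ideal.mul_mem_right _ _ hp) (Ideal.mul_mem_left _ _ h1)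

theorem pr_hom (p : MvPolynomial ι K) : IsWeightedHomogeneous (zw Z) (pr K Z p) 0 := by
  induction p using MvPolynomial.induction_on with
  | C a => simpa [pr] using isWeightedHomogeneous_C (zw Z) a
  | add p q hp hq => rw [map_add]; exact hp.add hq
  | mul_X p i hp =>
    rw [map_mul]
    have h1 : IsWeightedHomogeneous (zw Z) (pr K Z (X i)) 0 := by
      by_cases hi : i ∈ Z
      · have : pr K Z (X i) = 0 := by simp [pr, hi]
        rw [this]; exact isWeightedHomogeneous_zero _ _ _
      · have : pr K Z (X i) = X i := by simp [pr, hi]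
        rw [this]
        have := isWeightedHomogeneous_X K (zw Z) i
        rwa [zw_not hi] at this
    simpa using hp.mul h1

theorem pr_of_mem {p : MvPolynomial ι K} (hp : p ∈ Fil (zw Z) 1) : pr K Z p = 0 := by
  refine hom_eq_zero (z := zw Z) (pr_hom p) ?_
  have := Ideal.sub_mem _ hp (pr_sub_mem (Z := Z) p)
  simpa using this

theorem mem_of_pr {p : MvPolynomial ι K} (hp : pr K Z p = 0) : p ∈ Fil (zw Z) 1 := by
  have := pr_sub_mem (Z := Z) p
  rwa [hp, sub_zero] at this

/-- dual basis -/
noncomputable def bd [LieAlgebra.IsKilling K g] (b : Basis ι K g) : Basis ι K g :=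
  LinearMap.BilinForm.dualBasis (killingForm K g) (LieAlgebra.IsKilling.killingForm_nondegenerate K g) b

theorem kf_bd [LieAlgebra.IsKilling K g] (b : Basis ι K g) (i j : ι) :
    killingForm K g (bd b i) (b j) = if j = i then 1 else 0 :=
  LinearMap.BilinForm.apply_dualBasis_left _ _ i j

theorem exists_point [LieAlgebra.IsKilling K g] (b : Basis ι K g) (c : ι → K) :
    ∃ x : g, ∀ i, killingForm K g (b i) x = c i := by
  refine ⟨∑ i, c i • bd b i, fun j => ?_⟩
  rw [kf_comm, map_sum, LinearMap.sum_apply]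
  simp [kf_bd]

theorem ev_of_mem (b : Basis ι K g) {p : MvPolynomial ι K} (hp : p ∈ Fil (zw Z) 1) {x : g}
    (hx : ∀ γ ∈ Z, killingForm K g (b γ) x = 0) : ev b x p = 0 := by
  have : (ev b x).comp (pr K Z) = ev b x := by
    refine algHom_ext fun i => ?_
    by_cases hi : i ∈ Z
    · simp [pr, hi, ev_X, hx i hi]
    · simp [pr, hi]
  rw [← this, AlgHom.comp_apply, pr_of_mem hp, map_zero]

theorem mem_of_ev [LieAlgebra.IsKilling K g] (b : Basis ι K g) {p : MvPolynomial ι K}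
    (h : ∀ x : g, (∀ γ ∈ Z, killingForm K g (b γ) x = 0) → ev b x p = 0) : p ∈ Fil (zw Z) 1 := by
  apply mem_of_pr
  refine MvPolynomial.funext fun c => ?_
  obtain ⟨x, hx⟩ := exists_point b (fun i => if i ∈ Z then 0 else c i)
  have h1 := h x (fun γ hγ => by rw [hx, if_pos hγ])
  have : (aeval c : MvPolynomial ι K →ₐ[K] K).comp (pr K Z) = ev b x := by
    refine algHom_ext fun i => ?_
    by_cases hi : i ∈ Z
    · simp [pr, hi, ev_X, hx i]
    · simp [pr, hi, ev_X, hx i]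
  rw [map_zero, ← h1, ← this]
  simp [aeval_def, eval₂_eq_eval_map]

/-- ext data from vectors -/
theorem extData_of (b : Basis ι K g) (ζ : ι → g)
    (hne : (Matrix.of fun γ γ' : Z => pr K Z (jj b ⁅ζ γ', b γ⁆)).det ≠ 0) :
    ∃ N, ExtData (fun i => LL b (b i)) Z N (Matrix.of fun γ γ' : Z => pr K Z (jj b ⁅ζ γ', b γ⁆)).det := by
  classical
  set M := Matrix.of fun γ γ' : Z => pr K Z (jj b ⁅ζ γ', b γ⁆) with hM
  refine ⟨fun γ i => if hγ : γ ∈ Z then ∑ γ' : Z, C (b.repr (ζ γ') i) * M.adjugate γ' ⟨γ, hγ⟩ else 0, ?_, hne, ?_⟩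
  · have : M = (pr K Z).toRingHom.mapMatrix (Matrix.of fun γ γ' : Z => (jj b ⁅ζ γ', b γ⁆)) := by
      ext i j; simp [hM]
    rw [this, ← RingHom.map_det]
    exact pr_hom _
  · intro γ hγ γ'' hγ''
    have h1 : Vd (fun i => LL b (b i)) (fun i => if hγ : γ ∈ Z then ∑ γ' : Z, C (b.repr (ζ γ') i) * M.adjugate γ' ⟨γ, hγ⟩ else 0) (X γ'')
        = ∑ γ' : Z, jj b ⁅ζ γ', b γ''⁆ * M.adjugate γ' ⟨γ, hγ⟩ := by
      rw [Vd_apply]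
      simp only [dif_pos hγ, Finset.sum_mul]
      rw [Finset.sum_comm]
      refine Finset.sum_congr rfl fun γ' _ => ?_
      rw [← LL_X, LL_sum b (ζ γ'), Finset.sum_mul]
      refine Finset.sum_congr rfl fun i _ => ?_
      rw [smul_eq_C_mul]; ring
    have h2 : (if γ'' = γ then M.det else 0) = ∑ γ' : Z, pr K Z (jj b ⁅ζ γ', b γ''⁆) * M.adjugate γ' ⟨γ, hγ⟩ := by
      have := congrFun (congrFun (Matrix.mul_adjugate M) ⟨γ'', hγ''⟩) ⟨γ, hγ⟩
      rw [Matrix.mul_apply] at this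
      simp only [Matrix.smul_apply, Matrix.one_apply, Subtype.mk.injEq, smul_eq_mul, mul_ite, mul_one, mul_zero] at this
      rw [← this]; rfl
    rw [h1, h2, ← Finset.sum_sub_distrib]
    refine Ideal.sum_mem _ fun γ' _ => ?_
    rw [← sub_mul]
    exact Ideal.mul_mem_right _ _ (pr_sub_mem _)

end E1
end KK

set_option linter.all false
namespace KK
open Module MvPolynomial

section E2
variable {K : Type*} [Field K] [CharZero K] [IsAlgClosed K]
variable {g : Type*} [LieRing g] [LieAlgebra K g] [FiniteDimensional K g] [LieAlgebra.IsKilling K g]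
variable {ι : Type*} [Fintype ι] [DecidableEq ι]
variable {e h f : g} {b : Basis ι K g} {w : ι → ℤ} {i0 : ι}

def Zs (w : ι → ℤ) (i0 : ι) : Finset ι := Finset.univ.filter (fun i => w i < 0 ∧ i ≠ i0)

theorem mem_Zs {i : ι} : i ∈ Zs w i0 ↔ w i < 0 ∧ i ≠ i0 := by simp [Zs]

theorem kf_nondeg {x : g} (hx : ∀ i, killingForm K g x (b i) = 0) : x = 0 := by
  refine (LieAlgebra.IsKilling.killingForm_nondegenerate K g).1 x fun y => ?_
  have : killingForm K g x = 0 := b.ext (by simpa using hx)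
  rw [this]; simp

theorem kf_neg (h x y : g) : killingForm K g ⁅h, x⁆ y = - killingForm K g x ⁅h, y⁆ := by
  rw [← lie_skew, map_neg, LinearMap.neg_apply, kf_assoc]

theorem WB.bd_w (W : WB e h f b w i0) (i : ι) : ⁅h, bd b i⁆ = ((-w i : ℤ) : K) • bd b i := by
  rw [← sub_eq_zero]
  refine kf_nondeg (b := b) fun j => ?_
  rw [map_sub, LinearMap.sub_apply, kf_neg, W.hw, map_smul, map_smul, LinearMap.smul_apply, kf_bd]
  by_cases hij : j = i
  · subst hij; simp
  · simp [hij]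

theorem WB.chi_eq (W : WB e h f b w i0) (x : g) :
    killingForm K g e x = killingForm K g e (b i0) * b.repr x i0 := by
  have : killingForm K g e = killingForm K g e (b i0) • b.coord i0 := by
    refine b.ext fun i => ?_
    by_cases hi : i = i0
    · subst hi; simp
    · rw [W.chi i hi]; simp [Finsupp.single_apply, hi]
  conv_lhs => rw [this]
  simp

theorem WB.trip (W : WB e h f b w i0) :
    Trip (LieAlgebra.ad K g e) (LieAlgebra.ad K g h) (LieAlgebra.ad K g f) :=
  trip_ad W.hhe W.hhf W.hef

theorem WB.surj (W : WB e h f b w i0) {y : g} {m : ℤ} (hm : 1 ≤ m) (hy : ⁅h, y⁆ = (m : K) • y) :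
    ∃ u, ⁅h, u⁆ = ((m - 2 : ℤ) : K) • u ∧ ⁅e, u⁆ = y := by
  obtain ⟨u, hu, hu'⟩ := W.trip.E_surj hm (End.mem_eigenspace_iff.2 hy)
  exact ⟨u, End.mem_eigenspace_iff.1 hu, hu'⟩

theorem WB.pr_jj (W : WB e h f b w i0) {x : g} {m : ℤ} (hx : ⁅h, x⁆ = (m : K) • x) (hm : m ≤ -2) :
    pr K (Zs w i0) (jj b x) = C (b.repr x i0) * X i0 := by
  rw [jj_eq, map_sum, Finset.sum_eq_single i0]
  · have : i0 ∉ Zs w i0 := by simp [mem_Zs]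
    simp [pr, this]
  · intro i _ hi
    by_cases hwi : w i = m
    · have : i ∈ Zs w i0 := mem_Zs.2 ⟨by omega, hi⟩
      simp [pr, this]
    · rw [repr_zero_of_eig W.hw hx hwi]; simp
  · simp

theorem WB.ext2 (W : WB e h f b w i0) : ∃ (N : _) (k : ℕ),
    ExtData (fun i => LL b (b i)) (Zs w i0) N ((C (killingForm K g e (b i0))⁻¹ * X i0) ^ k) := by
  classical
  have hex : ∀ γ : ι, ∃ u, w γ < 0 → (⁅h, u⁆ = ((-w γ - 2 : ℤ) : K) • u ∧ ⁅e, u⁆ = bd b γ) := by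
    intro γ
    by_cases hγ : w γ < 0
    · obtain ⟨u, hu⟩ := W.surj (m := - w γ) (by omega) (W.bd_w γ)
      exact ⟨u, fun _ => hu⟩
    · exact ⟨0, fun h => absurd h hγ⟩
  choose ζ hζ using hex
  set M := Matrix.of fun γ γ' : Zs w i0 => pr K (Zs w i0) (jj b ⁅ζ γ', b γ⁆) with hM
  set π : MvPolynomial ι K := C (killingForm K g e (b i0))⁻¹ * X i0 with hπ
  have hent : ∀ γ γ' : Zs w i0, w γ ≤ w γ' → M γ γ' = if γ = γ' then π else 0 := by
    intro γ γ' hle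
    have h1 := hζ γ' (mem_Zs.1 γ'.2).1
    have h2 : ⁅h, ⁅ζ γ', b γ⁆⁆ = ((-w γ' - 2 + w γ : ℤ) : K) • ⁅ζ γ', b γ⁆ := eig_add h1.1 (W.hw γ)
    have h3 : b.repr ⁅ζ γ', b γ⁆ i0 = (killingForm K g e (b i0))⁻¹ * if γ = γ' then 1 else 0 := by
      have h4 := W.chi_eq ⁅ζ γ', b γ⁆
      rw [← kf_assoc, h1.2, kf_bd] at h4
      have h5 : ((γ : ι) = (γ' : ι)) ↔ γ = γ' := Subtype.ext_iff.symm
      simp only [h5] at h4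
      rw [h4, inv_mul_cancel_left₀ W.chi0]
    change pr K (Zs w i0) (jj b ⁅ζ γ', b γ⁆) = _
    rw [W.pr_jj h2 (by omega), h3]
    split_ifs <;> simp [hπ]
  have htri : M.BlockTriangular (fun γ : Zs w i0 => - w γ) := by
    intro γ γ' hlt
    rw [hent γ γ' (by simp at hlt; omega), if_neg]
    rintro rfl; simp at hlt
  have hdet : ∃ k, M.det = π ^ k := by
    rw [htri.det]
    refine ⟨∑ a ∈ Finset.univ.image (fun γ : Zs w i0 => - w γ), Fintype.card {γ : Zs w i0 // - w γ = a}, ?_⟩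
    rw [← Finset.prod_pow_eq_pow_sum]
    refine Finset.prod_congr rfl fun a _ => ?_
    have : M.toSquareBlock (fun γ : Zs w i0 => - w γ) a = Matrix.scalar _ π := by
      ext1 x y
      have : M.toSquareBlock (fun γ : Zs w i0 => - w γ) a x y = M x.1 y.1 := rfl
      rw [this, hent x.1 y.1 (by have := x.2; have := y.2; omega), Matrix.scalar_apply, Matrix.diagonal_apply]
      simp only [Subtype.ext_iff]
    rw [this, Matrix.scalar_apply, Matrix.det_diagonal, Finset.prod_const, Finset.card_univ]
  obtain ⟨k, hk⟩ := hdet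
  have hπ0 : π ≠ 0 := mul_ne_zero (by simpa using W.chi0) (X_ne_zero _)
  obtain ⟨N, hN⟩ := extData_of b ζ (Z := Zs w i0) (by rw [← hM, hk]; exact pow_ne_zero _ hπ0)
  rw [← hM, hk] at hN
  exact ⟨N, k, hN⟩

theorem WB.h_Y (W : WB e h f b w i0) {i : ι} (hi : w i ≠ 0) : killingForm K g (b i) h = 0 :=
  killing_weight (W.hw i) (b := 0) (by simp) (by simpa using hi)

theorem WB.ext1 (W : WB e h f b w i0) : ∃ (N : _) (D : _),
    ExtData (fun i => LL b (b i)) (Zs w i0) N D ∧ ¬ (X i0 ∣ D) := by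
  classical
  set M := Matrix.of fun γ γ' : Zs w i0 => pr K (Zs w i0) (jj b ⁅bd b γ', b γ⁆) with hM
  have hev : ∀ p, ev b h (pr K (Zs w i0) p) = ev b h p := by
    intro p
    have h1 := ev_of_mem b (pr_sub_mem (Z := Zs w i0) p) (x := h)
      (fun γ hγ => W.h_Y (by have := (mem_Zs.1 hγ).1; omega))
    rw [map_sub, sub_eq_zero] at h1
    exact h1.symm
  have hdet : ev b h M.det ≠ 0 := by
    have h1 : ev b h M.det = ((ev b h).toRingHom.mapMatrix M).det := RingHom.map_det _ _
    have h2 : (ev b h).toRingHom.mapMatrix M = Matrix.diagonal (fun γ : Zs w i0 => -(w γ : K)) := by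
      ext γ γ'
      have : (ev b h).toRingHom.mapMatrix M γ γ' = ev b h (pr K (Zs w i0) (jj b ⁅bd b γ', b γ⁆)) := rfl
      rw [this, hev, ev_jj, kf_assoc, ← lie_skew, W.hw, map_neg, map_smul, kf_bd, Matrix.diagonal_apply]
      have h5 : ((γ : ι) = (γ' : ι)) ↔ γ = γ' := Subtype.ext_iff.symm
      simp only [h5]
      split_ifs <;> simp
    rw [h1, h2, Matrix.det_diagonal]
    refine Finset.prod_ne_zero_iff.2 fun γ _ => neg_ne_zero.2 ?_
    have := (mem_Zs.1 γ.2).1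
    exact_mod_cast this.ne
  have hne : M.det ≠ 0 := by intro h0; rw [h0, map_zero] at hdet; exact hdet rfl
  obtain ⟨N, hN⟩ := extData_of b (bd b) (Z := Zs w i0) hne
  refine ⟨N, _, hN, ?_⟩
  rintro ⟨q, hq⟩
  apply hdet
  rw [hM, hq, map_mul, ev_X, W.h_Y (by rw [W.hi0]; decide), zero_mul]

theorem relPrime_of {D : MvPolynomial ι K} (c : K) (hc : c ≠ 0) (i : ι) (hD : ¬ (X i ∣ D)) (k : ℕ) :
    IsRelPrime D ((C c * X i) ^ k) := by
  refine IsRelPrime.pow_right ?_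
  intro d hd hd'
  have h1 : d ∣ X i := by
    have := Dvd.dvd.mul_left hd' (C c⁻¹)
    rwa [← mul_assoc, ← C_mul, inv_mul_cancel₀ hc, C_1, one_mul] at this
  rcases ((X_prime (R := K) (i := i)).irreducible.dvd_iff).1 h1 with hu | ha
  · exact hu
  · exact absurd (ha.dvd.trans hd) hD

/-- lower part of the weight filtration -/
noncomputable def Le (b : Basis ι K g) (w : ι → ℤ) (ν : ℤ) : Submodule K g :=
  Submodule.span K (b '' {i | w i ≤ ν})

theorem Le_mono {μ ν : ℤ} (hle : μ ≤ ν) : Le b w μ ≤ Le b w ν :=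
  Submodule.span_mono (Set.image_mono fun _ hi => le_trans hi hle)

theorem Le_eig (hw : ∀ i, ⁅h, b i⁆ = (w i : K) • b i) {x : g} {m ν : ℤ} (hx : ⁅h, x⁆ = (m : K) • x)
    (hm : m ≤ ν) : x ∈ Le b w ν := by
  rw [← b.sum_repr x]
  refine Submodule.sum_mem _ fun i _ => ?_
  by_cases hi : w i = m
  · exact Submodule.smul_mem _ _ (Submodule.subset_span ⟨i, by simp; omega, rfl⟩)
  · rw [repr_zero_of_eig hw hx hi, zero_smul]; exact zero_mem _

theorem Le_lie (hw : ∀ i, ⁅h, b i⁆ = (w i : K) • b i) {x y : g} {μ ν : ℤ} (hx : x ∈ Le b w μ)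
    (hy : y ∈ Le b w ν) : ⁅x, y⁆ ∈ Le b w (μ + ν) := by
  induction hx using Submodule.span_induction with
  | mem x hx =>
    obtain ⟨i, hi, rfl⟩ := hx
    induction hy using Submodule.span_induction with
    | mem y hy =>
      obtain ⟨j, hj, rfl⟩ := hy
      simp only [Set.mem_setOf_eq] at hi hj
      exact Le_eig hw (eig_add (hw i) (hw j)) (by omega)
    | zero => rw [lie_zero]; exact zero_mem _
    | add x y _ _ h1 h2 => rw [lie_add]; exact add_mem h1 h2
    | smul c x _ h1 => rw [lie_smul]; exact Submodule.smul_mem _ _ h1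
  | zero => rw [zero_lie]; exact zero_mem _
  | add x y _ _ h1 h2 => rw [add_lie]; exact add_mem h1 h2
  | smul c x _ h1 => rw [smul_lie]; exact Submodule.smul_mem _ _ h1

theorem Le_kf (hw : ∀ i, ⁅h, b i⁆ = (w i : K) • b i) {x y : g} {μ ν : ℤ} (hx : x ∈ Le b w μ)
    (hy : y ∈ Le b w ν) (hμν : μ + ν < 0) : killingForm K g x y = 0 := by
  induction hx using Submodule.span_induction with
  | mem x hx =>
    obtain ⟨i, hi, rfl⟩ := hx
    induction hy using Submodule.span_induction with
    | mem y hy =>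
      obtain ⟨j, hj, rfl⟩ := hy
      simp only [Set.mem_setOf_eq] at hi hj
      refine killing_weight (hw i) (hw j) ?_
      have : w i + w j ≠ 0 := by omega
      exact_mod_cast this
    | zero => rw [map_zero]
    | add x y _ _ h1 h2 => rw [map_add, h1, h2, add_zero]
    | smul c x _ h1 => rw [map_smul, h1, smul_zero]
  | zero => rw [map_zero, LinearMap.zero_apply]
  | add x y _ _ h1 h2 => rw [map_add, LinearMap.add_apply, h1, h2, add_zero]
  | smul c x _ h1 => rw [map_smul, LinearMap.smul_apply, h1, smul_zero]

theorem Le_top : ∃ ν : ℕ, Le b w ν = ⊤ := by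
  refine ⟨∑ i, (w i).natAbs, ?_⟩
  rw [eq_top_iff, ← b.span_eq]
  refine Submodule.span_mono ?_
  rintro _ ⟨i, rfl⟩
  refine ⟨i, ?_, rfl⟩
  have : (w i).natAbs ≤ ∑ i, (w i).natAbs := Finset.single_le_sum (f := fun i => (w i).natAbs) (fun _ _ => Nat.zero_le _) (Finset.mem_univ i)
  simp only [Set.mem_setOf_eq]; omega

/-- decomposition of points of `Y` -/
theorem WB.Y_dec (W : WB e h f b w i0) {x : g} (hx : ∀ γ ∈ Zs w i0, killingForm K g (b γ) x = 0) :
    ∃ y ∈ Le b w 0, x = (killingForm K g (b i0) x * (killingForm K g e (b i0))⁻¹) • e + y := by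
  refine ⟨x - (killingForm K g (b i0) x * (killingForm K g e (b i0))⁻¹) • e, ?_, by abel⟩
  set y := x - (killingForm K g (b i0) x * (killingForm K g e (b i0))⁻¹) • e with hy
  have hy0 : ∀ i, w i < 0 → killingForm K g (b i) y = 0 := by
    intro i hi
    rw [hy, map_sub, map_smul, kf_comm (b i) e]
    by_cases h0 : i = i0
    · subst h0; rw [smul_eq_mul, mul_assoc, inv_mul_cancel₀ W.chi0]; simp
    · rw [hx i (mem_Zs.2 ⟨hi, h0⟩), W.chi i h0]; simp
  have : y = ∑ i, killingForm K g (b i) y • bd b i := by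
    rw [← sub_eq_zero]
    refine kf_nondeg (b := b) fun j => ?_
    rw [map_sub, LinearMap.sub_apply, map_sum, LinearMap.sum_apply]
    simp [kf_bd, kf_comm y]
  rw [this]
  refine Submodule.sum_mem _ fun i _ => ?_
  by_cases hi : w i < 0
  · rw [hy0 i hi, zero_smul]; exact zero_mem _
  · exact Submodule.smul_mem _ _ (Le_eig W.hw (W.bd_w i) (by omega))

theorem WB.range_add (W : WB e h f b w i0) {a : K} (ha : a ≠ 0) {y : g} (hy : y ∈ Le b w 0) :
    LinearMap.range (LieAlgebra.ad K g (a • e + y)) ⊔ Le b w 0 = ⊤ := by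
  obtain ⟨ν, hν⟩ := Le_top (b := b) (w := w)
  rw [eq_top_iff, ← hν]
  clear hν
  induction ν with
  | zero => exact le_sup_right
  | succ ν ih =>
    refine Submodule.span_le.2 ?_
    rintro _ ⟨i, hi, rfl⟩
    simp only [Set.mem_setOf_eq] at hi
    by_cases hle : w i ≤ ν
    · exact ih (Submodule.subset_span ⟨i, hle, rfl⟩)
    · obtain ⟨u, hu, hu'⟩ := W.surj (by omega) (W.hw i)
      have h1 : b i = a⁻¹ • (LieAlgebra.ad K g (a • e + y) u) - a⁻¹ • ⁅y, u⁆ := by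
        rw [LieAlgebra.ad_apply, add_lie, smul_lie, hu', smul_add, smul_smul, inv_mul_cancel₀ ha]
        simp
      rw [SetLike.mem_coe, h1]
      refine sub_mem (Submodule.mem_sup_left (Submodule.smul_mem _ _ ⟨u, rfl⟩)) (Submodule.smul_mem _ _ ?_)
      refine ih (Le_mono (μ := 0 + (w i - 2)) (by push_cast at hi; omega) (Le_lie W.hw hy (Le_eig W.hw hu le_rfl)))

end E2
end KK

set_option linter.all false
namespace KK
open Module MvPolynomial

section E2
variable {K : Type*} [Field K] [CharZero K] [IsAlgClosed K]
variable {g : Type*} [LieRing g] [LieAlgebra K g] [FiniteDimensional K g] [LieAlgebra.IsKilling K g]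
variable {ι : Type*} [Fintype ι] [DecidableEq ι]
variable {e h f : g} {b : Basis ι K g} {w : ι → ℤ} {i0 : ι}

theorem WB.kf_line (W : WB e h f b w i0) {a : K} {y u : g} (hy : y ∈ Le b w 0) (hu : u ∈ Le b w (-1))
    (t : K) {i : ι} (hi : w i ≤ -2) :
    killingForm K g ⁅a • e + y, u + t • h⁆ (b i) = (-2 * a * t) * killingForm K g e (b i) := by
  have heLe : e ∈ Le b w 2 := Le_eig W.hw (m := 2) (by exact_mod_cast W.hhe) le_rfl
  have hxLe : a • e + y ∈ Le b w 2 := add_mem (Submodule.smul_mem _ _ heLe) (Le_mono (by norm_num) hy)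
  have hhLe : h ∈ Le b w 0 := Le_eig W.hw (m := 0) (by simp) le_rfl
  have hb0 : b i ∈ Le b w (-2) := Le_eig W.hw (W.hw i) hi
  have h1 : killingForm K g ⁅a • e + y, u⁆ (b i) = 0 :=
    Le_kf W.hw (Le_lie (μ := 2) (ν := -1) W.hw hxLe hu) hb0 (by norm_num)
  have h2 : killingForm K g ⁅y, h⁆ (b i) = 0 :=
    Le_kf W.hw (Le_lie (μ := 0) (ν := 0) W.hw hy hhLe) hb0 (by norm_num)
  have h3 : ⁅a • e + y, u + t • h⁆ = ⁅a • e + y, u⁆ + (-2 * a * t) • e + t • ⁅y, h⁆ := by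
    have : ⁅e, h⁆ = (-2 : K) • e := by rw [← lie_skew, W.hhe]; module
    rw [lie_add, lie_smul, add_lie (a • e) y h, smul_lie a e h, this]
    module
  rw [h3, map_add, map_add, LinearMap.add_apply, LinearMap.add_apply, h1, LinearMap.map_smul₂, LinearMap.map_smul₂, h2]
  simp

theorem WB.line_inj (W : WB e h f b w i0) {a : K} (ha : a ≠ 0) {y u : g} (hy : y ∈ Le b w 0)
    (hu : u ∈ Le b w (-1)) (t : K) (h0 : ⁅a • e + y, u + t • h⁆ = 0) : u = 0 ∧ t = 0 := by
  have hRY := W.range_add ha hy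
  have ht : t = 0 := by
    have h1 := W.kf_line (a := a) hy hu t (i := i0) W.hi0.le
    rw [h0, map_zero, LinearMap.zero_apply] at h1
    have h2 := (mul_eq_zero.1 h1.symm).resolve_right W.chi0
    have h3 := (mul_eq_zero.1 h2)
    rcases h3 with h3 | h3
    · exact absurd h3 (mul_ne_zero (by norm_num) ha)
    · exact h3
  refine ⟨?_, ht⟩
  subst ht
  rw [zero_smul, add_zero] at h0
  refine kf_nondeg (b := b) fun i => ?_
  have : b i ∈ LinearMap.range (LieAlgebra.ad K g (a • e + y)) ⊔ Le b w 0 := by rw [hRY]; trivial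
  obtain ⟨r, ⟨s, rfl⟩, y', hy', h3⟩ := Submodule.mem_sup.1 this
  rw [← h3, map_add, Le_kf W.hw hu hy' (by norm_num), LieAlgebra.ad_apply, ← kf_assoc, ← lie_skew, h0]
  simp

theorem WB.Y_mem (W : WB e h f b w i0) {z : g} (hz : ∀ γ ∈ Zs w i0, killingForm K g (b γ) z = 0) :
    z ∈ Submodule.span K {e} ⊔ Le b w 0 := by
  obtain ⟨y', hy', h1⟩ := W.Y_dec hz
  rw [h1]
  exact add_mem (Submodule.mem_sup_left (Submodule.smul_mem _ _ (Submodule.mem_span_singleton_self e)))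
      (Submodule.mem_sup_right hy')

theorem WB.Y_fin (W : WB e h f b w i0) : finrank K (Submodule.span K {e} ⊔ Le b w 0 : Submodule K g) ≤
    1 + (Fintype.card {i // w i = 0} + Fintype.card {i // w i < 0}) := by
  have he0 : e ≠ 0 := by rintro rfl; exact W.chi0 (by simp)
  have hc1 : Fintype.card {i // w i ≤ 0} = Fintype.card {i // w i = 0} + Fintype.card {i // w i < 0} := by
    simp only [Fintype.card_subtype]
    rw [← Finset.card_union_of_disjoint]
    · congr 1; ext i; simp; omega
    · rw [Finset.disjoint_left]; intro i; simp; omega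
  rw [← hc1]
  refine (Submodule.finrank_add_le_finrank_add_finrank _ _).trans ?_
  refine Nat.add_le_add (finrank_span_singleton he0).le ?_
  exact (span_card b {i | w i ≤ 0}).le

theorem fin_Le : finrank K (Le b w (-1)) = Fintype.card {i // w i < 0} := by
  have : {i | w i ≤ -1} = {i | w i < 0} := by ext i; simp; omega
  rw [Le, this]
  exact span_card b {i | w i < 0}

theorem lin_count {V : Type*} [AddCommGroup V] [Module K V] [FiniteDimensional K V]
    (T : V →ₗ[K] V) (W0 Y : Submodule K V) (r : ℕ)
    (hinj : ∀ x ∈ W0, T x = 0 → x = 0) (hmap : ∀ x ∈ W0, T x ∈ Y)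
    (hsup : LinearMap.range T ⊔ Y = ⊤) (hker : r ≤ finrank K (LinearMap.ker T))
    (hdim : finrank K Y ≤ finrank K W0 + r) (v : V) (hv : T v ∈ Y) : ∃ u ∈ W0, T v = T u := by
  have h1 := Submodule.finrank_sup_add_finrank_inf_eq (LinearMap.range T) Y
  rw [hsup, finrank_top] at h1
  have h2 := LinearMap.finrank_range_add_finrank_ker T
  have hinj' : Function.Injective (T ∘ₗ W0.subtype) := by
    rw [← LinearMap.ker_eq_bot, LinearMap.ker_eq_bot']
    intro x hx
    exact Subtype.ext (hinj x x.2 hx)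
  have h3 := LinearMap.finrank_range_of_inj hinj'
  have hle : LinearMap.range (T ∘ₗ W0.subtype) ≤ LinearMap.range T ⊓ Y := by
    rintro _ ⟨x, rfl⟩
    exact ⟨⟨x, rfl⟩, hmap x x.2⟩
  have heq := Submodule.eq_of_le_of_finrank_le hle (by omega)
  have hmem : T v ∈ LinearMap.range (T ∘ₗ W0.subtype) := by rw [heq]; exact ⟨⟨v, rfl⟩, hv⟩
  obtain ⟨u, hu⟩ := hmem
  exact ⟨u, u.2, hu.symm⟩

theorem WB.slice (W : WB e h f b w i0) {a : K} (ha : a ≠ 0) {y v : g} (hy : y ∈ Le b w 0)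
    (hv : ∀ γ ∈ Zs w i0, killingForm K g (b γ) ⁅a • e + y, v⁆ = 0) :
    ∃ u ∈ Le b w (-1), ∃ t : K, ⁅a • e + y, v⁆ = ⁅a • e + y, u + t • h⁆ := by
  have he0 : e ≠ 0 := by rintro rfl; exact W.chi0 (by simp)
  have hh : h ∉ Le b w (-1) := by
    intro hh
    have h1 := W.line_inj ha hy (Submodule.neg_mem _ hh) 1 (by simp)
    exact one_ne_zero h1.2
  have hd : Disjoint (Le b w (-1)) (Submodule.span K {h}) := by
    rw [Submodule.disjoint_span_singleton]
    · intro h1; exact absurd h1 hh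
  have hfin : finrank K (Le b w (-1) ⊔ Submodule.span K {h} : Submodule K g) =
      Fintype.card {i // w i < 0} + 1 := by
    have h1 := Submodule.finrank_sup_add_finrank_inf_eq (Le b w (-1)) (Submodule.span K {h})
    rw [hd.eq_bot, finrank_bot, fin_Le, finrank_span_singleton (by rintro rfl; exact hh (zero_mem _))] at h1
    omega
  have hmem : ∀ x ∈ Le b w (-1) ⊔ Submodule.span K {h}, ∃ u ∈ Le b w (-1), ∃ t : K, x = u + t • h := by
    intro x hx
    obtain ⟨u, hu, r, hr, rfl⟩ := Submodule.mem_sup.1 hx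
    obtain ⟨t, rfl⟩ := Submodule.mem_span_singleton.1 hr
    exact ⟨u, hu, t, rfl⟩
  have h3 := W.ker (a • e + y)
  rw [Nat.card_eq_fintype_card] at h3
  obtain ⟨x, hx, hxv⟩ := lin_count (LieAlgebra.ad K g (a • e + y)) (Le b w (-1) ⊔ Submodule.span K {h})
    (Submodule.span K {e} ⊔ Le b w 0) (Fintype.card {i // w i = 0}) (by
      intro x hx h0
      obtain ⟨u, hu, t, rfl⟩ := hmem x hx
      obtain ⟨rfl, rfl⟩ := W.line_inj ha hy hu t h0
      simp) (by
      intro x hx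
      obtain ⟨u, hu, t, rfl⟩ := hmem x hx
      refine W.Y_mem fun γ hγ => ?_
      obtain ⟨hγ1, hγ2⟩ := mem_Zs.1 hγ
      rw [kf_comm, LieAlgebra.ad_apply, W.kf_line hy hu t (by obtain ⟨k, hk⟩ := W.even γ; omega), W.chi γ hγ2, mul_zero])
    (by
      rw [eq_top_iff, ← W.range_add ha hy]
      exact sup_le_sup_left le_sup_right _) h3 (by rw [hfin]; have := W.Y_fin; omega) v (W.Y_mem hv)
  obtain ⟨u, hu, t, rfl⟩ := hmem x hx
  exact ⟨u, hu, t, hxv⟩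

end E2
end KK

set_option linter.all false
namespace KK
open Module MvPolynomial

section Hom
variable {K : Type*} [Field K] {ι : Type*} [Fintype ι] [DecidableEq ι]

theorem whom_aeval {M : Type*} [AddCommMonoid M] {σ : Type*} {u : ι → M} {u' : σ → M} {f : ι → MvPolynomial σ K}
    (hf : ∀ i, IsWeightedHomogeneous u' (f i) (u i)) {p : MvPolynomial ι K} {n : M}
    (hp : IsWeightedHomogeneous u p n) : IsWeightedHomogeneous u' (aeval f p) n := by
  rw [aeval_def, eval₂_eq']
  refine (weightedHomogeneousSubmodule K u' n).sum_mem fun d hd => ?_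
  have h1 : IsWeightedHomogeneous u' (∏ i, f i ^ d i) (∑ i, d i • u i) :=
    IsWeightedHomogeneous.prod _ _ _ fun i _ => (hf i).pow (d i)
  have h2 := (isWeightedHomogeneous_C u' (coeff d p)).mul h1
  have h3 : (0 : M) + ∑ i, d i • u i = n := by
    rw [zero_add, ← hp (mem_support_iff.1 hd), Finsupp.weight_apply, Finsupp.sum_fintype _ _ (by simp)]
  rw [h3] at h2
  exact h2

theorem whom_der {u : ι → ℤ} {δ : ℤ} {D : Derivation K (MvPolynomial ι K) (MvPolynomial ι K)}
    (hD : ∀ i, IsWeightedHomogeneous u (D (X i)) (u i + δ)) {p : MvPolynomial ι K} {n : ℤ}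
    (hp : IsWeightedHomogeneous u p n) : IsWeightedHomogeneous u (D p) (n + δ) := by
  rw [deriv_eq_sum]
  refine (weightedHomogeneousSubmodule K u (n + δ)).sum_mem fun i _ => ?_
  have h1 : IsWeightedHomogeneous u (pderiv i p) (n - u i) := hp.pderiv (by ring)
  have h2 := h1.mul (hD i)
  have h3 : n - u i + (u i + δ) = n + δ := by ring
  rw [h3] at h2
  exact h2

theorem whom_scale {u : ι → ℤ} {p : MvPolynomial ι K} {n : ℤ}
    (hp : IsWeightedHomogeneous u p n) {τ : K} (hτ : τ ≠ 0) (c : ι → K) :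
    eval (fun i => τ ^ (u i) * c i) p = τ ^ n * eval c p := by
  rw [eval_eq', eval_eq', Finset.mul_sum]
  refine Finset.sum_congr rfl fun d hd => ?_
  have h3 : n = ∑ i, u i * d i := by
    rw [← hp (mem_support_iff.1 hd), Finsupp.weight_apply, Finsupp.sum_fintype _ _ (by simp)]
    refine Finset.sum_congr rfl fun i _ => ?_
    rw [nsmul_eq_mul, mul_comm]
  have h4 : ∀ s : Finset ι, ∏ i ∈ s, (τ ^ (u i) * c i) ^ d i = τ ^ (∑ i ∈ s, u i * d i) * ∏ i ∈ s, c i ^ d i := by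
    intro s
    induction s using Finset.induction_on with
    | empty => simp
    | insert a s ha ih =>
      rw [Finset.prod_insert ha, Finset.prod_insert ha, Finset.sum_insert ha, ih, zpow_add₀ hτ, mul_pow,
        zpow_mul, zpow_natCast]
      ring
  rw [h4, h3]; ring

end Hom

section E4
variable {K : Type*} [Field K] [CharZero K] [IsAlgClosed K]
variable {g : Type*} [LieRing g] [LieAlgebra K g] [FiniteDimensional K g] [LieAlgebra.IsKilling K g]
variable {ι : Type*} [Fintype ι] [DecidableEq ι]
variable {e h f : g} {b : Basis ι K g} {w : ι → ℤ} {i0 : ι}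

/-- restriction to `e + b^-`. -/
noncomputable def sg (e : g) (b : Basis ι K g) (w : ι → ℤ) : MvPolynomial ι K →ₐ[K] MvPolynomial ι K :=
  aeval (fun i => if w i < 0 then C (killingForm K g e (b i)) else X i)

theorem sg_neg {i : ι} (hi : w i < 0) : sg e b w (X i) = C (killingForm K g e (b i)) := by simp [sg, hi]
theorem sg_pos {i : ι} (hi : ¬ w i < 0) : sg e b w (X i) = X i := by simp [sg, hi]
theorem sg_C (c : K) : sg e b w (C c) = C c := by simp [sg]

theorem sg_sg (p : MvPolynomial ι K) : sg e b w (sg e b w p) = sg e b w p := by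
  have : (sg e b w).comp (sg e b w) = sg e b w := by
    refine algHom_ext fun i => ?_
    by_cases hi : w i < 0
    · rw [AlgHom.comp_apply, sg_neg hi, sg_C]
    · rw [AlgHom.comp_apply, sg_pos hi, sg_pos hi]
  exact DFunLike.congr_fun this p

noncomputable def ph (e : g) (b : Basis ι K g) (w : ι → ℤ) (i0 : ι) :
    MvPolynomial ι K →ₐ[K] MvPolynomial ι K :=
  aeval (fun i => if w i < 0 then C (killingForm K g e (b i)) else
    X i * (C (killingForm K g e (b i0))⁻¹ * X i0) ^ (w i / 2).toNat)

theorem WB.sg_ph (W : WB e h f b w i0) (p : MvPolynomial ι K) :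
    sg e b w (ph e b w i0 p) = sg e b w p := by
  have : (sg e b w).comp (ph e b w i0) = sg e b w := by
    refine algHom_ext fun i => ?_
    by_cases hi : w i < 0
    · rw [AlgHom.comp_apply, sg_neg hi]
      simp [ph, hi, sg_C]
    · have h0 : w i0 < 0 := by rw [W.hi0]; norm_num
      have h1 : ph e b w i0 (X i) = X i * (C (killingForm K g e (b i0))⁻¹ * X i0) ^ (w i / 2).toNat := by
        simp [ph, hi]
      rw [AlgHom.comp_apply, h1, map_mul, map_pow, map_mul, sg_C, sg_neg h0, ← C_mul, inv_mul_cancel₀ W.chi0,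
        C_1, one_pow, mul_one]
  exact DFunLike.congr_fun this p

theorem WB.ph_w (W : WB e h f b w i0) (p : MvPolynomial ι K) :
    IsWeightedHomogeneous w (ph e b w i0 p) 0 := by
  refine whom_aeval (u := fun _ => (0 : ℤ)) ?_ (p := p) (n := 0) ?_
  · intro i
    by_cases hi : w i < 0
    · rw [if_pos hi]; exact isWeightedHomogeneous_C _ _
    · rw [if_neg hi]
      have h1 : IsWeightedHomogeneous w (X i * (C (killingForm K g e (b i0))⁻¹ * X i0) ^ (w i / 2).toNat)
        (w i + (w i / 2).toNat • (0 + w i0)) :=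
        (isWeightedHomogeneous_X K w i).mul (((isWeightedHomogeneous_C w _).mul (isWeightedHomogeneous_X K w i0)).pow _)
      convert h1 using 1
      rw [W.hi0, nsmul_eq_mul]
      obtain ⟨k, hk⟩ := W.even i
      omega
  · intro d _
    simp [Finsupp.weight_apply]

theorem WB.ph_2 (W : WB e h f b w i0) {p : MvPolynomial ι K} {n : ℤ}
    (hp : IsWeightedHomogeneous (fun i => w i + 2) p n) :
    IsWeightedHomogeneous (fun _ => (2 : ℤ)) (ph e b w i0 p) n := by
  refine whom_aeval (u := fun i => w i + 2) ?_ hp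
  intro i
  by_cases hi : w i < 0
  · rw [if_pos hi]
    by_cases h0 : i = i0
    · rw [h0, W.hi0]; exact isWeightedHomogeneous_C _ _
    · rw [W.chi i h0, C_0]; exact isWeightedHomogeneous_zero _ _ _
  · rw [if_neg hi]
    have h1 : IsWeightedHomogeneous (fun _ => (2 : ℤ)) (X i * (C (killingForm K g e (b i0))⁻¹ * X i0) ^ (w i / 2).toNat)
        (2 + (w i / 2).toNat • (0 + 2)) :=
        (isWeightedHomogeneous_X K _ i).mul (((isWeightedHomogeneous_C _ _).mul (isWeightedHomogeneous_X K _ i0)).pow _)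
    convert h1 using 1
    rw [nsmul_eq_mul]
    obtain ⟨k, hk⟩ := W.even i
    omega

theorem jj_w (hw : ∀ i, ⁅h, b i⁆ = (w i : K) • b i) {x : g} {m : ℤ} (hx : ⁅h, x⁆ = (m : K) • x) :
    IsWeightedHomogeneous w (jj b x) m := by
  rw [jj_eq]
  refine (weightedHomogeneousSubmodule K w m).sum_mem fun i _ => ?_
  by_cases hi : w i = m
  · have := (isWeightedHomogeneous_C w (b.repr x i)).mul (isWeightedHomogeneous_X K w i)
    rw [zero_add, hi] at this
    exact this
  · rw [repr_zero_of_eig hw hx hi, C_0, zero_mul]; exact zero_mem _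

theorem jj_2 (b : Basis ι K g) (x : g) : IsWeightedHomogeneous (fun _ => (2 : ℤ)) (jj b x) 2 := by
  rw [jj_eq]
  refine (weightedHomogeneousSubmodule K _ _).sum_mem fun i _ => ?_
  have := (isWeightedHomogeneous_C (fun _ => (2 : ℤ)) (b.repr x i)).mul (isWeightedHomogeneous_X K (fun _ => (2 : ℤ)) i)
  rw [zero_add] at this
  exact this

theorem LL_w (hw : ∀ i, ⁅h, b i⁆ = (w i : K) • b i) (i : ι) {p : MvPolynomial ι K} {n : ℤ}
    (hp : IsWeightedHomogeneous w p n) : IsWeightedHomogeneous w (LL b (b i) p) (n + w i) := by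
  refine whom_der (fun j => ?_) hp
  rw [LL_X]
  refine jj_w hw ?_
  rw [add_comm]
  exact eig_add (hw i) (hw j)

theorem LL_2 (x : g) {p : MvPolynomial ι K} {n : ℤ}
    (hp : IsWeightedHomogeneous (fun _ => (2 : ℤ)) p n) :
    IsWeightedHomogeneous (fun _ => (2 : ℤ)) (LL b x p) n := by
  have := whom_der (δ := 0) (D := LL b x) (u := fun _ => (2 : ℤ)) (fun j => ?_) hp
  · simpa using this
  · rw [LL_X]; simpa using jj_2 b _

theorem LL_h_monomial (hw : ∀ i, ⁅h, b i⁆ = (w i : K) • b i) (d : ι →₀ ℕ) :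
    LL b h (monomial d 1) = ((Finsupp.weight w d : ℤ) : K) • monomial d (1 : K) := by
  induction d using Finsupp.induction_linear with
  | zero =>
    have : (monomial (0 : ι →₀ ℕ) (1 : K)) = 1 := rfl
    simp [this]
  | add d1 d2 h1 h2 =>
    have : (monomial (d1 + d2) (1 : K)) = monomial d1 1 * monomial d2 1 := by simp [monomial_mul]
    rw [this, Derivation.leibniz, h1, h2, map_add]
    push_cast
    simp only [smul_eq_mul, smul_eq_C_mul, C_add]
    ring
  | single i n =>
    have : (monomial (Finsupp.single i n) (1 : K)) = X i ^ n := by rw [X_pow_eq_monomial]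
    rw [this, Derivation.leibniz_pow, LL_X, hw, map_smul, jj_basis, Finsupp.weight_single]
    cases n with
    | zero => simp
    | succ n =>
      simp only [smul_eq_mul, smul_eq_C_mul, Nat.add_sub_cancel, nsmul_eq_mul]
      push_cast
      simp only [map_mul, map_add, map_natCast, map_one]
      ring

theorem LL_h_coeff (hw : ∀ i, ⁅h, b i⁆ = (w i : K) • b i) (p : MvPolynomial ι K) (d : ι →₀ ℕ) :
    coeff d (LL b h p) = ((Finsupp.weight w d : ℤ) : K) * coeff d p := by
  induction p using MvPolynomial.induction_on' with
  | monomial s a =>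
    have : monomial s a = a • monomial s (1 : K) := by simp [smul_monomial]
    rw [this, Derivation.map_smul, LL_h_monomial hw, coeff_smul, coeff_smul, coeff_smul, coeff_monomial]
    by_cases hs : s = d
    · subst hs; simp; ring
    · simp [hs]
  | add p q hp hq => rw [map_add, coeff_add, coeff_add, hp, hq]; ring

theorem LL_h_zero (hw : ∀ i, ⁅h, b i⁆ = (w i : K) • b i) {p : MvPolynomial ι K} :
    LL b h p = 0 ↔ IsWeightedHomogeneous w p 0 := by
  constructor
  · intro h0 d hd
    have := LL_h_coeff hw p d
    rw [h0, coeff_zero] at this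
    exact_mod_cast (mul_eq_zero.1 this.symm).resolve_right hd
  · intro hp
    ext d
    rw [LL_h_coeff hw, coeff_zero]
    by_cases hd : coeff d p = 0
    · rw [hd, mul_zero]
    · rw [hp hd]; simp

theorem WB.i0_not (W : WB e h f b w i0) : i0 ∉ Zs w i0 := by simp [mem_Zs]

theorem WB.mem_of_sg (W : WB e h f b w i0) {p : MvPolynomial ι K} {m : ℤ}
    (hp : IsWeightedHomogeneous w p m) (hs : sg e b w p = 0) : p ∈ Fil (zw (Zs w i0)) 1 := by
  have hX : IsWeightedHomogeneous (zw (Zs w i0)) (X i0 : MvPolynomial ι K) 0 := by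
    have := isWeightedHomogeneous_X K (zw (Zs w i0)) i0
    rwa [zw_not W.i0_not] at this
  refine Fil_cancel hX (X_ne_zero i0) (mem_of_ev b fun x hx => ?_)
  rw [map_mul, ev_X]
  by_cases ha : killingForm K g (b i0) x = 0
  · rw [ha, zero_mul]
  obtain ⟨τ, hτ⟩ := IsAlgClosed.exists_pow_nat_eq (killingForm K g (b i0) x / killingForm K g e (b i0)) (n := 2) (by norm_num)
  have hτ0 : τ ≠ 0 := by
    rintro rfl
    have := div_ne_zero ha W.chi0
    rw [← hτ] at this; simp at this
  set c : ι → K := fun i => killingForm K g (b i) x with hc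
  have h1 := whom_scale hp hτ0 c
  have h2 : eval (fun i => τ ^ (w i) * c i) p = eval (fun i => τ ^ (w i) * c i) (sg e b w p) := by
    have : (aeval (fun i => τ ^ (w i) * c i) : MvPolynomial ι K →ₐ[K] K).comp (sg e b w) = aeval (fun i => τ ^ (w i) * c i) := by
      refine algHom_ext fun i => ?_
      by_cases hi : w i < 0
      · rw [AlgHom.comp_apply, sg_neg hi, aeval_X, aeval_C]
        by_cases h0 : i = i0
        · subst h0
          rw [W.hi0, hc]
          simp only [Algebra.algebraMap_self, RingHom.id_apply]
          have h3 : killingForm K g (b i) x = τ ^ 2 * killingForm K g e (b i) := by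
            rw [hτ, div_mul_cancel₀ _ W.chi0]
          rw [h3, zpow_neg, ← mul_assoc]
          have : (τ ^ (2 : ℤ)) = τ ^ 2 := by norm_cast
          rw [this, inv_mul_cancel₀ (pow_ne_zero 2 hτ0), one_mul]
        · rw [W.chi i h0]
          simp only [hc, hx i (mem_Zs.2 ⟨hi, h0⟩), mul_zero, map_zero]
      · rw [AlgHom.comp_apply, sg_pos hi]
    have h4 := DFunLike.congr_fun this p
    rw [AlgHom.comp_apply] at h4
    simpa [aeval_eq_eval] using h4.symm
  rw [hs, map_zero, h1] at h2
  have h5 : ev b x p = eval c p := by simp [ev, hc, aeval_eq_eval]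
  rw [h5, (mul_eq_zero.1 h2).resolve_left (zpow_ne_zero _ hτ0), mul_zero]

theorem WB.sg_of_mem (W : WB e h f b w i0) {p : MvPolynomial ι K} (hp : p ∈ Fil (zw (Zs w i0)) 1) :
    sg e b w p = 0 := by
  have : (sg e b w).comp (pr K (Zs w i0)) = sg e b w := by
    refine algHom_ext fun i => ?_
    by_cases hi : i ∈ Zs w i0
    · rw [AlgHom.comp_apply, sg_neg (mem_Zs.1 hi).1, W.chi i (mem_Zs.1 hi).2]
      simp [pr, hi]
    · simp [pr, hi]
  rw [← this, AlgHom.comp_apply, pr_of_mem hp, map_zero]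

theorem WB.chi_lie (W : WB e h f b w i0) {i j : ι} (hi : w i < 0) (hj : w j < 0) :
    killingForm K g e ⁅b i, b j⁆ = 0 := by
  refine killing_weight W.hhe (eig_add (W.hw i) (W.hw j)) ?_
  obtain ⟨k, hk⟩ := W.even i
  obtain ⟨l, hl⟩ := W.even j
  have : (2 + (w i + w j) : ℤ) ≠ 0 := by omega
  exact_mod_cast this

theorem WB.sg_jj (W : WB e h f b w i0) {i j : ι} (hi : w i < 0) (hj : w j < 0) :
    sg e b w (jj b ⁅b i, b j⁆) = 0 := by
  have hx := eig_add (W.hw i) (W.hw j)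
  rw [jj_eq, map_sum]
  have h1 : ∀ k, sg e b w (C (b.repr ⁅b i, b j⁆ k) * X k) = C (killingForm K g e (b.repr ⁅b i, b j⁆ k • b k)) := by
    intro k
    rw [map_mul, sg_C]
    by_cases hk : w k = w i + w j
    · rw [sg_neg (by omega), map_smul, smul_eq_mul, C_mul]
    · rw [repr_zero_of_eig W.hw hx hk]; simp
  rw [Finset.sum_congr rfl fun k _ => h1 k, ← map_sum, ← map_sum, b.sum_repr, W.chi_lie hi hj, C_0]

theorem WB.sg_LL (W : WB e h f b w i0) {i : ι} (hi : w i < 0) (p : MvPolynomial ι K) :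
    sg e b w (LL b (b i) p) = sg e b w (LL b (b i) (sg e b w p)) := by
  rw [← sub_eq_zero, ← map_sub, ← map_sub]
  induction p using MvPolynomial.induction_on with
  | C a => simp [sg_C]
  | add p q hp hq => rw [map_add, add_sub_add_comm, map_add, map_add, hp, hq, add_zero]
  | mul_X p j hp =>
    have h1 : p * X j - sg e b w (p * X j) = (p - sg e b w p) * X j + sg e b w p * (X j - sg e b w (X j)) := by
      rw [map_mul]; ring
    have h2 : ∀ q, sg e b w (q - sg e b w q) = 0 := fun q => by rw [map_sub, sg_sg, sub_self]
    have h3 : sg e b w (LL b (b i) (X j - sg e b w (X j))) = 0 := by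
      by_cases hj : w j < 0
      · rw [sg_neg hj, map_sub, LL_X, derivation_C, sub_zero, W.sg_jj hi hj]
      · rw [sg_pos hj, sub_self, map_zero, map_zero]
    rw [h1, map_add, Derivation.leibniz, Derivation.leibniz, map_add, map_add, map_add]
    simp only [smul_eq_mul, map_mul, h2, h3, hp, mul_zero, zero_mul, add_zero]

theorem WB.E_inj (W : WB e h f b w i0) {P : MvPolynomial ι K} (hP : ∀ ξ, LL b ξ P = 0)
    (hs : sg e b w P = 0) : P = 0 := by
  obtain ⟨N, k, hN⟩ := W.ext2
  exact ext_unique hN (fun i => hP (b i)) (W.mem_of_sg ((LL_h_zero W.hw).1 (hP h)) hs)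

theorem WB.alpha (W : WB e h f b w i0) {F : MvPolynomial ι K} (hF : IsWeightedHomogeneous w F 0)
    (hs : ∀ i, w i < 0 → sg e b w (LL b (b i) F) = 0) (v : ι → MvPolynomial ι K)
    (hv : ∀ γ ∈ Zs w i0, Vd (fun i => LL b (b i)) v (X γ) ∈ Fil (zw (Zs w i0)) 1) :
    Vd (fun i => LL b (b i)) v F ∈ Fil (zw (Zs w i0)) 1 := by
  have hX : IsWeightedHomogeneous (zw (Zs w i0)) (X i0 : MvPolynomial ι K) 0 := by
    have := isWeightedHomogeneous_X K (zw (Zs w i0)) i0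
    rwa [zw_not W.i0_not] at this
  refine Fil_cancel hX (X_ne_zero i0) (mem_of_ev b fun x hx => ?_)
  rw [map_mul, ev_X]
  by_cases ha : killingForm K g (b i0) x = 0
  · rw [ha, zero_mul]
  set vx : g := ∑ i, ev b x (v i) • b i with hvx
  have hev : ∀ p, ev b x (Vd (fun i => LL b (b i)) v p) = ev b x (LL b vx p) := by
    intro p
    rw [Vd_apply, map_sum, LL_sum, map_sum]
    refine Finset.sum_congr rfl fun i _ => ?_
    rw [map_mul, map_smul, hvx, Basis.repr_sum_self, smul_eq_mul]
  have hc := fun γ hγ => ev_of_mem b (hv γ hγ) hx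
  obtain ⟨y, hy, hxy⟩ := W.Y_dec hx
  have hv' : ∀ γ ∈ Zs w i0, killingForm K g (b γ) ⁅x, vx⁆ = 0 := by
    intro γ hγ
    rw [← kf_rot, ← ev_jj b, ← LL_X, ← hev]
    exact hc γ hγ
  set a' := killingForm K g (b i0) x * (killingForm K g e (b i0))⁻¹ with ha'
  have ha0 : a' ≠ 0 := mul_ne_zero ha (inv_ne_zero W.chi0)
  rw [hxy] at hv'
  obtain ⟨u, hu, t, hut⟩ := W.slice ha0 hy hv'
  rw [← hxy] at hut
  have hLu : ev b x (LL b u F) = 0 := by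
    have : ∀ z ∈ Le b w (-1), ev b x (LL b z F) = 0 := by
      intro z hz
      induction hz using Submodule.span_induction with
      | mem z hz =>
        obtain ⟨i, hi, rfl⟩ := hz
        simp only [Set.mem_setOf_eq] at hi
        exact ev_of_mem b (W.mem_of_sg (LL_w W.hw i hF) (hs i (by omega))) hx
      | zero => simp
      | add y z _ _ h1 h2 => simp [h1, h2]
      | smul c z _ h1 => simp [h1]
    exact this u hu
  have h1 : ev b x (LL b vx F) = ev b x (LL b (u + t • h) F) := by
    rw [ev_LL, ev_LL, hut]
  rw [hev, h1, map_add, map_smul, Derivation.add_apply, Derivation.smul_apply, (LL_h_zero W.hw).2 hF,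
    smul_zero, add_zero, hLu, mul_zero]

theorem WB.E_main (W : WB e h f b w i0) {p : MvPolynomial ι K} {n : ℤ}
    (hp : IsWeightedHomogeneous (fun i => w i + 2) p n)
    (hs : ∀ i, w i < 0 → sg e b w (LL b (b i) p) = 0) :
    ∃ P : MvPolynomial ι K, (∀ ξ, LL b ξ P = 0) ∧ sg e b w P = sg e b w p ∧
      IsWeightedHomogeneous (fun i => w i + 2) P n ∧ ∃ d : ℕ, P.IsHomogeneous d := by
  by_cases hφ : ph e b w i0 p = 0
  · refine ⟨0, by simp, ?_, isWeightedHomogeneous_zero _ _ _, 0, isHomogeneous_zero _ _ _⟩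
    rw [← W.sg_ph p, hφ]
  have hF2 := W.ph_2 hp
  have hFw := W.ph_w p
  set F₀ := ph e b w i0 p with hF0
  obtain ⟨d0, hd0⟩ := exists_coeff_ne_zero hφ
  obtain ⟨d, hd⟩ : ∃ d : ℕ, n = 2 * d := by
    refine ⟨d0.degree, ?_⟩
    rw [← hF2 hd0, Finsupp.weight_apply, Finsupp.degree_apply, Finsupp.sum, Nat.cast_sum, Finset.mul_sum]
    refine Finset.sum_congr rfl fun i _ => ?_
    rw [nsmul_eq_mul, mul_comm]
  have h2d : ∀ s : ι →₀ ℕ, Finsupp.weight (fun _ => (2 : ℤ)) s = 2 * (s.degree : ℤ) := by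
    intro s
    rw [Finsupp.weight_apply, Finsupp.degree_apply, Finsupp.sum, Nat.cast_sum, Finset.mul_sum]
    refine Finset.sum_congr rfl fun i _ => ?_
    rw [nsmul_eq_mul, mul_comm]
  have hs' : ∀ i, w i < 0 → sg e b w (LL b (b i) F₀) = 0 := by
    intro i hi
    rw [W.sg_LL hi, hF0, W.sg_ph, ← W.sg_LL hi, hs i hi]
  obtain ⟨N, k, hN⟩ := W.ext2
  obtain ⟨N', D', hN', hD'⟩ := W.ext1
  obtain ⟨F, hF, hFL⟩ := ext_main (L := fun i => LL b (b i)) (Z := Zs w i0) (LL_struct b) hN' hN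
    (relPrime_of _ (inv_ne_zero W.chi0) i0 hD' k) F₀ (W.alpha hFw hs') (d + 1)
  set P := weightedHomogeneousComponent (fun _ => (2 : ℤ)) n F with hPdef
  have hP2 : IsWeightedHomogeneous (fun _ => (2 : ℤ)) P n :=
    weightedHomogeneousComponent_isWeightedHomogeneous _ _
  have hFil : ∀ (k : ℕ) (q : MvPolynomial ι K), q ∈ Fil (zw (Zs w i0)) k →
      weightedHomogeneousComponent (fun _ => (2 : ℤ)) n q ∈ Fil (zw (Zs w i0)) k := by
    intro k q hq s hs
    rw [coeff_weightedHomogeneousComponent] at hs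
    split_ifs at hs with h1
    · exact hq s hs
    · exact absurd rfl hs
  have hdecomp : ∀ q : MvPolynomial ι K, ∃ r : MvPolynomial ι K, q = weightedHomogeneousComponent (fun _ => (2 : ℤ)) n q + r ∧
      (∀ x : g, weightedHomogeneousComponent (fun _ => (2 : ℤ)) n (LL b x r) = 0) := by
    intro q
    refine ⟨q - weightedHomogeneousComponent (fun _ => (2 : ℤ)) n q, by ring, fun x => ?_⟩
    have h1 : ∀ s : ι →₀ ℕ, coeff s (q - weightedHomogeneousComponent (fun _ => (2 : ℤ)) n q) ≠ 0 →
        Finsupp.weight (fun _ => (2 : ℤ)) s ≠ n := by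
      intro s hs hsn
      rw [coeff_sub, coeff_weightedHomogeneousComponent, if_pos hsn, sub_self] at hs
      exact hs rfl
    generalize q - weightedHomogeneousComponent (fun _ => (2 : ℤ)) n q = r at h1
    rw [r.as_sum, map_sum, map_sum]
    refine Finset.sum_eq_zero fun s hs => ?_
    have h3 : IsWeightedHomogeneous (fun _ => (2 : ℤ)) (monomial s (coeff s r)) (Finsupp.weight (fun _ => (2 : ℤ)) s) :=
      isWeightedHomogeneous_monomial _ _ _ rfl
    exact (LL_2 x h3).weightedHomogeneousComponent_ne _ (h1 s (mem_support_iff.1 hs)).symm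
  have hLP : ∀ i, LL b (b i) P = 0 := by
    intro i
    obtain ⟨r, hr, hr0⟩ := hdecomp F
    have h1 : LL b (b i) P = weightedHomogeneousComponent (fun _ => (2 : ℤ)) n (LL b (b i) F) := by
      conv_rhs => rw [hr, map_add, map_add, hr0, add_zero]
      rw [(LL_2 (b i) hP2).weightedHomogeneousComponent_same]
    have h2 := hFil (d + 1) _ (hFL i)
    rw [← h1] at h2
    ext s
    by_contra hs
    rw [coeff_zero] at hs
    have h3 := h2 s hs
    have h4 := LL_2 (b i) hP2 hs
    rw [h2d, hd] at h4
    have h5 : Finsupp.weight (zw (Zs w i0)) s ≤ s.degree := by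
      rw [Finsupp.weight_apply, Finsupp.degree_apply, Finsupp.sum]
      refine Finset.sum_le_sum fun j _ => ?_
      have := zw_le (Zs w i0) j
      rw [smul_eq_mul]; nlinarith
    omega
  have hLP' : ∀ ξ, LL b ξ P = 0 := by
    intro ξ; rw [LL_sum]; simp [hLP]
  have hPw := (LL_h_zero W.hw).1 (hLP' h)
  refine ⟨P, hLP', ?_, ?_, d, ?_⟩
  · have h1 := hFil 1 _ hF
    rw [map_sub, hF2.weightedHomogeneousComponent_same] at h1
    have h2 := W.sg_of_mem h1
    rw [map_sub, sub_eq_zero, hF0, W.sg_ph] at h2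
    exact h2
  · intro s hs
    have h1 := hPw hs
    have h2 := hP2 hs
    rw [← h2, ← zero_add (Finsupp.weight (fun _ => (2 : ℤ)) s), ← h1]
    simp only [Finsupp.weight_apply, Finsupp.sum, ← Finset.sum_add_distrib, smul_add]
  · intro s hs
    have h2 := hP2 hs
    rw [h2d, hd] at h2
    have : s.degree = d := by omega
    rw [Finsupp.weight_apply]
    rw [← this, Finsupp.degree_apply, Finsupp.sum]
    simp

end E4
end KK

set_option linter.all false
namespace KK
open Module MvPolynomial

section B
variable {K : Type*} [Field K] {g : Type*} [LieRing g] [LieAlgebra K g]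
  {ι : Type*} [Fintype ι] [DecidableEq ι]

structure SB (b : Basis ι K g) (w : ι → ℤ) (χ : g →ₗ[K] K) : Prop where
  hs : ∀ i j k, b.repr ⁅b i, b j⁆ k ≠ 0 → w k = w i + w j
  hχ : ∀ i, χ (b i) ≠ 0 → w i = -2
  hneg : ∀ i j, w i < 0 → w j < 0 → χ ⁅b i, b j⁆ = 0

noncomputable def bb (b : Basis ι K g) (i : ι) : UniversalEnvelopingAlgebra K g :=
  UniversalEnvelopingAlgebra.ι K (b i)

noncomputable def yy (b : Basis ι K g) (χ : g →ₗ[K] K) (i : ι) : UniversalEnvelopingAlgebra K g :=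
  UniversalEnvelopingAlgebra.ι K (b i) - algebraMap K _ (χ (b i))

noncomputable def Y (b : Basis ι K g) (χ : g →ₗ[K] K) (l : List ι) :
    UniversalEnvelopingAlgebra K g := (l.map (yy b χ)).prod

def dg (w : ι → ℤ) (l : List ι) : ℤ := (l.map (fun i => w i + 2)).sum

theorem Y_nil (b : Basis ι K g) (χ : g →ₗ[K] K) : Y b χ [] = 1 := by simp [Y]
theorem Y_cons (b : Basis ι K g) (χ : g →ₗ[K] K) (i l) : Y b χ (i :: l) = yy b χ i * Y b χ l := by
  simp [Y]
theorem Y_append (b : Basis ι K g) (χ : g →ₗ[K] K) (l l') :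
    Y b χ (l ++ l') = Y b χ l * Y b χ l' := by simp [Y]
theorem dg_nil (w : ι → ℤ) : dg w [] = 0 := by simp [dg]
theorem dg_cons (w : ι → ℤ) (i l) : dg w (i :: l) = w i + 2 + dg w l := by simp [dg]
theorem dg_append (w : ι → ℤ) (l l') : dg w (l ++ l') = dg w l + dg w l' := by simp [dg]
theorem dg_perm (w : ι → ℤ) {l l' : List ι} (h : l.Perm l') : dg w l = dg w l' :=
  (h.map _).sum_eq

def PL (b : Basis ι K g) (w : ι → ℤ) (χ : g →ₗ[K] K) (Q : ι → Prop) (q k : ℕ) (n : ℤ) :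
    Submodule K (UniversalEnvelopingAlgebra K g) :=
  Submodule.span K {u | ∃ l : List ι, (∀ i ∈ l, Q i) ∧ q ≤ l.length ∧ l.length < k ∧
    dg w l ≤ n ∧ u = Y b χ l}

variable {b : Basis ι K g} {w : ι → ℤ} {χ : g →ₗ[K] K}

theorem PL_mono {Q : ι → Prop} {q k k' : ℕ} {n n' : ℤ} (hk : k ≤ k') (hn : n ≤ n') :
    PL b w χ Q q k n ≤ PL b w χ Q q k' n' :=
  Submodule.span_mono (by
    rintro _ ⟨l, h1, h2, h3, h4, rfl⟩
    exact ⟨l, h1, h2, by omega, by omega, rfl⟩)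

theorem PL_mul_left {Q : ι → Prop} {q k : ℕ} {n : ℤ} {u} (hu : u ∈ PL b w χ Q q k n)
    (l : List ι) (hl : ∀ i ∈ l, Q i) :
    Y b χ l * u ∈ PL b w χ Q q (l.length + k) (dg w l + n) := by
  induction hu using Submodule.span_induction with
  | mem x h =>
    obtain ⟨l', h1, h2, h3, h4, rfl⟩ := h
    refine Submodule.subset_span ⟨l ++ l', ?_, ?_, ?_, ?_, (Y_append _ _ _ _).symm⟩
    · intro i hi
      rcases List.mem_append.1 hi with h | h
      exacts [hl i h, h1 i h]
    · simp; omega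
    · simp; omega
    · rw [dg_append]; omega
  | zero => simp
  | add x y _ _ hx hy => rw [mul_add]; exact add_mem hx hy
  | smul a x _ hx => rw [mul_smul_comm]; exact Submodule.smul_mem _ _ hx

theorem PL_mul_right {Q : ι → Prop} {q k : ℕ} {n : ℤ} {u} (hu : u ∈ PL b w χ Q q k n)
    (l : List ι) (hl : ∀ i ∈ l, Q i) :
    u * Y b χ l ∈ PL b w χ Q q (l.length + k) (dg w l + n) := by
  induction hu using Submodule.span_induction with
  | mem x h =>
    obtain ⟨l', h1, h2, h3, h4, rfl⟩ := h
    refine Submodule.subset_span ⟨l' ++ l, ?_, ?_, ?_, ?_, (Y_append _ _ _ _).symm⟩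
    · intro i hi
      rcases List.mem_append.1 hi with h | h
      exacts [h1 i h, hl i h]
    · simp; omega
    · simp; omega
    · rw [dg_append]; omega
  | zero => simp
  | add x y _ _ hx hy => rw [add_mul]; exact add_mem hx hy
  | smul a x _ hx => rw [smul_mul_assoc]; exact Submodule.smul_mem _ _ hx

theorem perm_aux {Q : ι → Prop} {q : ℕ}
    (hc : ∀ i j, Q i → Q j → yy b χ i * yy b χ j - yy b χ j * yy b χ i ∈
      PL b w χ Q q 2 (w i + w j + 2))
    {l l' : List ι} (h : l.Perm l') (hl : ∀ i ∈ l, Q i) :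
    Y b χ l - Y b χ l' ∈ PL b w χ Q q l.length (dg w l - 1) := by
  induction h with
  | nil => simp
  | cons x h ih =>
    have h1 := PL_mul_left (ih fun i hi => hl i (List.mem_cons_of_mem _ hi)) [x]
      (by simpa using hl x (by simp))
    rw [Y_cons, Y_cons, ← mul_sub]
    have h2 : Y b χ [x] = yy b χ x := by simp [Y]
    rw [h2] at h1
    refine PL_mono ?_ ?_ h1
    · simp; omega
    · rw [dg_cons, dg_cons, dg_nil]; omega
  | swap x y l =>
    have h1 := PL_mul_right (hc y x (hl y (by simp)) (hl x (by simp))) l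
      (fun i hi => hl i (by simp [hi]))
    rw [Y_cons, Y_cons, Y_cons, Y_cons, ← mul_assoc, ← mul_assoc, ← sub_mul]
    refine PL_mono ?_ ?_ h1
    · simp
    · rw [dg_cons, dg_cons]; omega
  | trans h1 h2 ih1 ih2 =>
    have e1 := ih1 hl
    have e2 := ih2 (fun i hi => hl i (h1.mem_iff.2 hi))
    rw [← h1.length_eq, ← dg_perm w h1] at e2
    have := add_mem e1 e2
    rwa [sub_add_sub_cancel] at this

theorem iota_sum (x : g) : UniversalEnvelopingAlgebra.ι K x = ∑ k, b.repr x k • bb b k := by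
  conv_lhs => rw [← b.sum_repr x, map_sum]
  exact Finset.sum_congr rfl fun k _ => by rw [map_smul]; rfl

theorem bb_lie (i j : ι) : bb b i * bb b j - bb b j * bb b i =
    ∑ k, b.repr ⁅b i, b j⁆ k • bb b k := by
  rw [← iota_sum]
  letI : LieRing (UniversalEnvelopingAlgebra K g) := LieRing.ofAssociativeRing
  exact ((UniversalEnvelopingAlgebra.ι K).map_lie (b i) (b j)).symm

theorem chi_sum (x : g) : χ x = ∑ k, b.repr x k * χ (b k) := by
  conv_lhs => rw [← b.sum_repr x, map_sum]
  exact Finset.sum_congr rfl fun k _ => by rw [map_smul]; rfl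

theorem yy_lie (i j : ι) : yy b χ i * yy b χ j - yy b χ j * yy b χ i =
    ∑ k, b.repr ⁅b i, b j⁆ k • yy b χ k + algebraMap K _ (χ ⁅b i, b j⁆) := by
  have h1 : ∑ k, b.repr ⁅b i, b j⁆ k • yy b χ k =
      ∑ k, b.repr ⁅b i, b j⁆ k • bb b k - algebraMap K _ (χ ⁅b i, b j⁆) := by
    rw [chi_sum (b := b) ⁅b i, b j⁆, map_sum, ← Finset.sum_sub_distrib]
    refine Finset.sum_congr rfl fun k _ => ?_
    rw [yy, smul_sub, map_mul, Algebra.smul_def _ (algebraMap K _ (χ (b k)))]; rfl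
  rw [h1, ← bb_lie, sub_add_cancel]
  have c1 := Algebra.commutes (χ (b i)) (bb b j)
  have c2 := Algebra.commutes (χ (b j)) (bb b i)
  have c3 := Algebra.commutes (χ (b j)) (algebraMap K (UniversalEnvelopingAlgebra K g) (χ (b i)))
  change (bb b i - _) * (bb b j - _) - (bb b j - _) * (bb b i - _) = _
  simp only [mul_sub, sub_mul]
  rw [c1, c2, c3]
  abel

theorem SB.perm (W : SB b w χ) {l l' : List ι} (h : l.Perm l') :
    Y b χ l - Y b χ l' ∈ PL b w χ (fun _ => True) 0 l.length (dg w l - 1) := by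
  refine perm_aux (fun i j _ _ => ?_) h (by simp)
  rw [yy_lie]
  refine add_mem (sum_mem fun k _ => ?_) ?_
  · by_cases hk : b.repr ⁅b i, b j⁆ k = 0
    · rw [hk, zero_smul]; exact zero_mem _
    · refine Submodule.smul_mem _ _ (Submodule.subset_span ⟨[k], by simp, by simp, by simp, ?_, by simp [Y]⟩)
      have := W.hs i j k hk
      rw [dg_cons, dg_nil]; omega
  · by_cases hk : χ ⁅b i, b j⁆ = 0
    · rw [hk, map_zero]; exact zero_mem _
    · rw [Algebra.algebraMap_eq_smul_one]
      refine Submodule.smul_mem _ _ (Submodule.subset_span ⟨[], by simp, by simp, by simp, ?_, by simp [Y]⟩)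
      rw [chi_sum (b := b)] at hk
      obtain ⟨k, _, hk⟩ := Finset.exists_ne_zero_of_sum_ne_zero hk
      have h1 := W.hs i j k (left_ne_zero_of_mul hk)
      have h2 := W.hχ k (right_ne_zero_of_mul hk)
      rw [dg_nil]; omega

theorem SB.perm_neg (W : SB b w χ) {l l' : List ι} (h : l.Perm l') (hl : ∀ i ∈ l, w i < 0) :
    Y b χ l - Y b χ l' ∈ PL b w χ (fun i => w i < 0) 1 l.length (dg w l - 1) := by
  refine perm_aux (fun i j hi hj => ?_) h hl
  rw [yy_lie, W.hneg i j hi hj, map_zero, add_zero]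
  refine sum_mem fun k _ => ?_
  by_cases hk : b.repr ⁅b i, b j⁆ k = 0
  · rw [hk, zero_smul]; exact zero_mem _
  · have := W.hs i j k hk
    refine Submodule.smul_mem _ _ (Submodule.subset_span ⟨[k], by simp; omega, by simp, by simp, ?_, by simp [Y]⟩)
    rw [dg_cons, dg_nil]; omega

/-! normal form -/

noncomputable def cm (w : ι → ℤ) (s : Multiset ι) : List ι :=
  (s.filter (fun i => ¬ w i < 0)).toList ++ (s.filter (fun i => w i < 0)).toList

theorem cm_perm (w : ι → ℤ) (l : List ι) : l.Perm (cm w (l : Multiset ι)) := by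
  rw [← Multiset.coe_eq_coe, cm, ← Multiset.coe_add, Multiset.coe_toList, Multiset.coe_toList,
    add_comm, Multiset.filter_add_not]

theorem cm_coe (w : ι → ℤ) (s : Multiset ι) : ((cm w s : List ι) : Multiset ι) = s := by
  rw [cm, ← Multiset.coe_add, Multiset.coe_toList, Multiset.coe_toList,
    add_comm, Multiset.filter_add_not]

/-- span of normal-ordered monomials -/
def NF (b : Basis ι K g) (w : ι → ℤ) (χ : g →ₗ[K] K) (n : ℤ) :
    Submodule K (UniversalEnvelopingAlgebra K g) :=
  Submodule.span K {u | ∃ s : Multiset ι, dg w (cm w s) ≤ n ∧ u = Y b χ (cm w s)}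

def TF (b : Basis ι K g) (w : ι → ℤ) (χ : g →ₗ[K] K) :
    Submodule K (UniversalEnvelopingAlgebra K g) :=
  Submodule.span K {u | ∃ s : Multiset ι, (∃ i ∈ s, w i < 0) ∧ u = Y b χ (cm w s)}

theorem SB.normal (W : SB b w χ) : ∀ (k : ℕ) (l : List ι) (n : ℤ), l.length < k → dg w l ≤ n →
    Y b χ l ∈ NF b w χ n := by
  intro k
  induction k with
  | zero => intro l n h; omega
  | succ k ih =>
    intro l n hl hd
    have h1 := W.perm (cm_perm w l)
    have h2 : PL b w χ (fun _ => True) 0 l.length (dg w l - 1) ≤ NF b w χ n :=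
      Submodule.span_le.2 (by
        rintro _ ⟨l', _, _, h3, h4, rfl⟩
        exact ih l' n (by omega) (by omega))
    have h3 : Y b χ (cm w (l : Multiset ι)) ∈ NF b w χ n :=
      Submodule.subset_span ⟨_, by rw [← dg_perm w (cm_perm w l)]; exact hd, rfl⟩
    have := add_mem (h2 h1) h3
    rwa [sub_add_cancel] at this

theorem SB.normal_neg (W : SB b w χ) : ∀ (k : ℕ) (l l2 : List ι), l.length + l2.length < k →
    l2 ≠ [] → (∀ i ∈ l2, w i < 0) → Y b χ (l ++ l2) ∈ TF b w χ := by
  intro k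
  induction k with
  | zero => intro l l2 h; omega
  | succ k ih =>
    intro l l2 hl h0 hn
    set P := ((l : Multiset ι).filter (fun i => ¬ w i < 0)).toList with hP
    set G := ((l : Multiset ι).filter (fun i => w i < 0)).toList with hG
    have hlP : l.Perm (P ++ G) := cm_perm w l
    have hGn : ∀ i ∈ G, w i < 0 := by intro i hi; rw [hG] at hi; simp at hi; exact hi.2
    have hPn : ∀ i ∈ P, ¬ w i < 0 := by intro i hi; rw [hP] at hi; simp at hi; simpa using hi.2
    have hlen := hlP.length_eq
    rw [List.length_append] at hlen
    have s1 : (Y b χ l - Y b χ (P ++ G)) * Y b χ l2 ∈ TF b w χ := by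
      have h1 := W.perm hlP
      generalize Y b χ l - Y b χ (P ++ G) = v at h1
      induction h1 using Submodule.span_induction with
      | mem x h =>
        obtain ⟨l', _, _, h3, _, rfl⟩ := h
        rw [← Y_append]
        exact ih l' l2 (by omega) h0 hn
      | zero => simp
      | add x y _ _ hx hy => rw [add_mul]; exact add_mem hx hy
      | smul a x _ hx => rw [smul_mul_assoc]; exact Submodule.smul_mem _ _ hx
    set N := (((l ++ l2 : List ι) : Multiset ι).filter (fun i => w i < 0)).toList with hN
    have hGN : (G ++ l2).Perm N := by
      rw [← Multiset.coe_eq_coe, hN, Multiset.coe_toList, ← Multiset.coe_add, ← Multiset.coe_add,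
        Multiset.filter_add, hG, Multiset.coe_toList]
      congr 1
      exact (Multiset.filter_eq_self.2 (by simpa using hn)).symm
    have s2 : Y b χ P * (Y b χ (G ++ l2) - Y b χ N) ∈ TF b w χ := by
      have h1 := W.perm_neg hGN (by
        intro i hi
        rcases List.mem_append.1 hi with h | h
        exacts [hGn i h, hn i h])
      generalize Y b χ (G ++ l2) - Y b χ N = v at h1
      induction h1 using Submodule.span_induction with
      | mem x h =>
        obtain ⟨l', h1, h2, h3, _, rfl⟩ := h
        rw [← Y_append]
        rw [List.length_append] at h3
        exact ih P l' (by omega) (by rintro rfl; simp at h2) h1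
      | zero => simp
      | add x y _ _ hx hy => rw [mul_add]; exact add_mem hx hy
      | smul a x _ hx => rw [mul_smul_comm]; exact Submodule.smul_mem _ _ hx
    have hcm : cm w ((l ++ l2 : List ι) : Multiset ι) = P ++ N := by
      rw [cm, hN]
      congr 1
      rw [hP, ← Multiset.coe_add, Multiset.filter_add]
      congr 1
      have h9 : Multiset.filter (fun i => ¬ w i < 0) (l2 : Multiset ι) = 0 :=
        Multiset.filter_eq_nil.2 (by simpa using hn)
      rw [h9, add_zero]
    have s3 : Y b χ (P ++ N) ∈ TF b w χ := by
      refine Submodule.subset_span ⟨((l ++ l2 : List ι) : Multiset ι), ?_, by rw [hcm]⟩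
      obtain ⟨i, hi⟩ := List.exists_mem_of_ne_nil _ h0
      exact ⟨i, by simp [hi], hn i hi⟩
    have := add_mem (add_mem s1 s2) s3
    convert this using 1
    rw [Y_append, Y_append, Y_append, Y_append]
    simp only [sub_mul, mul_sub, mul_assoc]
    abel

end B
end KK

set_option linter.all false
namespace KK
open Module MvPolynomial

section B
variable {K : Type*} [Field K] [CharZero K] {g : Type*} [LieRing g] [LieAlgebra K g] [FiniteDimensional K g]
  {ι : Type*} [Fintype ι] [DecidableEq ι]

noncomputable def xx (b : Basis ι K g) (χ : g →ₗ[K] K) (i : ι) : MvPolynomial ι K :=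
  X i - C (χ (b i))

noncomputable def XX (b : Basis ι K g) (χ : g →ₗ[K] K) (l : List ι) :
    MvPolynomial ι K := (l.map (xx b χ)).prod

theorem XX_nil (b : Basis ι K g) (χ : g →ₗ[K] K) : XX b χ [] = 1 := by simp [XX]
theorem XX_cons (b : Basis ι K g) (χ : g →ₗ[K] K) (i l) : XX b χ (i :: l) = xx b χ i * XX b χ l := by
  simp [XX]
theorem XX_append (b : Basis ι K g) (χ : g →ₗ[K] K) (l l') :
    XX b χ (l ++ l') = XX b χ l * XX b χ l' := by simp [XX]

noncomputable def Sym (b : Basis ι K g) (w : ι → ℤ) (χ : g →ₗ[K] K) (n : ℤ) :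
    Submodule K (UniversalEnvelopingAlgebra K g × MvPolynomial ι K) :=
  Submodule.span K {z | (∃ l, dg w l = n ∧ z = (Y b χ l, XX b χ l)) ∨
    (∃ l, dg w l < n ∧ z = (Y b χ l, 0))}

variable {b : Basis ι K g} {w : ι → ℤ} {χ : g →ₗ[K] K}

theorem Sym_l {n : ℤ} (l : List ι) (h : dg w l = n) : (Y b χ l, XX b χ l) ∈ Sym b w χ n :=
  Submodule.subset_span (Or.inl ⟨l, h, rfl⟩)
theorem Sym_r {n : ℤ} (l : List ι) (h : dg w l < n) : (Y b χ l, 0) ∈ Sym b w χ n :=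
  Submodule.subset_span (Or.inr ⟨l, h, rfl⟩)

theorem Sym_mul {n m : ℤ} {u v p q} (h1 : (u, p) ∈ Sym b w χ n) (h2 : (v, q) ∈ Sym b w χ m) :
    (u * v, p * q) ∈ Sym b w χ (n + m) := by
  have h3 : Sym b w χ n * Sym b w χ m ≤ Sym b w χ (n + m) := by
    rw [Sym, Sym, Submodule.span_mul_span]
    refine Submodule.span_le.2 ?_
    rintro _ ⟨_, (⟨l, hl, rfl⟩ | ⟨l, hl, rfl⟩), _, (⟨l', hl', rfl⟩ | ⟨l', hl', rfl⟩), rfl⟩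
    · have := Sym_l (b := b) (χ := χ) (l ++ l') (n := n + m) (by rw [dg_append, hl, hl'])
      rw [Y_append, XX_append] at this
      exact this
    all_goals
      have := Sym_r (b := b) (w := w) (χ := χ) (l ++ l') (n := n + m) (by rw [dg_append]; omega)
      rw [Y_append] at this
      simpa using this
  exact h3 (Submodule.mul_mem_mul h1 h2)

theorem Sym_lt {n m : ℤ} (h : n < m) {u p} (hu : (u, p) ∈ Sym b w χ n) :
    (u, 0) ∈ Sym b w χ m := by
  have : Sym b w χ n ≤ (Sym b w χ m).comap
      ((LinearMap.inl K _ _).comp (LinearMap.fst K (UniversalEnvelopingAlgebra K g) (MvPolynomial ι K))) := by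
    refine Submodule.span_le.2 ?_
    rintro _ (⟨l, hl, rfl⟩ | ⟨l, hl, rfl⟩)
    · exact Sym_r l (by omega)
    · exact Sym_r l (by omega)
  exact this hu

theorem SB.Sym_bb (W : SB b w χ) (i : ι) : (bb b i, X i) ∈ Sym b w χ (w i + 2) := by
  have h1 := Sym_l (b := b) (χ := χ) (w := w) [i] (n := w i + 2) (by simp [dg])
  have h2 : χ (b i) • ((Y b χ [], XX b χ []) : UniversalEnvelopingAlgebra K g × MvPolynomial ι K)
      ∈ Sym b w χ (w i + 2) := by
    by_cases h : χ (b i) = 0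
    · rw [h, zero_smul]; exact zero_mem _
    · exact Submodule.smul_mem _ _ (Sym_l [] (by rw [dg_nil, W.hχ i h]; rfl))
  have := add_mem h1 h2
  convert this using 1
  simp only [Y_cons, Y_nil, XX_cons, XX_nil, yy, xx, bb, mul_one, Prod.smul_mk, Prod.mk_add_mk]
  rw [← Algebra.algebraMap_eq_smul_one, ← Algebra.algebraMap_eq_smul_one, MvPolynomial.algebraMap_eq]
  simp

theorem SB.Sym_ad_l (W : SB b w χ) (i : ι) (l : List ι) :
    (bb b i * Y b χ l - Y b χ l * bb b i, LL b (b i) (XX b χ l)) ∈ Sym b w χ (dg w l + w i) := by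
  induction l with
  | nil => simp only [Y_nil, XX_nil]; simp; exact zero_mem _
  | cons j l ih =>
    have h0 : (bb b i * yy b χ j - yy b χ j * bb b i, LL b (b i) (xx b χ j)) ∈ Sym b w χ (w i + w j + 2) := by
      have e1 : bb b i * yy b χ j - yy b χ j * bb b i = ∑ k, b.repr ⁅b i, b j⁆ k • bb b k := by
        rw [← bb_lie]
        have c1 := Algebra.commutes (χ (b j)) (bb b i)
        change bb b i * (bb b j - _) - (bb b j - _) * bb b i = _
        rw [mul_sub, sub_mul, c1]; abel
      have e2 : LL b (b i) (xx b χ j) = ∑ k, b.repr ⁅b i, b j⁆ k • X k := by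
        rw [xx, map_sub, LL_X, jj_eq, derivation_C, sub_zero]
        exact Finset.sum_congr rfl fun k _ => by rw [smul_eq_C_mul]
      have e3 : (∑ k, b.repr ⁅b i, b j⁆ k • bb b k, ∑ k, b.repr ⁅b i, b j⁆ k • (X k : MvPolynomial ι K))
          = ∑ k, b.repr ⁅b i, b j⁆ k • (bb b k, (X k : MvPolynomial ι K)) := by
        refine Prod.ext ?_ ?_
        · rw [Prod.fst_sum]; rfl
        · rw [Prod.snd_sum]; rfl
      rw [e1, e2, e3]
      refine sum_mem fun k _ => ?_
      by_cases hk : b.repr ⁅b i, b j⁆ k = 0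
      · rw [hk, zero_smul]; exact zero_mem _
      · have := W.Sym_bb k
        rw [W.hs i j k hk] at this
        exact Submodule.smul_mem _ _ this
    have hj := Sym_l (b := b) (χ := χ) (w := w) [j] (n := w j + 2) (by simp [dg])
    have hl := Sym_l (b := b) (χ := χ) (w := w) l rfl
    have h1 := Sym_mul h0 hl
    have h2 := Sym_mul hj ih
    have d1 : w i + w j + 2 + dg w l = dg w (j :: l) + w i := by rw [dg_cons]; ring
    have d2 : w j + 2 + (dg w l + w i) = dg w (j :: l) + w i := by rw [dg_cons]; ring
    rw [d1] at h1
    rw [d2] at h2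
    have := add_mem h1 h2
    convert this using 1
    rw [Prod.mk_add_mk, Y_cons, XX_cons, Derivation.leibniz, Y_cons, Y_nil, XX_cons, XX_nil]
    refine Prod.ext ?_ ?_
    · simp only [mul_sub, sub_mul, mul_one, mul_assoc]; abel
    · simp only [smul_eq_mul, mul_one]; ring

theorem SB.Sym_ad (W : SB b w χ) (i : ι) {n : ℤ} {u p} (hu : (u, p) ∈ Sym b w χ n) :
    (bb b i * u - u * bb b i, LL b (b i) p) ∈ Sym b w χ (n + w i) := by
  have : Sym b w χ n ≤ (Sym b w χ (n + w i)).comap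
      ((LinearMap.mulLeft K (bb b i) - LinearMap.mulRight K (bb b i)).prodMap
        (LL b (b i) : MvPolynomial ι K →ₗ[K] MvPolynomial ι K)) := by
    refine Submodule.span_le.2 ?_
    rintro _ (⟨l, hl, rfl⟩ | ⟨l, hl, rfl⟩)
    · have := W.Sym_ad_l i l
      rw [hl] at this
      simpa using this
    · have := Sym_lt (m := n + w i) (by omega) (W.Sym_ad_l i l)
      simpa using this
  simpa using this hu

def FF (b : Basis ι K g) (w : ι → ℤ) (χ : g →ₗ[K] K) (n : ℤ) :
    Submodule K (UniversalEnvelopingAlgebra K g) :=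
  Submodule.span K {u | ∃ l, dg w l ≤ n ∧ u = Y b χ l}

theorem FF_l {n : ℤ} (l : List ι) (h : dg w l ≤ n) : Y b χ l ∈ FF b w χ n :=
  Submodule.subset_span ⟨l, h, rfl⟩

theorem FF_mono {n m : ℤ} (h : n ≤ m) : FF b w χ n ≤ FF b w χ m :=
  Submodule.span_mono (by rintro _ ⟨l, hl, rfl⟩; exact ⟨l, by omega, rfl⟩)

theorem FF_Sym {n : ℤ} {u} (hu : u ∈ FF b w χ n) : ∃ p, (u, p) ∈ Sym b w χ n := by
  induction hu using Submodule.span_induction with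
  | mem x h =>
    obtain ⟨l, hl, rfl⟩ := h
    rcases hl.lt_or_eq with h | h
    · exact ⟨0, Sym_r l h⟩
    · exact ⟨_, Sym_l l h⟩
  | zero => exact ⟨0, zero_mem _⟩
  | add x y _ _ hx hy =>
    obtain ⟨p, hp⟩ := hx
    obtain ⟨q, hq⟩ := hy
    exact ⟨p + q, add_mem hp hq⟩
  | smul a x _ hx =>
    obtain ⟨p, hp⟩ := hx
    exact ⟨a • p, Submodule.smul_mem _ a hp⟩

theorem FF_Sym0 {n m : ℤ} {u} (hu : u ∈ FF b w χ n) (h : n < m) : (u, 0) ∈ Sym b w χ m := by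
  obtain ⟨p, hp⟩ := FF_Sym hu
  exact Sym_lt h hp

theorem SB.xx_hom (W : SB b w χ) (i : ι) :
    IsWeightedHomogeneous (fun i => w i + 2) (xx b χ i) (w i + 2) := by
  have h1 : IsWeightedHomogeneous (fun i => w i + 2) (X i : MvPolynomial ι K) (w i + 2) :=
    isWeightedHomogeneous_X _ _ _
  have h2 : IsWeightedHomogeneous (fun i => w i + 2) (C (χ (b i)) : MvPolynomial ι K) (w i + 2) := by
    by_cases h : χ (b i) = 0
    · rw [h, map_zero]; exact isWeightedHomogeneous_zero _ _ _
    · rw [W.hχ i h]; exact isWeightedHomogeneous_C _ _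
  exact (weightedHomogeneousSubmodule K _ _).sub_mem h1 h2

theorem SB.Sym_hom (W : SB b w χ) {n : ℤ} {u p} (hu : (u, p) ∈ Sym b w χ n) :
    IsWeightedHomogeneous (fun i => w i + 2) p n := by
  have : Sym b w χ n ≤ (weightedHomogeneousSubmodule K (fun i => w i + 2) n).comap
      (LinearMap.snd K (UniversalEnvelopingAlgebra K g) (MvPolynomial ι K)) := by
    refine Submodule.span_le.2 ?_
    rintro _ (⟨l, rfl, rfl⟩ | ⟨l, hl, rfl⟩)
    · change IsWeightedHomogeneous _ _ _
      dsimp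
      clear hu
      induction l with
      | nil => rw [XX_nil, dg_nil]; exact isWeightedHomogeneous_one _ _
      | cons i l ih => rw [XX_cons, dg_cons]; exact (W.xx_hom i).mul ih
    · exact isWeightedHomogeneous_zero _ _ _
  exact this hu

/-! τ and Λ -/
noncomputable def ta (b : Basis ι K g) (χ : g →ₗ[K] K) : MvPolynomial ι K →ₐ[K] MvPolynomial ι K :=
  aeval (xx b χ)
noncomputable def ti (b : Basis ι K g) (χ : g →ₗ[K] K) : MvPolynomial ι K →ₐ[K] MvPolynomial ι K :=
  aeval (fun i => X i + C (χ (b i)))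

theorem ti_xx (i : ι) : ti b χ (xx b χ i) = X i := by
  rw [xx, map_sub, ti, aeval_X, ← algebraMap_eq, AlgHom.commutes]; simp

theorem ti_ta (p : MvPolynomial ι K) : ti b χ (ta b χ p) = p := by
  have : (ti b χ).comp (ta b χ) = AlgHom.id K _ := by
    refine algHom_ext fun i => ?_
    rw [AlgHom.comp_apply, ta, aeval_X, ti_xx]; rfl
  exact DFunLike.congr_fun this p

theorem ta_ti (p : MvPolynomial ι K) : ta b χ (ti b χ p) = p := by
  have : (ta b χ).comp (ti b χ) = AlgHom.id K _ := by
    refine algHom_ext fun i => ?_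
    rw [AlgHom.comp_apply, ti, aeval_X, map_add, ta, aeval_X, ← algebraMap_eq, AlgHom.commutes, xx]
    simp
  exact DFunLike.congr_fun this p

noncomputable def La (b : Basis ι K g) (w : ι → ℤ) (χ : g →ₗ[K] K) :
    MvPolynomial ι K →ₗ[K] UniversalEnvelopingAlgebra K g :=
  (basisMonomials ι K).constr K (fun m => Y b χ (cm w (Finsupp.toMultiset m)))

theorem La_mon (m : ι →₀ ℕ) (c : K) :
    La b w χ (monomial m c) = c • Y b χ (cm w (Finsupp.toMultiset m)) := by
  have : (monomial m c : MvPolynomial ι K) = c • basisMonomials ι K m := by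
    rw [coe_basisMonomials, smul_monomial, smul_eq_mul, mul_one]
  rw [this, map_smul, La, Basis.constr_basis]

theorem prodX (s : Multiset ι) :
    (s.map (fun i => (X i : MvPolynomial ι K))).prod = monomial (Multiset.toFinsupp s) 1 := by
  induction s using Multiset.induction_on with
  | empty => simp
  | cons i s ih =>
    rw [Multiset.map_cons, Multiset.prod_cons, ih, ← Multiset.singleton_add, map_add,
      Multiset.toFinsupp_singleton, X, monomial_mul, mul_one]

theorem ti_XX (l : List ι) : ti b χ (XX b χ l) = monomial (Multiset.toFinsupp (l : Multiset ι)) 1 := by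
  rw [← prodX, XX, map_list_prod, List.map_map, Multiset.map_coe, Multiset.prod_coe]
  congr 2
  funext i
  exact ti_xx i

theorem ta_mon (m : ι →₀ ℕ) (c : K) :
    ta b χ (monomial m c) = c • XX b χ (cm w (Finsupp.toMultiset m)) := by
  have h := ti_XX (b := b) (χ := χ) (cm w (Finsupp.toMultiset m))
  rw [cm_coe, Finsupp.toMultiset_toFinsupp] at h
  have h2 := congrArg (ta b χ) h
  rw [ta_ti] at h2
  rw [h2, ← map_smul, smul_monomial, smul_eq_mul, mul_one]

theorem dg_cm (m : ι →₀ ℕ) :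
    dg w (cm w (Finsupp.toMultiset m)) = Finsupp.weight (fun i => w i + 2) m := by
  have : dg w (cm w (Finsupp.toMultiset m)) = ((Finsupp.toMultiset m).map (fun i => w i + 2)).sum := by
    conv_rhs => rw [← cm_coe w (Finsupp.toMultiset m)]
    rw [Multiset.map_coe, Multiset.sum_coe]; rfl
  rw [this]
  clear this
  induction m using Finsupp.induction_linear with
  | zero => simp
  | add x y hx hy => rw [map_add, Multiset.map_add, Multiset.sum_add, map_add, hx, hy]
  | single i n => rw [Finsupp.toMultiset_single, Multiset.map_nsmul, Multiset.sum_nsmul, Finsupp.weight_single]; simp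

theorem La_Sym {n : ℤ} {s : MvPolynomial ι K}
    (hs : IsWeightedHomogeneous (fun i => w i + 2) s n) : (La b w χ s, ta b χ s) ∈ Sym b w χ n := by
  have : (La b w χ s, ta b χ s) = ∑ m ∈ s.support,
      coeff m s • (Y b χ (cm w (Finsupp.toMultiset m)), XX b χ (cm w (Finsupp.toMultiset m))) := by
    refine Prod.ext ?_ ?_
    · rw [Prod.fst_sum]
      conv_lhs => rw [as_sum s]
      dsimp
      rw [map_sum]
      exact Finset.sum_congr rfl fun m _ => La_mon _ _
    · rw [Prod.snd_sum]
      conv_lhs => rw [as_sum s]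
      dsimp
      rw [map_sum]
      exact Finset.sum_congr rfl fun m _ => ta_mon _ _
  rw [this]
  refine sum_mem fun m hm => Submodule.smul_mem _ _ (Sym_l _ ?_)
  rw [dg_cm]
  exact hs (mem_support_iff.1 hm)

theorem La_FF {n : ℤ} {s : MvPolynomial ι K}
    (hs : ∀ m, coeff m s ≠ 0 → Finsupp.weight (fun i => w i + 2) m ≤ n) : La b w χ s ∈ FF b w χ n := by
  rw [as_sum s, map_sum]
  refine sum_mem fun m hm => ?_
  rw [La_mon]
  refine Submodule.smul_mem _ _ (FF_l _ ?_)
  rw [dg_cm]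
  exact hs m (mem_support_iff.1 hm)

theorem SB.Sym_La_l (W : SB b w χ) (l : List ι) :
    Y b χ l - La b w χ (ti b χ (XX b χ l)) ∈ FF b w χ (dg w l - 1) := by
  rw [ti_XX, La_mon, one_smul, Multiset.toFinsupp_toMultiset]
  have h2 : PL b w χ (fun _ => True) 0 l.length (dg w l - 1) ≤ FF b w χ (dg w l - 1) := by
    refine Submodule.span_mono ?_
    rintro _ ⟨l', _, _, _, h, rfl⟩
    exact ⟨l', h, rfl⟩
  exact h2 (W.perm (cm_perm w l))

theorem SB.Sym_La (W : SB b w χ) {n : ℤ} {u : UniversalEnvelopingAlgebra K g}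
    {q : MvPolynomial ι K} (hu : (u, q) ∈ Sym b w χ n) :
    u - La b w χ (ti b χ q) ∈ FF b w χ (n - 1) := by
  let T : (UniversalEnvelopingAlgebra K g × MvPolynomial ι K) →ₗ[K] UniversalEnvelopingAlgebra K g :=
      LinearMap.fst K _ _ - (La b w χ ∘ₗ (ti b χ).toLinearMap) ∘ₗ LinearMap.snd K _ _
  have hT : ∀ u q, T (u, q) = u - La b w χ (ti b χ q) := fun u q => rfl
  rw [← hT]
  clear_value T
  have key : Sym b w χ n ≤ (FF b w χ (n - 1)).comap T := by
    refine Submodule.span_le.2 ?_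
    rintro _ (⟨l, hl, rfl⟩ | ⟨l, hl, rfl⟩)
    · rw [SetLike.mem_coe, Submodule.mem_comap, hT, ← hl]
      exact W.Sym_La_l l
    · rw [SetLike.mem_coe, Submodule.mem_comap, hT, map_zero, map_zero, sub_zero]
      exact FF_l l (by omega)
  exact key hu

/-- killing monomials with a negative index -/
noncomputable def nu (K : Type*) [Field K] (w : ι → ℤ) : MvPolynomial ι K →ₐ[K] MvPolynomial ι K :=
  aeval (fun i => if w i < 0 then 0 else X i)

theorem nu_mon (m : ι →₀ ℕ) (c : K) : nu K w (monomial m c) =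
    if (∃ i ∈ m.support, w i < 0) then 0 else monomial m c := by
  rw [nu, aeval_monomial, Finsupp.prod]
  split_ifs with h
  · obtain ⟨i, hi, hw⟩ := h
    rw [Finset.prod_eq_zero hi, mul_zero]
    rw [if_pos hw, zero_pow (Finsupp.mem_support_iff.1 hi)]
  · push Not at h
    rw [monomial_eq, algebraMap_eq, Finsupp.prod]
    congr 1
    refine Finset.prod_congr rfl fun i hi => ?_
    rw [if_neg (not_lt.2 (h i hi))]

theorem nu_coeff (s : MvPolynomial ι K) (m : ι →₀ ℕ) (hm : ¬ ∃ i ∈ m.support, w i < 0) :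
    coeff m (nu K w s) = coeff m s := by
  induction s using MvPolynomial.induction_on' with
  | monomial u a =>
    rw [nu_mon]
    split_ifs with h
    · rw [coeff_zero, coeff_monomial, if_neg]
      rintro rfl; exact hm h
    · rfl
  | add p q hp hq => rw [map_add, coeff_add, coeff_add, hp, hq]

theorem nu_zero {s : MvPolynomial ι K} (hs : ∀ m, coeff m s ≠ 0 → ∃ i ∈ m.support, w i < 0) :
    nu K w s = 0 := by
  rw [as_sum s, map_sum]
  refine Finset.sum_eq_zero fun m hm => ?_
  rw [nu_mon, if_pos (hs m (mem_support_iff.1 hm))]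

theorem nu_La {s : MvPolynomial ι K} (hs : nu K w s = 0) : La b w χ s ∈ TF b w χ := by
  rw [as_sum s, map_sum]
  refine sum_mem fun m hm => ?_
  rw [La_mon]
  refine Submodule.smul_mem _ _ (Submodule.subset_span ⟨_, ?_, rfl⟩)
  by_contra hc
  have h1 : ¬ ∃ i ∈ m.support, w i < 0 := by
    rintro ⟨i, hi, hw⟩
    exact hc ⟨i, by rwa [Finsupp.mem_toMultiset], hw⟩
  have h2 := nu_coeff s m h1
  rw [hs, coeff_zero] at h2
  exact mem_support_iff.1 hm h2.symm

theorem TF_La {u} (hu : u ∈ TF b w χ) : ∃ s : MvPolynomial ι K,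
    (∀ m, coeff m s ≠ 0 → ∃ i ∈ m.support, w i < 0) ∧ u = La b w χ s := by
  induction hu using Submodule.span_induction with
  | mem x h =>
    obtain ⟨s, ⟨i, hi, hw⟩, rfl⟩ := h
    refine ⟨monomial (Multiset.toFinsupp s) 1, ?_, by rw [La_mon, one_smul, Multiset.toFinsupp_toMultiset]⟩
    intro m hm
    rw [coeff_monomial] at hm
    have : Multiset.toFinsupp s = m := by by_contra h; simp [h] at hm
    exact ⟨i, by rw [← this]; simpa using hi, hw⟩
  | zero => exact ⟨0, by simp, by simp⟩
  | add x y _ _ hx hy =>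
    obtain ⟨p, hp, rfl⟩ := hx
    obtain ⟨q, hq, rfl⟩ := hy
    refine ⟨p + q, fun m hm => ?_, by rw [map_add]⟩
    rw [coeff_add] at hm
    by_cases h : coeff m p = 0
    · exact hq m (by simpa [h] using hm)
    · exact hp m h
  | smul a x _ hx =>
    obtain ⟨p, hp, rfl⟩ := hx
    refine ⟨a • p, fun m hm => hp m ?_, by rw [map_smul]⟩
    rw [coeff_smul] at hm
    exact right_ne_zero_of_mul hm

theorem SB.sub_TF (W : SB b w χ) {n : ℤ} {u q} (hu : (u, q) ∈ Sym b w χ n)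
    (hq : nu K w (ti b χ q) = 0) : ∃ v ∈ TF b w χ, u - v ∈ FF b w χ (n - 1) :=
  ⟨_, nu_La hq, W.Sym_La hu⟩

theorem SB.TF_top (W : SB b w χ) {u} (hu : u ∈ TF b w χ) (h0 : u ≠ 0) :
    ∃ N q, q ≠ 0 ∧ nu K w (ti b χ q) = 0 ∧ (u, q) ∈ Sym b w χ N := by
  classical
  obtain ⟨s, hs, rfl⟩ := TF_La hu
  have hs0 : s ≠ 0 := by rintro rfl; simp at h0
  obtain ⟨m0, hm0, hmax⟩ := s.support.exists_max_image (Finsupp.weight (fun i => w i + 2))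
    (by rw [Finset.nonempty_iff_ne_empty]; simpa using hs0)
  set N := Finsupp.weight (fun i => w i + 2) m0 with hN
  set t := weightedHomogeneousComponent (fun i => w i + 2) N s with ht
  have ct : ∀ m, coeff m t = if Finsupp.weight (fun i => w i + 2) m = N then coeff m s else 0 :=
    fun m => coeff_weightedHomogeneousComponent _ _ _
  refine ⟨N, ta b χ t, ?_, ?_, ?_⟩
  · intro h
    have h2 := congrArg (ti b χ) h
    rw [ti_ta, map_zero] at h2
    have h3 := ct m0
    rw [h2, if_pos rfl, coeff_zero] at h3
    exact mem_support_iff.1 hm0 h3.symm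
  · rw [ti_ta]
    refine nu_zero fun m hm => hs m ?_
    rw [ct] at hm
    by_contra h; simp [h] at hm
  · have h1 := La_Sym (b := b) (χ := χ) (weightedHomogeneousComponent_isWeightedHomogeneous (w := fun i => w i + 2) N s)
    have h2 : La b w χ (s - t) ∈ FF b w χ (N - 1) := by
      refine La_FF fun m hm => ?_
      rw [coeff_sub, ct] at hm
      split_ifs at hm with h
      · simp at hm
      · have := hmax m (mem_support_iff.2 (by simpa using hm))
        omega
    have := add_mem h1 (FF_Sym0 h2 (m := N) (by omega))
    convert this using 1
    rw [Prod.mk_add_mk, add_zero, map_sub, ← ht, add_sub_cancel]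

theorem SB.TF_Sym (W : SB b w χ) (hz : ∀ n p, ((0, p) ∈ Sym b w χ n) → p = 0)
    {n : ℤ} {u q} (hu : u ∈ TF b w χ) (hq : (u, q) ∈ Sym b w χ n) : nu K w (ti b χ q) = 0 := by
  by_cases h0 : u = 0
  · subst h0
    rw [hz n q hq]; simp
  obtain ⟨N, q', h1, h2, h3⟩ := W.TF_top hu h0
  rcases lt_trichotomy n N with h | h | h
  · have := sub_mem h3 (Sym_lt h hq)
    rw [Prod.mk_sub_mk, sub_self, sub_zero] at this
    exact absurd (hz _ _ this) h1
  · subst h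
    have := sub_mem h3 hq
    rw [Prod.mk_sub_mk, sub_self] at this
    rw [← sub_eq_zero.1 (hz _ _ this)]; exact h2
  · have := sub_mem hq (Sym_lt h h3)
    rw [Prod.mk_sub_mk, sub_self, sub_zero] at this
    rw [hz _ _ this]; simp

theorem SB.FF_neg (W : SB b w χ) {n : ℤ} (hn : n < 0) {u} (hu : u ∈ FF b w χ n) : u ∈ TF b w χ := by
  have h1 : FF b w χ n ≤ NF b w χ n := Submodule.span_le.2 (by
    rintro _ ⟨l, hl, rfl⟩
    exact W.normal _ l n (Nat.lt_succ_self _) hl)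
  have h2 : NF b w χ n ≤ TF b w χ := Submodule.span_mono (by
    rintro _ ⟨s, hs, rfl⟩
    refine ⟨s, ?_, rfl⟩
    by_contra hc
    push Not at hc
    have : 0 ≤ dg w (cm w s) := by
      refine List.sum_nonneg ?_
      intro x hx
      obtain ⟨i, hi, rfl⟩ := List.mem_map.1 hx
      have : i ∈ s := by rw [← cm_coe w s]; exact hi
      have := hc i this
      omega
    omega)
  exact h2 (h1 hu)

end B
end KK

set_option linter.all false
namespace KK
open Module MvPolynomial

section R
variable {K : Type*} [Field K] {g : Type*} [LieRing g] [LieAlgebra K g]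
  {ι : Type*} [Fintype ι] [DecidableEq ι]

theorem exists_lift {A : Type*} [Ring A] [Algebra K A] (φ : g →ₗ[K] A)
    (h : ∀ x y, φ ⁅x, y⁆ = φ x * φ y - φ y * φ x) :
    ∃ F : UniversalEnvelopingAlgebra K g →ₐ[K] A, ∀ x, F (UniversalEnvelopingAlgebra.ι K x) = φ x := by
  letI : LieRing A := LieRing.ofAssociativeRing
  let ψ : g →ₗ⁅K⁆ A := { φ with map_lie' := fun {x y} => h x y }
  exact ⟨UniversalEnvelopingAlgebra.lift K ψ, fun x => UniversalEnvelopingAlgebra.lift_ι_apply K ψ x⟩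

theorem uea_adjoin (u : UniversalEnvelopingAlgebra K g) :
    u ∈ Algebra.adjoin K (Set.range (UniversalEnvelopingAlgebra.ι K : g → UniversalEnvelopingAlgebra K g)) := by
  set A := Algebra.adjoin K (Set.range (UniversalEnvelopingAlgebra.ι K : g → UniversalEnvelopingAlgebra K g)) with hA
  let φ : g →ₗ[K] A :=
    { toFun := fun x => ⟨UniversalEnvelopingAlgebra.ι K x, Algebra.subset_adjoin ⟨x, rfl⟩⟩
      map_add' := fun x y => Subtype.ext (by simp)
      map_smul' := fun c x => Subtype.ext (by simp) }
  obtain ⟨F, hF⟩ := exists_lift φ (fun x y => Subtype.ext (by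
    letI : LieRing (UniversalEnvelopingAlgebra K g) := LieRing.ofAssociativeRing
    exact (UniversalEnvelopingAlgebra.ι K).map_lie x y))
  have h1 : A.val.comp F = AlgHom.id K _ := by
    refine UniversalEnvelopingAlgebra.hom_ext K ?_
    letI : LieRing (UniversalEnvelopingAlgebra K g) := LieRing.ofAssociativeRing
    refine LieHom.ext fun x => ?_
    change (F (UniversalEnvelopingAlgebra.ι K x) : UniversalEnvelopingAlgebra K g) = UniversalEnvelopingAlgebra.ι K x
    rw [hF]; rfl
  have h2 := DFunLike.congr_fun h1 u
  change (F u : UniversalEnvelopingAlgebra K g) = u at h2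
  rw [← h2]
  exact (F u).2

theorem Y_span (b : Basis ι K g) (χ : g →ₗ[K] K) (u : UniversalEnvelopingAlgebra K g) :
    u ∈ Submodule.span K (Set.range (Y b χ)) := by
  have hone : (1 : UniversalEnvelopingAlgebra K g) ∈ Submodule.span K (Set.range (Y b χ)) :=
    Submodule.subset_span ⟨[], Y_nil _ _⟩
  induction uea_adjoin u using Algebra.adjoin_induction with
  | mem x hx =>
    obtain ⟨x, rfl⟩ := hx
    rw [iota_sum (b := b)]
    refine sum_mem fun k _ => Submodule.smul_mem _ _ ?_
    have h1 : yy b χ k ∈ Submodule.span K (Set.range (Y b χ)) :=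
      Submodule.subset_span ⟨[k], by simp [Y]⟩
    have h2 : bb b k = yy b χ k + χ (b k) • 1 := by
      rw [← Algebra.algebraMap_eq_smul_one, yy, sub_add_cancel]; rfl
    rw [h2]
    exact add_mem h1 (Submodule.smul_mem _ _ hone)
  | algebraMap r =>
    rw [Algebra.algebraMap_eq_smul_one]
    exact Submodule.smul_mem _ _ hone
  | add x y _ _ hx hy => exact add_mem hx hy
  | mul x y _ _ hx hy =>
    have h1 := Submodule.mul_mem_mul hx hy
    rw [Submodule.span_mul_span] at h1
    refine (Submodule.span_mono ?_) h1
    rintro _ ⟨_, ⟨l, rfl⟩, _, ⟨l', rfl⟩, rfl⟩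
    exact ⟨l ++ l', Y_append _ _ _ _⟩

noncomputable def MM (b : Basis ι K g) : g →ₗ[K] Matrix ι ι K :=
  (LinearMap.toMatrix b b).toLinearMap ∘ₗ (LieAlgebra.ad K g : g →ₗ[K] Module.End K g)

theorem MM_apply (b : Basis ι K g) (x : g) (k l : ι) : MM b x k l = b.repr ⁅x, b l⁆ k := by
  simp [MM, LinearMap.toMatrix_apply]

theorem MM_lie (b : Basis ι K g) (x y : g) : MM b ⁅x, y⁆ = MM b x * MM b y - MM b y * MM b x := by
  have : LieAlgebra.ad K g ⁅x, y⁆ = LieAlgebra.ad K g x * LieAlgebra.ad K g y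
      - LieAlgebra.ad K g y * LieAlgebra.ad K g x := by
    ext z; simp
  change LinearMap.toMatrix b b (LieAlgebra.ad K g ⁅x, y⁆) = _
  rw [this, map_sub, LinearMap.toMatrix_mul, LinearMap.toMatrix_mul]; rfl

noncomputable def aa (b : Basis ι K g) : g →ₗ[K] MvPolynomial (ι × ι) K where
  toFun x := ∑ k, ∑ l, MM b x k l • X (k, l)
  map_add' x y := by simp [add_smul, Finset.sum_add_distrib]
  map_smul' c x := by simp [mul_smul, Finset.smul_sum]

theorem aa_eq (b : Basis ι K g) (x : g) : aa b x = ∑ k, ∑ l, MM b x k l • X (k, l) := rfl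

noncomputable def DD (b : Basis ι K g) (x : g) :
    Derivation K (MvPolynomial (ι × ι) K) (MvPolynomial (ι × ι) K) :=
  mkDerivation K (fun p => ∑ j, MM b x j p.1 • X (j, p.2))

theorem DD_X (b : Basis ι K g) (x : g) (k l : ι) :
    DD b x (X (k, l)) = ∑ j, MM b x j k • X (j, l) := mkDerivation_X _ _ _

theorem DD_DD (b : Basis ι K g) (x y : g) (k l : ι) :
    DD b x (DD b y (X (k, l))) = ∑ m, (MM b x * MM b y) m k • X (m, l) := by
  rw [DD_X, map_sum]
  simp only [Derivation.map_smul, DD_X, Finset.smul_sum, Matrix.mul_apply, Finset.sum_smul, smul_smul]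
  rw [Finset.sum_comm]
  refine Finset.sum_congr rfl fun m _ => Finset.sum_congr rfl fun j _ => by rw [mul_comm]

theorem DD_lie (b : Basis ι K g) (x y : g) (p) :
    DD b x (DD b y p) - DD b y (DD b x p) = DD b ⁅x, y⁆ p := by
  have : ⁅DD b x, DD b y⁆ = DD b ⁅x, y⁆ := by
    refine derivation_ext fun ⟨k, l⟩ => ?_
    rw [Derivation.commutator_apply, DD_DD, DD_DD, DD_X, ← Finset.sum_sub_distrib]
    refine Finset.sum_congr rfl fun m _ => ?_
    rw [MM_lie, Matrix.sub_apply, sub_smul]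
  rw [← this, Derivation.commutator_apply]

theorem DD_aa0 (b : Basis ι K g) (x y : g) :
    DD b x (aa b y) = ∑ j, ∑ l, (MM b x * MM b y) j l • X (j, l) := by
  rw [aa_eq]
  simp only [map_sum, Derivation.map_smul, DD_X, Finset.smul_sum, Matrix.mul_apply, Finset.sum_smul, smul_smul]
  rw [Finset.sum_comm]
  have : ∀ l, (∑ k, ∑ j, (MM b y k l * MM b x j k) • (X (j, l) : MvPolynomial (ι × ι) K)) =
     ∑ j, ∑ k, (MM b x j k * MM b y k l) • X (j, l) := by
    intro l
    rw [Finset.sum_comm]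
    exact Finset.sum_congr rfl fun m _ => Finset.sum_congr rfl fun j _ => by rw [mul_comm]
  simp only [this]
  rw [Finset.sum_comm]

theorem DD_aa (b : Basis ι K g) (x y : g) :
    DD b x (aa b y) - DD b y (aa b x) = aa b ⁅x, y⁆ := by
  rw [DD_aa0, DD_aa0, aa_eq, ← Finset.sum_sub_distrib]
  refine Finset.sum_congr rfl fun j _ => ?_
  rw [← Finset.sum_sub_distrib]
  refine Finset.sum_congr rfl fun m _ => ?_
  rw [MM_lie, Matrix.sub_apply, sub_smul]

theorem DD_add (b : Basis ι K g) (x y : g) : DD b (x + y) = DD b x + DD b y := by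
  refine derivation_ext fun ⟨k, l⟩ => ?_
  simp [DD_X, add_smul, Finset.sum_add_distrib]

theorem DD_smul (b : Basis ι K g) (c : K) (x : g) : DD b (c • x) = c • DD b x := by
  refine derivation_ext fun ⟨k, l⟩ => ?_
  simp [DD_X, mul_smul, Finset.smul_sum]

theorem exists_R (b : Basis ι K g) :
    ∃ F : UniversalEnvelopingAlgebra K g →ₐ[K] Module.End K (MvPolynomial (ι × ι) K),
      ∀ x p, F (UniversalEnvelopingAlgebra.ι K x) p = aa b x * p + DD b x p := by
  let φ : g →ₗ[K] Module.End K (MvPolynomial (ι × ι) K) :=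
    { toFun := fun x => LinearMap.mulLeft K (aa b x) + (DD b x : MvPolynomial (ι × ι) K →ₗ[K] MvPolynomial (ι × ι) K)
      map_add' := fun x y => by
        refine LinearMap.ext fun p => ?_
        simp [DD_add, add_mul]; ring
      map_smul' := fun c x => by
        refine LinearMap.ext fun p => ?_
        simp [DD_smul] }
  have hφ : ∀ x p, φ x p = aa b x * p + DD b x p := fun x p => rfl
  obtain ⟨F, hF⟩ := exists_lift φ (fun x y => by
    refine LinearMap.ext fun p => ?_
    rw [LinearMap.sub_apply, Module.End.mul_apply, Module.End.mul_apply]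
    simp only [hφ]
    rw [← DD_aa, ← DD_lie, map_add, map_add, Derivation.leibniz, Derivation.leibniz]
    simp only [smul_eq_mul]
    ring)
  exact ⟨F, fun x p => by rw [hF, hφ]⟩

/-- increasing filtration -/
noncomputable def Fl {σ : Type*} (K : Type*) [Field K] (v : σ → ℤ) (n : ℤ) : Submodule K (MvPolynomial σ K) :=
  Submodule.span K {x | ∃ k ≤ n, IsWeightedHomogeneous v x k}

theorem Fl_mono {σ : Type*} {v : σ → ℤ} {n m : ℤ} (h : n ≤ m) : Fl K v n ≤ Fl K v m :=
  Submodule.span_mono (by rintro x ⟨k, hk, hx⟩; exact ⟨k, by omega, hx⟩)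

theorem Fl_mem {σ : Type*} {v : σ → ℤ} {n : ℤ} {x : MvPolynomial σ K} (h : IsWeightedHomogeneous v x n) :
    x ∈ Fl K v n := Submodule.subset_span ⟨n, le_rfl, h⟩

theorem Fl_mul {σ : Type*} {v : σ → ℤ} {n m : ℤ} {x y : MvPolynomial σ K}
    (h : IsWeightedHomogeneous v x n) (hy : y ∈ Fl K v m) : x * y ∈ Fl K v (m + n) := by
  induction hy using Submodule.span_induction with
  | mem y hy =>
    obtain ⟨k, hk, hy⟩ := hy
    exact Fl_mono (by omega) (Fl_mem (h.mul hy))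
  | zero => simp
  | add a b _ _ ha hb => rw [mul_add]; exact add_mem ha hb
  | smul c a _ ha => rw [mul_smul_comm]; exact Submodule.smul_mem _ _ ha

theorem Fl_der {σ : Type*} [Fintype σ] [DecidableEq σ] {v : σ → ℤ} {δ m : ℤ} {D : Derivation K (MvPolynomial σ K) (MvPolynomial σ K)}
    (hD : ∀ i, IsWeightedHomogeneous v (D (X i)) (v i + δ)) {y : MvPolynomial σ K}
    (hy : y ∈ Fl K v m) : D y ∈ Fl K v (m + δ) := by
  induction hy using Submodule.span_induction with
  | mem y hy =>
    obtain ⟨k, hk, hy⟩ := hy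
    exact Fl_mono (by omega) (Fl_mem (whom_der hD hy))
  | zero => simp
  | add a b _ _ ha hb => rw [map_add]; exact add_mem ha hb
  | smul c a _ ha => rw [Derivation.map_smul]; exact Submodule.smul_mem _ _ ha

theorem Fl_zero {σ : Type*} {v : σ → ℤ} {n m : ℤ} (hnm : m < n) {x : MvPolynomial σ K}
    (h : IsWeightedHomogeneous v x n) (hx : x ∈ Fl K v m) : x = 0 := by
  classical
  have h1 : Fl K v m ≤ LinearMap.ker (weightedHomogeneousComponent v n) := by
    refine Submodule.span_le.2 ?_
    rintro y ⟨k, hk, hy⟩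
    rw [SetLike.mem_coe, LinearMap.mem_ker]
    exact hy.weightedHomogeneousComponent_ne n (by omega)
  have h2 := h1 hx
  rw [LinearMap.mem_ker, h.weightedHomogeneousComponent_same] at h2
  exact h2

end R

section R2
variable {K : Type*} [Field K] [CharZero K] {g : Type*} [LieRing g] [LieAlgebra K g] [FiniteDimensional K g]
  {ι : Type*} [Fintype ι] [DecidableEq ι]
variable {b : Basis ι K g} {w : ι → ℤ} {χ : g →ₗ[K] K}

noncomputable def rh (b : Basis ι K g) : MvPolynomial ι K →ₐ[K] MvPolynomial (ι × ι) K :=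
  aeval (fun i => aa b (b i))

theorem rh_inj (hinj : ∀ x : g, (∀ y : g, ⁅x, y⁆ = 0) → x = 0) {p : MvPolynomial ι K} (hp : rh b p = 0) :
    p = 0 := by
  have hM : LinearMap.ker (MM b) = ⊥ := by
    rw [LinearMap.ker_eq_bot']
    intro x hx
    refine hinj x fun y => ?_
    have : LieAlgebra.ad K g x = 0 := (LinearMap.toMatrix b b).injective (by rw [map_zero]; exact hx)
    simpa using DFunLike.congr_fun this y
  obtain ⟨G, hG⟩ := (MM b).exists_leftInverse_of_injective hM
  let kk : MvPolynomial (ι × ι) K →ₐ[K] MvPolynomial ι K :=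
    aeval (fun p => jj b (G (Matrix.single p.1 p.2 1)))
  have hk : ∀ x, kk (aa b x) = jj b x := by
    intro x
    have h1 : G (MM b x) = x := DFunLike.congr_fun hG x
    conv_rhs => rw [← h1, Matrix.matrix_eq_sum_single (MM b x)]
    rw [aa_eq]
    simp only [map_sum, map_smul]
    refine Finset.sum_congr rfl fun k _ => Finset.sum_congr rfl fun l _ => ?_
    have h2 : Matrix.single k l (MM b x k l) = MM b x k l • Matrix.single k l (1 : K) := by
      rw [Matrix.smul_single, smul_eq_mul, mul_one]
    rw [h2, map_smul, map_smul]
    congr 1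
    simp [kk]
  have h3 : kk.comp (rh b) = AlgHom.id K _ := by
    refine algHom_ext fun i => ?_
    rw [AlgHom.comp_apply, rh, aeval_X, hk, jj_basis]; rfl
  have h4 := DFunLike.congr_fun h3 p
  rw [AlgHom.comp_apply, hp, map_zero] at h4
  exact h4.symm

def vw (w : ι → ℤ) (p : ι × ι) : ℤ := w p.1 - w p.2 + 2

theorem SB.aa_hom (W : SB b w χ) (i : ι) : IsWeightedHomogeneous (vw w) (aa b (b i)) (w i + 2) := by
  rw [aa_eq]
  refine (weightedHomogeneousSubmodule K _ _).sum_mem fun k _ =>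
    (weightedHomogeneousSubmodule K _ _).sum_mem fun l _ => ?_
  by_cases h : MM b (b i) k l = 0
  · rw [h, zero_smul]; exact zero_mem _
  · refine Submodule.smul_mem _ _ ?_
    have h1 : IsWeightedHomogeneous (vw w) (X (k, l) : MvPolynomial (ι × ι) K) (vw w (k, l)) :=
      isWeightedHomogeneous_X _ _ _
    rw [MM_apply] at h
    have h2 := W.hs i l k h
    have h3 : vw w (k, l) = w i + 2 := by simp only [vw]; omega
    rw [h3] at h1
    exact h1

theorem SB.DD_hom (W : SB b w χ) (i : ι) (p : ι × ι) :
    IsWeightedHomogeneous (vw w) (DD b (b i) (X p)) (vw w p + w i) := by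
  obtain ⟨k, l⟩ := p
  rw [DD_X]
  refine (weightedHomogeneousSubmodule K _ _).sum_mem fun j _ => ?_
  by_cases h : MM b (b i) j k = 0
  · rw [h, zero_smul]; exact zero_mem _
  · refine Submodule.smul_mem _ _ ?_
    have h1 : IsWeightedHomogeneous (vw w) (X (j, l) : MvPolynomial (ι × ι) K) (vw w (j, l)) :=
      isWeightedHomogeneous_X _ _ _
    rw [MM_apply] at h
    have h2 := W.hs i k j h
    have h3 : vw w (j, l) = vw w (k, l) + w i := by simp only [vw]; omega
    rw [h3] at h1
    exact h1

theorem SB.rh_hom (W : SB b w χ) {n : ℤ} {p : MvPolynomial ι K}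
    (hp : IsWeightedHomogeneous (fun i => w i + 2) p n) : IsWeightedHomogeneous (vw w) (rh b p) n :=
  whom_aeval (fun i => W.aa_hom i) hp

theorem SB.XX_hom (W : SB b w χ) (l : List ι) :
    IsWeightedHomogeneous (fun i => w i + 2) (XX b χ l) (dg w l) :=
  W.Sym_hom (Sym_l l rfl)

theorem SB.R_l (W : SB b w χ)
    {F : UniversalEnvelopingAlgebra K g →ₐ[K] Module.End K (MvPolynomial (ι × ι) K)}
    (hF : ∀ x p, F (UniversalEnvelopingAlgebra.ι K x) p = aa b x * p + DD b x p) (l : List ι) :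
    F (Y b χ l) 1 - rh b (XX b χ l) ∈ Fl K (vw w) (dg w l - 1) := by
  induction l with
  | nil => rw [Y_nil, XX_nil, map_one F, map_one (rh b), Module.End.one_apply, sub_self]; exact zero_mem _
  | cons i l ih =>
    have h0 : IsWeightedHomogeneous (vw w) (rh b (xx b χ i)) (w i + 2) := W.rh_hom (W.xx_hom i)
    have hy : ∀ p, F (yy b χ i) p = rh b (xx b χ i) * p + DD b (b i) p := by
      intro p
      have e1 : rh b (xx b χ i) = aa b (b i) - C (χ (b i)) := by
        rw [xx, map_sub, rh, aeval_X, ← algebraMap_eq, AlgHom.commutes]; rfl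
      rw [e1, yy, map_sub, LinearMap.sub_apply, hF, AlgHom.commutes, Module.algebraMap_end_apply,
        smul_eq_C_mul]
      ring
    have h1 : rh b (XX b χ l) ∈ Fl K (vw w) (dg w l) := Fl_mem (W.rh_hom (W.XX_hom l))
    have h2 : F (Y b χ l) 1 ∈ Fl K (vw w) (dg w l) := by
      have := add_mem (Fl_mono (m := dg w l) (by omega) ih) h1
      rwa [sub_add_cancel] at this
    have h3 := Fl_mul h0 ih
    have h4 := Fl_der (W.DD_hom i) h2
    have h5 := add_mem (Fl_mono (m := dg w (i :: l) - 1) (by rw [dg_cons]; omega) h3)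
      (Fl_mono (m := dg w (i :: l) - 1) (by rw [dg_cons]; omega) h4)
    convert h5 using 1
    rw [Y_cons, map_mul, Module.End.mul_apply, hy, XX_cons, map_mul]
    ring

theorem SB.Sym_zero (W : SB b w χ) (hinj : ∀ x : g, (∀ y : g, ⁅x, y⁆ = 0) → x = 0) (n : ℤ)
    (p : MvPolynomial ι K) (hp : ((0 : UniversalEnvelopingAlgebra K g), p) ∈ Sym b w χ n) : p = 0 := by
  obtain ⟨F, hF⟩ := exists_R b
  refine rh_inj (b := b) hinj (Fl_zero (n := n) (m := n - 1) (by omega) (W.rh_hom (W.Sym_hom hp)) ?_)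
  let T : (UniversalEnvelopingAlgebra K g × MvPolynomial ι K) →ₗ[K] MvPolynomial (ι × ι) K :=
      (LinearMap.applyₗ 1 ∘ₗ F.toLinearMap) ∘ₗ LinearMap.fst K _ _ - (rh b).toLinearMap ∘ₗ LinearMap.snd K _ _
  have hT : ∀ u q, T (u, q) = F u 1 - rh b q := fun u q => rfl
  clear_value T
  have key : Sym b w χ n ≤ (Fl K (vw w) (n - 1)).comap T := by
    refine Submodule.span_le.2 ?_
    rintro _ (⟨l, hl, rfl⟩ | ⟨l, hl, rfl⟩)
    · rw [SetLike.mem_coe, Submodule.mem_comap, hT, ← hl]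
      exact W.R_l hF l
    · rw [SetLike.mem_coe, Submodule.mem_comap, hT, map_zero, sub_zero]
      have h1 : rh b (XX b χ l) ∈ Fl K (vw w) (dg w l) := Fl_mem (W.rh_hom (W.XX_hom l))
      have := add_mem (Fl_mono (m := dg w l) (by omega) (W.R_l hF l)) h1
      rw [sub_add_cancel] at this
      exact Fl_mono (by omega) this
  have h6 := key hp
  rw [Submodule.mem_comap, hT, map_zero, LinearMap.zero_apply, zero_sub] at h6
  simpa using neg_mem h6

end R2
end KK

set_option linter.all false
namespace KK
open Module MvPolynomial

section Om
variable {K : Type*} [Field K] [CharZero K] {g : Type*} [LieRing g] [LieAlgebra K g] [FiniteDimensional K g]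
  {ι : Type*} [Fintype ι] [DecidableEq ι]

noncomputable def Om (b : Basis ι K g) : ℕ → MvPolynomial ι K →ₗ[K] UniversalEnvelopingAlgebra K g
  | 0 => Algebra.linearMap K _ ∘ₗ lcoeff K 0
  | d + 1 => ((d + 1 : ℕ) : K)⁻¹ • ∑ i, LinearMap.mulLeft K (bb b i) ∘ₗ Om b d ∘ₗ
      (pderiv i : Derivation K (MvPolynomial ι K) (MvPolynomial ι K)).toLinearMap

theorem Om_zero (b : Basis ι K g) (p : MvPolynomial ι K) : Om b 0 p = algebraMap K _ (coeff 0 p) := rfl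

theorem Om_succ (b : Basis ι K g) (d : ℕ) (p : MvPolynomial ι K) :
    Om b (d + 1) p = ((d + 1 : ℕ) : K)⁻¹ • ∑ i, bb b i * Om b d (pderiv i p) := by
  rw [Om, LinearMap.smul_apply, LinearMap.sum_apply]; rfl

theorem pderiv_LL (b : Basis ι K g) (x : g) (k : ι) (p : MvPolynomial ι K) :
    pderiv k (LL b x p) = LL b x (pderiv k p) + ∑ i, b.repr ⁅x, b i⁆ k • pderiv i p := by
  have h : ⁅(pderiv k : Derivation K (MvPolynomial ι K) (MvPolynomial ι K)), LL b x⁆ = ∑ i, b.repr ⁅x, b i⁆ k • (pderiv i : Derivation K (MvPolynomial ι K) (MvPolynomial ι K)) := by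
    refine derivation_ext fun j => ?_
    have e0 : (∑ i, b.repr ⁅x, b i⁆ k • (pderiv i : Derivation K (MvPolynomial ι K) (MvPolynomial ι K))) (X j)
        = ∑ i, b.repr ⁅x, b i⁆ k • pderiv i (X j) := by
      rw [← Derivation.coeFnAddMonoidHom_apply, map_sum, Finset.sum_apply]; rfl
    rw [e0, Derivation.commutator_apply, LL_X, jj_eq, map_sum]
    have e1 : LL b x (pderiv k (X j)) = 0 := by
      rw [pderiv_X]
      by_cases h : k = j
      · subst h; simp
      · rw [Pi.single_eq_of_ne' h]; simp
    rw [e1, sub_zero]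
    have e2 : ∀ i, pderiv k (C (b.repr ⁅x, b j⁆ i) * X i : MvPolynomial ι K) =
        if i = k then C (b.repr ⁅x, b j⁆ i) else 0 := by
      intro i
      rw [pderiv_C_mul, pderiv_X]
      split_ifs with h
      · subst h; simp
      · rw [Pi.single_eq_of_ne h]; simp
    have e3 : ∀ i, b.repr ⁅x, b i⁆ k • pderiv i (X j : MvPolynomial ι K) =
        if i = j then C (b.repr ⁅x, b i⁆ k) else 0 := by
      intro i
      rw [pderiv_X]
      split_ifs with h
      · subst h; simp [smul_eq_C_mul]
      · rw [Pi.single_eq_of_ne' h]; simp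
    simp only [e2, e3, Finset.sum_ite_eq', Finset.mem_univ, if_true]
  have h2 := DFunLike.congr_fun h p
  have e0 : (∑ i, b.repr ⁅x, b i⁆ k • (pderiv i : Derivation K (MvPolynomial ι K) (MvPolynomial ι K))) p
        = ∑ i, b.repr ⁅x, b i⁆ k • pderiv i p := by
      rw [← Derivation.coeFnAddMonoidHom_apply, map_sum, Finset.sum_apply]; rfl
  rw [e0, Derivation.commutator_apply] at h2
  rw [← h2]; abel

theorem LL_coeff0 (b : Basis ι K g) (x : g) (p : MvPolynomial ι K) : coeff 0 (LL b x p) = 0 := by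
  rw [deriv_eq_sum, ← constantCoeff_eq, map_sum]
  refine Finset.sum_eq_zero fun i _ => ?_
  rw [map_mul, LL_X, jj_eq]
  simp

theorem Om_equiv (b : Basis ι K g) (x : ι) (d : ℕ) : ∀ p : MvPolynomial ι K,
    bb b x * Om b d p - Om b d p * bb b x = Om b d (LL b (b x) p) := by
  induction d with
  | zero =>
    intro p
    rw [Om_zero, Om_zero, LL_coeff0, Algebra.commutes]; simp
  | succ d ih =>
    intro p
    rw [Om_succ, Om_succ, mul_smul_comm, smul_mul_assoc, ← smul_sub]
    congr 1
    rw [Finset.mul_sum, Finset.sum_mul, ← Finset.sum_sub_distrib]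
    have h1 : ∀ i, bb b x * (bb b i * Om b d (pderiv i p)) - bb b i * Om b d (pderiv i p) * bb b x
        = bb b i * Om b d (LL b (b x) (pderiv i p))
          + ∑ k, b.repr ⁅b x, b i⁆ k • (bb b k * Om b d (pderiv i p)) := by
      intro i
      have : ∑ k, b.repr ⁅b x, b i⁆ k • (bb b k * Om b d (pderiv i p)) =
          (bb b x * bb b i - bb b i * bb b x) * Om b d (pderiv i p) := by
        rw [bb_lie, Finset.sum_mul]
        exact Finset.sum_congr rfl fun k _ => by rw [smul_mul_assoc]
      rw [this, ← ih]
      simp only [mul_sub, sub_mul, mul_assoc]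
      abel
    have h2 : ∀ k, bb b k * Om b d (pderiv k (LL b (b x) p)) =
        bb b k * Om b d (LL b (b x) (pderiv k p))
          + ∑ i, b.repr ⁅b x, b i⁆ k • (bb b k * Om b d (pderiv i p)) := by
      intro k
      rw [pderiv_LL, map_add, mul_add, map_sum, Finset.mul_sum]
      congr 1
      exact Finset.sum_congr rfl fun i _ => by rw [map_smul, mul_smul_comm]
    simp only [h1, h2]
    rw [Finset.sum_add_distrib, Finset.sum_add_distrib]
    congr 1
    rw [Finset.sum_comm]

variable {b : Basis ι K g} {w : ι → ℤ} {χ : g →ₗ[K] K}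

theorem SB.Om_Sym (W : SB b w χ) (d : ℕ) : ∀ (p : MvPolynomial ι K) (n : ℤ), p.IsHomogeneous d →
    IsWeightedHomogeneous (fun i => w i + 2) p n → (Om b d p, p) ∈ Sym b w χ n := by
  induction d with
  | zero =>
    intro p n h1 h2
    have hp : p = C (coeff 0 p) := totalDegree_eq_zero_iff_eq_C.1 (by
      have := h1.totalDegree_le; omega)
    by_cases h0 : coeff 0 p = 0
    · rw [Om_zero, h0, map_zero]
      rw [h0, map_zero] at hp
      rw [hp]; exact zero_mem _
    · have hn : n = 0 := by
        have := h2 h0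
        rw [map_zero] at this
        exact this.symm
      have := Submodule.smul_mem _ (coeff 0 p) (Sym_l (b := b) (χ := χ) (w := w) [] (n := n) (by rw [dg_nil, hn]))
      convert this using 1
      rw [Y_nil, XX_nil, Prod.smul_mk, ← Algebra.algebraMap_eq_smul_one, ← Algebra.algebraMap_eq_smul_one, Om_zero]
      rw [algebraMap_eq, ← hp]
  | succ d ih =>
    intro p n h1 h2
    have hd : ((d + 1 : ℕ) : K) ≠ 0 := Nat.cast_ne_zero.2 (by omega)
    have h3 : (∑ i, bb b i * Om b d (pderiv i p), ∑ i, X i * pderiv i p) ∈ Sym b w χ n := by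
      have e : (∑ i, bb b i * Om b d (pderiv i p), ∑ i, X i * pderiv i p)
          = ∑ i, (bb b i * Om b d (pderiv i p), X i * pderiv i p) := by
        refine Prod.ext ?_ ?_
        · rw [Prod.fst_sum]
        · rw [Prod.snd_sum]
      rw [e]
      refine sum_mem fun i _ => ?_
      have h4 := Sym_mul (W.Sym_bb i) (ih (pderiv i p) (n - (w i + 2)) (by simpa using h1.pderiv (i := i))
        (h2.pderiv (by ring)))
      have h5 : w i + 2 + (n - (w i + 2)) = n := by ring
      rwa [h5] at h4
    have h6 := Submodule.smul_mem _ ((d + 1 : ℕ) : K)⁻¹ h3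
    convert h6 using 1
    rw [Prod.smul_mk, ← Om_succ, h1.sum_X_mul_pderiv, ← Nat.cast_smul_eq_nsmul K, smul_smul,
      inv_mul_cancel₀ hd, one_smul]

theorem Om_center (b : Basis ι K g) (d : ℕ) {p : MvPolynomial ι K} (hp : ∀ ξ, LL b ξ p = 0) :
    Om b d p ∈ Subalgebra.center K (UniversalEnvelopingAlgebra K g) := by
  rw [Subalgebra.mem_center_iff]
  intro u
  have hx : ∀ i, bb b i * Om b d p = Om b d p * bb b i := fun i => by
    rw [← sub_eq_zero, Om_equiv, hp, map_zero]
  induction uea_adjoin u using Algebra.adjoin_induction with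
  | mem x hx' =>
    obtain ⟨x, rfl⟩ := hx'
    rw [iota_sum (b := b), Finset.mul_sum, Finset.sum_mul]
    exact Finset.sum_congr rfl fun i _ => by rw [smul_mul_assoc, mul_smul_comm, hx]
  | algebraMap r => exact Algebra.commutes _ _
  | add x y _ _ hx hy => rw [add_mul, mul_add, hx, hy]
  | mul x y _ _ hx hy => rw [mul_assoc, hy, ← mul_assoc, hx, mul_assoc]

end Om
end KK

set_option linter.all false
namespace KK
open Module MvPolynomial

section F
variable {K : Type*} [Field K] [IsAlgClosed K] [CharZero K] {g : Type*} [LieRing g] [LieAlgebra K g]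
  [FiniteDimensional K g] [LieAlgebra.IsKilling K g]
  {ι : Type*} [Fintype ι] [DecidableEq ι]
variable {e h f : g} {b : Basis ι K g} {w : ι → ℤ} {i0 : ι}

theorem WB.toSB (W : WB e h f b w i0) : SB b w (killingForm K g e) where
  hs i j k hk := by
    by_contra hc
    refine hk (repr_zero_of_eig W.hw (a := w i + w j) ?_ hc)
    have := eig_add (W.hw i) (W.hw j)
    exact_mod_cast this
  hχ i hi := by
    by_cases h : i = i0
    · rw [h, W.hi0]
    · exact absurd (W.chi i h) hi
  hneg i j hi hj := W.chi_lie hi hj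

theorem WB.sg_nu (W : WB e h f b w i0) (q : MvPolynomial ι K) :
    sg e b w q = nu K w (ti b (killingForm K g e) q) := by
  have : sg e b w = (nu K w).comp (ti b (killingForm K g e)) := by
    refine algHom_ext fun i => ?_
    have e1 : nu K w (C (killingForm K g e (b i))) = C (killingForm K g e (b i)) := by
      rw [← algebraMap_eq, AlgHom.commutes]
    rw [AlgHom.comp_apply, ti, aeval_X, map_add, e1, nu, aeval_X]
    by_cases hi : w i < 0
    · rw [sg_neg hi, if_pos hi, zero_add]
    · rw [sg_pos hi, if_neg hi]
      have : killingForm K g e (b i) = 0 := by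
        by_contra hc
        have := W.toSB.hχ i hc
        omega
      rw [this, map_zero, add_zero]
  rw [this]; rfl

theorem center_triv (K : Type*) [Field K] [CharZero K] {g : Type*} [LieRing g] [LieAlgebra K g]
    [FiniteDimensional K g] [LieAlgebra.IsKilling K g] (x : g) (hx : ∀ y : g, ⁅x, y⁆ = 0) : x = 0 := by
  have h1 : x ∈ LieAlgebra.center K g := by
    rw [LieModule.mem_maxTrivSubmodule]
    intro y
    rw [← lie_skew, hx, neg_zero]
  rw [LieAlgebra.center_eq_bot] at h1
  simpa using h1

theorem WB.hz (W : WB e h f b w i0) (n : ℤ) (p : MvPolynomial ι K)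
    (hp : ((0 : UniversalEnvelopingAlgebra K g), p) ∈ Sym b w (killingForm K g e) n) : p = 0 :=
  W.toSB.Sym_zero (center_triv K) n p hp

theorem WB.inj (W : WB e h f b w i0) {z : UniversalEnvelopingAlgebra K g}
    (hz : z ∈ Subalgebra.center K (UniversalEnvelopingAlgebra K g))
    (hT : z ∈ TF b w (killingForm K g e)) : z = 0 := by
  by_contra h0
  obtain ⟨N, q, hq, hn, hs⟩ := W.toSB.TF_top hT h0
  refine hq (W.E_inj (P := q) ?_ (by rw [W.sg_nu, hn]))
  have h1 : ∀ i, LL b (b i) q = 0 := by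
    intro i
    have h2 := W.toSB.Sym_ad i hs
    rw [(Subalgebra.mem_center_iff.1 hz (bb b i)), sub_self] at h2
    exact W.hz _ _ h2
  intro ξ
  rw [LL_sum]
  exact Finset.sum_eq_zero fun i _ => by rw [h1, smul_zero]

theorem WB.TF_ad (W : WB e h f b w i0) {i : ι} (hi : w i < 0)
    (hl : ∀ (a u : UniversalEnvelopingAlgebra K g), u ∈ TF b w (killingForm K g e) →
      a * u ∈ TF b w (killingForm K g e))
    (hr : ∀ (a : UniversalEnvelopingAlgebra K g), a * yy b (killingForm K g e) i ∈ TF b w (killingForm K g e))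
    {u} (hu : u ∈ TF b w (killingForm K g e)) :
    bb b i * u - u * bb b i ∈ TF b w (killingForm K g e) := by
  have h1 := hl (bb b i) u hu
  have h2 := hr u
  have h3 := Submodule.smul_mem _ (killingForm K g e (b i)) hu
  have e1 : u * bb b i = u * yy b (killingForm K g e) i + killingForm K g e (b i) • u := by
    rw [yy, mul_sub, ← Algebra.commutes, ← Algebra.smul_def, sub_add_cancel]; rfl
  rw [e1]
  exact sub_mem h1 (add_mem h2 h3)

theorem WB.surjF (W : WB e h f b w i0)
    (hl : ∀ (a u : UniversalEnvelopingAlgebra K g), u ∈ TF b w (killingForm K g e) →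
      a * u ∈ TF b w (killingForm K g e))
    (hr : ∀ i, w i < 0 → ∀ (a : UniversalEnvelopingAlgebra K g),
      a * yy b (killingForm K g e) i ∈ TF b w (killingForm K g e)) (n : ℕ) :
    ∀ a ∈ FF b w (killingForm K g e) ((n : ℤ) - 1),
      (∀ i, w i < 0 → bb b i * a - a * bb b i ∈ TF b w (killingForm K g e)) →
      ∃ z ∈ Subalgebra.center K (UniversalEnvelopingAlgebra K g), a - z ∈ TF b w (killingForm K g e) := by
  induction n with
  | zero =>
    intro a ha _
    exact ⟨0, zero_mem _, by rw [sub_zero]; exact W.toSB.FF_neg (n := (0 : ℕ) - 1) (by simp) ha⟩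
  | succ n ih =>
    intro a ha hinv
    obtain ⟨q, hq⟩ := FF_Sym ha
    have e0 : ((n + 1 : ℕ) : ℤ) - 1 = n := by push_cast; ring
    rw [e0] at hq
    have h1 : ∀ i, w i < 0 → sg e b w (LL b (b i) q) = 0 := by
      intro i hi
      rw [W.sg_nu]
      exact W.toSB.TF_Sym W.hz (hinv i hi) (W.toSB.Sym_ad i hq)
    obtain ⟨P, hP, hsg, hPn, d, hPd⟩ := W.E_main (W.toSB.Sym_hom hq) h1
    have hzc := Om_center b d hP
    have hzs := W.toSB.Om_Sym d P n hPd hPn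
    have hsub := sub_mem hq hzs
    rw [Prod.mk_sub_mk] at hsub
    obtain ⟨v, hv, hav⟩ := W.toSB.sub_TF hsub (by rw [← W.sg_nu, map_sub, hsg, sub_self])
    obtain ⟨z', hz', hfin⟩ := ih _ hav (by
      intro i hi
      have c1 := Subalgebra.mem_center_iff.1 hzc (bb b i)
      have c2 := W.TF_ad hi hl (hr i hi) hv
      have c3 := sub_mem (hinv i hi) c2
      convert c3 using 1
      simp only [mul_sub, sub_mul, c1]
      abel)
    refine ⟨Om b d P + z', add_mem hzc hz', ?_⟩
    have := add_mem hfin hv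
    convert this using 1
    abel

end F
end KK

open KK
/-- Assume `e` is a principal nilpotent element, i.e. `dim ker(ad e)` equals
the rank of `g` (the dimension of a Cartan subalgebra). Then `g(i) = 0` for every odd `i`,
and, setting `m := ⊕_{i < 0} g(i)`, the natural linear map `Z(U) → U/U·m_χ` (inclusion of
the center followed by the quotient map) is injective with image equal to the invariant
subspace `{a + U·m_χ : [ξ, a] ∈ U·m_χ for all ξ ∈ m}`; in particular the W-algebra
`U(g,e) = (U/U·m_χ)^{ad m}` is isomorphic to the center `Z(U)`. -/
theorem kostant_principal_case
    (K : Type*) [Field K] [IsAlgClosed K] [CharZero K]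
    (g : Type*) [LieRing g] [LieAlgebra K g] [FiniteDimensional K g]
    [LieAlgebra.IsSemisimple K g]
    (e h f : g) (he : e ≠ 0)
    (hhe : ⁅h, e⁆ = (2 : K) • e) (hhf : ⁅h, f⁆ = (-2 : K) • f) (hef : ⁅e, f⁆ = h)
    (hprin : ∀ H : LieSubalgebra K g, H.IsCartanSubalgebra →
      Module.finrank K (LinearMap.ker (LieAlgebra.ad K g e)) = Module.finrank K H)
    (m : Submodule K g)
    (hm : m = ⨆ i : ℤ, ⨆ _ : i < 0,
      Module.End.eigenspace (LieAlgebra.ad K g h) (i : K))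
    (I : Submodule (UniversalEnvelopingAlgebra K g) (UniversalEnvelopingAlgebra K g))
    (hI : I = Submodule.span (UniversalEnvelopingAlgebra K g)
      {u : UniversalEnvelopingAlgebra K g | ∃ ξ ∈ m,
        u = UniversalEnvelopingAlgebra.ι K ξ -
          algebraMap K (UniversalEnvelopingAlgebra K g) (killingForm K g e ξ)}) :
    -- all odd weight spaces vanish
    (∀ i : ℤ, Odd i → Module.End.eigenspace (LieAlgebra.ad K g h) (i : K) = ⊥) ∧
    -- the map `Z(U) → U/U·m_χ` is injective ...
    (∀ z ∈ Subalgebra.center K (UniversalEnvelopingAlgebra K g), z ∈ I → z = 0) ∧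
    -- ... with image exactly the `ad m`-invariants of `U/U·m_χ`
    (∀ a : UniversalEnvelopingAlgebra K g,
      (∀ ξ ∈ m, UniversalEnvelopingAlgebra.ι K ξ * a -
          a * UniversalEnvelopingAlgebra.ι K ξ ∈ I) ↔
      ∃ z ∈ Subalgebra.center K (UniversalEnvelopingAlgebra K g), a - z ∈ I) := by
  classical
  haveI : LieAlgebra.IsKilling K g := LieAlgebra.HasTrivialRadical.instIsKilling K g
  obtain ⟨N, b, w, i0, W⟩ := exists_WB he hhe hhf hef hprin
  have hbm : ∀ i, w i < 0 → b i ∈ m := by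
    intro i hi
    rw [hm]
    refine Submodule.mem_iSup_of_mem (w i) (Submodule.mem_iSup_of_mem hi ?_)
    rw [Module.End.mem_eigenspace_iff]
    exact W.hw i
  have hmr : ∀ ξ ∈ m, ∀ i, ¬ w i < 0 → b.repr ξ i = 0 := by
    intro ξ hξ i hi
    have hle : m ≤ LinearMap.ker (b.coord i) := by
      rw [hm]
      refine iSup_le fun a => iSup_le fun ha => ?_
      intro x hx
      rw [Module.End.mem_eigenspace_iff] at hx
      rw [LinearMap.mem_ker, Module.Basis.coord_apply]
      exact repr_zero_of_eig W.hw (a := a) hx (by omega)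
    exact hle hξ
  have hgen : ∀ ξ ∈ m, UniversalEnvelopingAlgebra.ι K ξ -
      algebraMap K (UniversalEnvelopingAlgebra K g) (killingForm K g e ξ) =
      ∑ i, b.repr ξ i • yy b (killingForm K g e) i := by
    intro ξ hξ
    rw [iota_sum (b := b), chi_sum (b := b) (χ := killingForm K g e) ξ, map_sum, ← Finset.sum_sub_distrib]
    refine Finset.sum_congr rfl fun k _ => ?_
    rw [yy, smul_sub, map_mul, Algebra.smul_def _ (algebraMap K _ (killingForm K g e (b k)))]; rfl
  have hYI : ∀ i, w i < 0 → yy b (killingForm K g e) i ∈ I := by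
    intro i hi
    rw [hI]
    exact Submodule.subset_span ⟨b i, hbm i hi, rfl⟩
  have hr : ∀ i, w i < 0 → ∀ (a : UniversalEnvelopingAlgebra K g),
      a * yy b (killingForm K g e) i ∈ TF b w (killingForm K g e) := by
    intro i hi a
    have ha := Y_span b (killingForm K g e) a
    induction ha using Submodule.span_induction with
    | mem x hx =>
      obtain ⟨l, rfl⟩ := hx
      have := W.toSB.normal_neg _ l [i] (Nat.lt_succ_self _) (by simp) (by simpa using hi)
      rw [Y_append] at this
      simpa [Y] using this
    | zero => simp
    | add x y _ _ hx hy => rw [add_mul]; exact add_mem hx hy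
    | smul c x _ hx => rw [smul_mul_assoc]; exact Submodule.smul_mem _ _ hx
  have hIT' : ∀ u ∈ I, ∀ a : UniversalEnvelopingAlgebra K g, a * u ∈ TF b w (killingForm K g e) := by
    intro u hu
    rw [hI] at hu
    induction hu using Submodule.span_induction with
    | mem x hx =>
      obtain ⟨ξ, hξ, rfl⟩ := hx
      intro a
      rw [hgen ξ hξ, Finset.mul_sum]
      refine sum_mem fun i _ => ?_
      by_cases hi : w i < 0
      · rw [mul_smul_comm]; exact Submodule.smul_mem _ _ (hr i hi a)
      · rw [hmr ξ hξ i hi, zero_smul, mul_zero]; exact zero_mem _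
    | zero => intro a; rw [mul_zero]; exact zero_mem _
    | add x y _ _ hx hy => intro a; rw [mul_add]; exact add_mem (hx a) (hy a)
    | smul c x _ hx => intro a; rw [smul_eq_mul, ← mul_assoc]; exact hx _
  have hTI' : ∀ u ∈ TF b w (killingForm K g e), u ∈ I := by
    intro u hu
    induction hu using Submodule.span_induction with
    | mem x hx =>
      obtain ⟨s, ⟨i, hi, hw⟩, rfl⟩ := hx
      rw [cm, Y_append]
      set L := (s.filter (fun i => w i < 0)).toList with hL
      have hLn : ∀ j ∈ L, w j < 0 := by
        intro j hj
        rw [hL] at hj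
        simp at hj
        exact hj.2
      have hL0 : L ≠ [] := by
        have : i ∈ L := by rw [hL]; simp [hi, hw]
        exact List.ne_nil_of_mem this
      rw [← List.dropLast_append_getLast hL0, Y_append, ← mul_assoc]
      have h1 : Y b (killingForm K g e) [L.getLast hL0] = yy b (killingForm K g e) (L.getLast hL0) := by
        simp [Y]
      rw [h1]
      exact I.smul_mem _ (hYI _ (hLn _ (List.getLast_mem hL0)))
    | zero => exact zero_mem _
    | add x y _ _ hx hy => exact add_mem hx hy
    | smul c x _ hx =>
      rw [Algebra.smul_def]
      exact I.smul_mem _ hx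
  have hIT : ∀ u, u ∈ I ↔ u ∈ TF b w (killingForm K g e) :=
    fun u => ⟨fun hu => by simpa using hIT' u hu 1, hTI' u⟩
  have hl : ∀ (a u : UniversalEnvelopingAlgebra K g), u ∈ TF b w (killingForm K g e) →
      a * u ∈ TF b w (killingForm K g e) := fun a u hu => hIT' u (hTI' u hu) a
  refine ⟨?_, ?_, ?_⟩
  · intro i hi
    rw [eq_bot_iff]
    intro x hx
    rw [Module.End.mem_eigenspace_iff] at hx
    rw [Submodule.mem_bot]
    refine b.repr.map_eq_zero_iff.1 (Finsupp.ext fun j => ?_)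
    refine repr_zero_of_eig W.hw (a := i) hx ?_
    intro hj
    have := W.even j
    rw [hj] at this
    exact (Int.not_even_iff_odd.2 hi) this
  · intro z hz hzI
    exact W.inj hz ((hIT z).1 hzI)
  · intro a
    constructor
    · intro ha
      have hF : ∃ n : ℕ, a ∈ FF b w (killingForm K g e) ((n : ℤ) - 1) := by
        have hs := Y_span b (killingForm K g e) a
        clear ha
        induction hs using Submodule.span_induction with
        | mem x hx =>
          obtain ⟨l, rfl⟩ := hx
          exact ⟨(dg w l).toNat + 1, FF_l l (by push_cast; omega)⟩
        | zero => exact ⟨0, zero_mem _⟩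
        | add x y _ _ hx hy =>
          obtain ⟨n1, h1⟩ := hx
          obtain ⟨n2, h2⟩ := hy
          exact ⟨n1 + n2, add_mem (FF_mono (by push_cast; omega) h1) (FF_mono (by push_cast; omega) h2)⟩
        | smul c x _ hx =>
          obtain ⟨n1, h1⟩ := hx
          exact ⟨n1, Submodule.smul_mem _ _ h1⟩
      obtain ⟨n, hn⟩ := hF
      obtain ⟨z, hz, hzT⟩ := W.surjF hl hr n a hn (fun i hi => (hIT _).1 (ha (b i) (hbm i hi)))
      exact ⟨z, hz, (hIT _).2 hzT⟩
    · rintro ⟨z, hz, hza⟩ ξ hξ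
      have c1 := Subalgebra.mem_center_iff.1 hz (UniversalEnvelopingAlgebra.ι K ξ)
      have e1 : UniversalEnvelopingAlgebra.ι K ξ * a - a * UniversalEnvelopingAlgebra.ι K ξ =
          UniversalEnvelopingAlgebra.ι K ξ * (a - z) -
          ((a - z) * (UniversalEnvelopingAlgebra.ι K ξ - algebraMap K _ (killingForm K g e ξ)) +
            algebraMap K _ (killingForm K g e ξ) * (a - z)) := by
        rw [mul_sub (a - z), ← Algebra.commutes (killingForm K g e ξ) (a - z), sub_add_cancel,
          mul_sub, sub_mul, c1]
        abel
      rw [e1]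
      have h1 : UniversalEnvelopingAlgebra.ι K ξ - algebraMap K _ (killingForm K g e ξ) ∈ I := by
        rw [hI]
        exact Submodule.subset_span ⟨ξ, hξ, rfl⟩
      exact sub_mem (I.smul_mem _ hza) (add_mem (I.smul_mem _ h1) (I.smul_mem _ hza))
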